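/- Suppose T : Ω → closure(Ω) satisfies hypotheses (H0)–(H6). Then there exists ε_* > 0 such that for every T-invariant probability measure μ absolutely continuous with respect to Lebesgue measure, with density h, there exist an open ball B ⊆ Ω of radius ε_*/2 and a constant c > 0 with h ≥ c m-almost everywhere on B. In particular, every ergodic component of Lebesgue measure (every T-invariant set of positive Lebesgue measure that cannot be decomposed, mod m, into two T-invariant sets of positive Lebesgue measure) coincides with an open set up to an m-null set. -/

import Mathlib

open MeasureTheory Set Filter Topology
open scoped ENNReal NNReal Classical

noncomputable section

namespace Liverani

/-- The divergence of a vector field on `ℝ^d`. -/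
def divg {d : ℕ} (φ : (Fin d → ℝ) → (Fin d → ℝ)) (x : Fin d → ℝ) : ℝ :=
  ∑ j, fderiv ℝ φ x (Pi.single j 1) j

/-- Test vector fields: `C¹`, compactly supported, sup-norm `≤ 1`. -/
def IsTest (d : ℕ) (φ : (Fin d → ℝ) → (Fin d → ℝ)) : Prop :=
  ContDiff ℝ 1 φ ∧ HasCompactSupport φ ∧ ∀ x, ‖φ x‖ ≤ 1

/-- The BV seminorm on `ℝ^d`, extended-real valued. -/
def bvNormE {d : ℕ} (h : (Fin d → ℝ) → ℝ) : ℝ≥0∞ :=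
  ⨆ φ : {φ : (Fin d → ℝ) → (Fin d → ℝ) // IsTest d φ},
    ENNReal.ofReal (∫ x, h x * divg φ.1 x)

/-- The BV seminorm, real valued. -/
def bvNorm {d : ℕ} (h : (Fin d → ℝ) → ℝ) : ℝ := (bvNormE h).toReal

/-- Membership in `BV(ℝ^d)`. -/
def MemBV {d : ℕ} (h : (Fin d → ℝ) → ℝ) : Prop :=
  Integrable h volume ∧ bvNormE h < ⊤

/-- The BV seminorm on a set `Ω` (of the extension of `h` by zero), extended-real valued. -/
def bvNormOnE {d : ℕ} (Ω : Set (Fin d → ℝ)) (h : (Fin d → ℝ) → ℝ) : ℝ≥0∞ :=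
  bvNormE (Ω.indicator h)

/-- The BV norm on a set `Ω`. -/
def bvNormOn {d : ℕ} (Ω : Set (Fin d → ℝ)) (h : (Fin d → ℝ) → ℝ) : ℝ :=
  bvNorm (Ω.indicator h)

/-- Membership in `BV(Ω)`: the extension by zero belongs to `BV(ℝ^d)`. -/
def MemBVOn {d : ℕ} (Ω : Set (Fin d → ℝ)) (h : (Fin d → ℝ) → ℝ) : Prop :=
  MemBV (Ω.indicator h)

/-- One-dimensional BV seminorm (for slices). -/
def bvNorm1E (g : ℝ → ℝ) : ℝ≥0∞ :=
  ⨆ φ : {φ : ℝ → ℝ // ContDiff ℝ 1 φ ∧ HasCompactSupport φ ∧ ∀ y, |φ y| ≤ 1},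
    ENNReal.ofReal (∫ y, g y * deriv φ.1 y)

/-- The matrix norm `‖A‖_∞ = max_i Σ_j |A i j|`. -/
def matNorm {d : ℕ} (A : Matrix (Fin d) (Fin d) ℝ) : ℝ :=
  NNReal.toReal (Finset.univ.sup fun i => ∑ j, ‖A i j‖₊)

/-- The Jacobian matrix `DT` of a map `T` computed via `fderiv`. -/
def jac {d : ℕ} (T : (Fin d → ℝ) → (Fin d → ℝ)) (x : Fin d → ℝ) :
    Matrix (Fin d) (Fin d) ℝ :=
  Matrix.of fun i j => fderiv ℝ T x (Pi.single j 1) i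

/-- The inverse Jacobian matrix `(DT)⁻¹`. -/
def jacInv {d : ℕ} (T : (Fin d → ℝ) → (Fin d → ℝ)) (x : Fin d → ℝ) :
    Matrix (Fin d) (Fin d) ℝ :=
  (jac T x)⁻¹

/-- Entrywise partial derivative `∂_{x_j} (DT)⁻¹` of the inverse Jacobian along the
`j`-th coordinate. -/
def jacDj {d : ℕ} (T : (Fin d → ℝ) → (Fin d → ℝ)) (j : Fin d) (z : Fin d → ℝ) :
    Matrix (Fin d) (Fin d) ℝ :=
  Matrix.of fun i i' => deriv (fun y => jacInv T (Function.update z j y) i i') (z j)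

/-- The transfer operator `(L h)(x) = Σ_{y ∈ Ω ∩ T⁻¹{x}} |det D_y T|⁻¹ h(y)`. -/
def transferOp {d : ℕ} (Ω : Set (Fin d → ℝ)) (T : (Fin d → ℝ) → (Fin d → ℝ))
    (h : (Fin d → ℝ) → ℝ) (x : Fin d → ℝ) : ℝ :=
  ∑' y : ↥(Ω ∩ T ⁻¹' {x}), |(jac T y).det|⁻¹ * h y

/-- `Ω_k^ε`, the part of `U` at distance at least `ε` from its boundary. -/
def innerPart {d : ℕ} (U : Set (Fin d → ℝ)) (ε : ℝ) : Set (Fin d → ℝ) :=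
  {x ∈ U | ε ≤ Metric.infDist x (frontier U)}

/-- `∂^ε Ω_k`, the `ε`-boundary layer of `U`. -/
def bLayer {d : ℕ} (U : Set (Fin d → ℝ)) (ε : ℝ) : Set (Fin d → ℝ) :=
  U \ innerPart U ε

/-- `Γ_ε = ∪_k ∂^ε Ω_k`. -/
def Gam {d : ℕ} (parts : ℕ → Set (Fin d → ℝ)) (ε : ℝ) : Set (Fin d → ℝ) :=
  ⋃ k, bLayer (parts k) ε

/-- A piecewise expanding system: the data `Ω, T, {Ω_k}, {I_{k,ℓ}}, δ, λ` together with
hypotheses (H0)–(H5). -/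
structure PES (d : ℕ) where
  Ω : Set (Fin d → ℝ)
  T : (Fin d → ℝ) → (Fin d → ℝ)
  parts : ℕ → Set (Fin d → ℝ)
  Ifam : Fin d → (Fin d → ℝ) → ℕ → ℕ → Set ℝ
  δ : ℝ
  lam : ℝ
  Ω_open : IsOpen Ω
  Ω_subset : Ω ⊆ Set.Icc 0 1
  T_maps : Set.MapsTo T Ω (closure Ω)
  /-- (H0) -/
  h0 : ∀ n : ℕ, volume (T^[n] ⁻¹' frontier Ω) = 0
  /-- (H1) -/
  parts_open : ∀ k, IsOpen (parts k)
  parts_conn : ∀ k, IsPreconnected (parts k)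
  parts_disj : Pairwise (Function.onFun Disjoint parts)
  parts_union : ⋃ k, parts k = Ω
  T_C2 : ∀ k, ContDiffOn ℝ 2 T (parts k)
  T_inv : ∀ k, ∃ S : (Fin d → ℝ) → (Fin d → ℝ),
    ContDiffOn ℝ 1 S (T '' parts k) ∧ ∀ x ∈ parts k, S (T x) = x
  /-- (H2): continuous extension of `T` to the closure of each `Ω_k` -/
  h2T : ∀ k, ∃ g : (Fin d → ℝ) → (Fin d → ℝ),
    ContinuousOn g (closure (parts k)) ∧ Set.EqOn g T (parts k)
  /-- (H2): continuous extension of `(DT)⁻¹` to the closure of each `Ω_k` -/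
  h2D : ∀ k, ∃ G : (Fin d → ℝ) → Matrix (Fin d) (Fin d) ℝ,
    ContinuousOn G (closure (parts k)) ∧ Set.EqOn G (jacInv T) (parts k)
  /-- (H3): the slice structure -/
  δ_pos : 0 < δ
  lam_gt_one : 1 < lam
  Ifam_indep : ∀ (j : Fin d) (x x' : Fin d → ℝ) (k ℓ : ℕ),
    (∀ i, i ≠ j → x i = x' i) → Ifam j x k ℓ = Ifam j x' k ℓ
  Ifam_open : ∀ j x k ℓ, IsOpen (Ifam j x k ℓ)
  Ifam_conn : ∀ j x k ℓ, IsPreconnected (Ifam j x k ℓ)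
  Ifam_disj : ∀ j x k, Pairwise (Function.onFun Disjoint (Ifam j x k))
  Ifam_union : ∀ j x k, {y : ℝ | Function.update x j y ∈ parts k} = ⋃ ℓ, Ifam j x k ℓ
  h3 : ∀ x ∈ Set.Icc (0 : Fin d → ℝ) 1, ∀ j : Fin d,
    (∑' p : ℕ × ℕ,
      if (Set.Icc (x j - δ) (x j + δ) ∩ Ifam j x p.1 p.2).Nonempty then
        ⨆ y ∈ Ifam j x p.1 p.2,
          ENNReal.ofReal (matNorm (jacInv T (Function.update x j y)))
      else 0) ≤ ENNReal.ofReal lam⁻¹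
  /-- (H4) -/
  h4 : ∀ j : Fin d,
    Filter.Tendsto (fun ε : ℝ =>
      ⨆ x : Fin d → ℝ, ∑' k : ℕ, ∫⁻ y in Set.Icc (0:ℝ) 1,
        Set.indicator (bLayer (parts k) ε)
          (fun z => ENNReal.ofReal (matNorm (jacDj T j z)))
          (Function.update x j y))
      (nhdsWithin 0 (Set.Ioi 0)) (nhds 0)
  /-- (H5) -/
  h5 : ∀ i j k : Fin d,
    MeasureTheory.IntegrableOn (fun x => jac T x k j * jacInv T x j i) Ω volume

/-- A piecewise expanding system satisfying in addition hypothesis (H6). -/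
structure PES6 (d : ℕ) extends PES d where
  Cb : ℝ
  αb : ℝ
  ab : ℝ
  Cb_pos : 0 < Cb
  αb_mem : αb ∈ Set.Ioc (0:ℝ) 1
  ab_ge_one : 1 ≤ ab
  /-- (H6): measure of the boundary layers -/
  h6a : ∀ ε : ℝ, 0 < ε →
    volume (⋃ k, bLayer (parts k) ε) ≤ ENNReal.ofReal (Cb ^ d * ε ^ αb)
  /-- (H6): blow-up of `∇ det DT` near the singularities -/
  h6b : ∀ x ∈ Ω, ∀ i : Fin d,
    |fderiv ℝ (fun z => (jac T z).det) x (Pi.single i 1)| ≤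
      Cb * Metric.infDist x (frontier Ω) ^ (-ab)

/-- `μ` is a `T`-invariant probability measure, absolutely continuous w.r.t. Lebesgue,
supported in `Ω`. -/
def InvariantMeasure {d : ℕ} (Ω : Set (Fin d → ℝ)) (T : (Fin d → ℝ) → (Fin d → ℝ))
    (μ : Measure (Fin d → ℝ)) : Prop :=
  IsProbabilityMeasure μ ∧ μ ≪ volume ∧ μ Ωᶜ = 0 ∧
    ∀ A : Set (Fin d → ℝ), MeasurableSet A → μ (T ⁻¹' A) = μ A

/-- `μ` is an ergodic absolutely continuous invariant probability measure. -/
def ErgodicACIM {d : ℕ} (Ω : Set (Fin d → ℝ)) (T : (Fin d → ℝ) → (Fin d → ℝ))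
    (μ : Measure (Fin d → ℝ)) : Prop :=
  InvariantMeasure Ω T μ ∧
    ∀ A : Set (Fin d → ℝ), MeasurableSet A → T ⁻¹' A = A → μ A = 0 ∨ μ A = 1

/-- `h` is a density of `μ` with respect to Lebesgue measure. -/
def IsDensity {d : ℕ} (μ : Measure (Fin d → ℝ)) (h : (Fin d → ℝ) → ℝ) : Prop :=
  ∀ A : Set (Fin d → ℝ), MeasurableSet A → μ A = ∫⁻ x in A, ENNReal.ofReal (h x) ∂volume

/-- The system `(T, μ)` is mixing. -/
def Mixing {d : ℕ} (T : (Fin d → ℝ) → (Fin d → ℝ)) (μ : Measure (Fin d → ℝ)) : Prop :=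
  ∀ A B : Set (Fin d → ℝ), MeasurableSet A → MeasurableSet B →
    Tendsto (fun n : ℕ => μ (T^[n] ⁻¹' A ∩ B)) atTop (𝓝 (μ A * μ B))

/-- A one-dimensional mollifier. -/
def IsMollifier (η : ℝ → ℝ) : Prop :=
  ContDiff ℝ (⊤ : ℕ∞) η ∧ (∀ y, 0 ≤ η y) ∧ Function.support η ⊆ Set.Icc (-1) 1 ∧ ∫ y, η y = 1

/-- The product mollifier `η̄_δ(x) = δ^{-d} Π_i η(δ⁻¹ x_i)`. -/
def moll (d : ℕ) (η : ℝ → ℝ) (δ : ℝ) (x : Fin d → ℝ) : ℝ :=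
  (δ ^ d)⁻¹ * ∏ i, η (δ⁻¹ * x i)

/-- The regularization `h_δ(x) = ∫_Ω η̄_δ(x-y) h(y) dy + δ`. -/
def mollify (d : ℕ) (η : ℝ → ℝ) (Ω : Set (Fin d → ℝ)) (h : (Fin d → ℝ) → ℝ)
    (δ : ℝ) (x : Fin d → ℝ) : ℝ :=
  (∫ y in Ω, moll d η δ (x - y) * h y) + δ

/-- `ν₀ = ‖(DT)⁻¹‖_{L∞(Ω)}`. -/
def nu0 {d : ℕ} (Ω : Set (Fin d → ℝ)) (T : (Fin d → ℝ) → (Fin d → ℝ)) : ℝ :=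
  (essSup (fun x => ENNReal.ofReal (matNorm (jacInv T x))) (volume.restrict Ω)).toReal

/-- The truncated ("open") transfer operators
`L̃_{ε,n} = L_{ε,0} ⋯ L_{ε,n-1}` where `L_{ε,k} f = L((1 - 1_{Γ_{ε ν^k}}) f)`. -/
def tildeOp {d : ℕ} (Ω : Set (Fin d → ℝ)) (T : (Fin d → ℝ) → (Fin d → ℝ))
    (parts : ℕ → Set (Fin d → ℝ)) (ν : ℝ) :
    ℕ → ℝ → ((Fin d → ℝ) → ℝ) → (Fin d → ℝ) → ℝ
  | 0, _, f => f
  | n + 1, ε, f => transferOp Ω T (((Gam parts ε)ᶜ).indicator (tildeOp Ω T parts ν n (ε * ν) f))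

/-- The distributional variation of `g` is at most `M`. -/
def VarLE {d : ℕ} (g : (Fin d → ℝ) → ℝ) (M : ℝ) : Prop :=
  ∀ φ, IsTest d φ → ∫ x, g x * divg φ x ≤ M

/-- The `L¹` norm of the gradient. -/
def gradL1 {d : ℕ} (p : (Fin d → ℝ) → ℝ) : ℝ :=
  ∑ j, ∫ x, |fderiv ℝ p x (Pi.single j 1)|

section Gradient

variable {d : ℕ}

theorem continuous_fderiv_single {p : (Fin d → ℝ) → ℝ} (hp : ContDiff ℝ 1 p) (j : Fin d) :
    Continuous fun x => fderiv ℝ p x (Pi.single j 1) :=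
  (hp.continuous_fderiv one_ne_zero).clm_apply continuous_const

theorem hasCompactSupport_fderiv_single {p : (Fin d → ℝ) → ℝ} (hp : HasCompactSupport p)
    (j : Fin d) : HasCompactSupport fun x => fderiv ℝ p x (Pi.single j 1) :=
  hp.fderiv_apply (𝕜 := ℝ) (Pi.single j 1)

theorem integrable_fderiv_single {p : (Fin d → ℝ) → ℝ} (hp : ContDiff ℝ 1 p)
    (hc : HasCompactSupport p) (j : Fin d) :
    Integrable fun x => fderiv ℝ p x (Pi.single j 1) :=
  (continuous_fderiv_single hp j).integrable_of_hasCompactSupport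
    (hasCompactSupport_fderiv_single hc j)

theorem gradL1_nonneg (p : (Fin d → ℝ) → ℝ) : 0 ≤ gradL1 p :=
  Finset.sum_nonneg fun _ _ => integral_nonneg fun _ => abs_nonneg _

theorem continuous_divg {φ : (Fin d → ℝ) → (Fin d → ℝ)} (hφ : ContDiff ℝ 1 φ) :
    Continuous (divg φ) := by
  unfold divg
  refine continuous_finsetSum _ fun j _ => ?_
  exact (continuous_apply j).comp
    ((hφ.continuous_fderiv one_ne_zero).clm_apply continuous_const)

theorem hasCompactSupport_divg {φ : (Fin d → ℝ) → (Fin d → ℝ)} (hφ : HasCompactSupport φ) :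
    HasCompactSupport (divg φ) := by
  refine (hφ.fderiv (𝕜 := ℝ)).mono' ?_
  intro x hx
  refine subset_tsupport _ ?_
  intro h
  apply hx
  simp [divg, h]

theorem exists_abs_divg_le {φ : (Fin d → ℝ) → (Fin d → ℝ)} (hφ : IsTest d φ) :
    ∃ K : ℝ, 0 ≤ K ∧ ∀ x, |divg φ x| ≤ K := by
  obtain ⟨K, hK⟩ := (hasCompactSupport_divg hφ.2.1).exists_bound_of_continuous
    (continuous_divg hφ.1)
  exact ⟨K, (norm_nonneg _).trans (hK 0), hK⟩

theorem divg_apply {φ : (Fin d → ℝ) → (Fin d → ℝ)} (hφ : ContDiff ℝ 1 φ) (x : Fin d → ℝ) :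
    divg φ x = ∑ j, fderiv ℝ (fun z => φ z j) x (Pi.single j 1) := by
  unfold divg
  refine Finset.sum_congr rfl fun j _ => ?_
  have h := (hφ.differentiable one_ne_zero x).hasFDerivAt
  have h2 := (hasFDerivAt_pi'.1 h j).fderiv
  rw [h2]; rfl

theorem integral_mul_divg {p : (Fin d → ℝ) → ℝ} (hp : ContDiff ℝ 1 p)
    (hc : HasCompactSupport p) {φ : (Fin d → ℝ) → (Fin d → ℝ)} (hφ : ContDiff ℝ 1 φ) :
    ∫ x, p x * divg φ x = - ∑ j, ∫ x, fderiv ℝ p x (Pi.single j 1) * φ x j := by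
  have hφj : ∀ j, ContDiff ℝ 1 fun z => φ z j := fun j => contDiff_pi.1 hφ j
  have h1 : ∀ j, Integrable fun x => p x * fderiv ℝ (fun z => φ z j) x (Pi.single j 1) :=
    fun j => (hp.continuous.mul
      (continuous_fderiv_single (hφj j) j)).integrable_of_hasCompactSupport
      hc.mul_right
  simp_rw [divg_apply hφ, Finset.mul_sum]
  rw [integral_finsetSum _ fun j _ => h1 j, ← Finset.sum_neg_distrib]
  refine Finset.sum_congr rfl fun j _ => ?_
  refine integral_mul_fderiv_eq_neg_fderiv_mul_of_integrable ?_ (h1 j) ?_ ?_ ?_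
  · exact ((continuous_fderiv_single hp j).mul (hφj j).continuous).integrable_of_hasCompactSupport
      (hasCompactSupport_fderiv_single hc j).mul_right
  · exact (hp.continuous.mul (hφj j).continuous).integrable_of_hasCompactSupport hc.mul_right
  · exact fun x _ => hp.differentiable one_ne_zero x
  · exact fun x _ => (hφj j).differentiable one_ne_zero x

theorem varLE_gradL1 {p : (Fin d → ℝ) → ℝ} (hp : ContDiff ℝ 1 p)
    (hc : HasCompactSupport p) : VarLE p (gradL1 p) := by
  intro φ hφ
  rw [integral_mul_divg hp hc hφ.1, gradL1, ← Finset.sum_neg_distrib]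
  refine Finset.sum_le_sum fun j _ => ?_
  rw [← integral_neg]
  have hφj : ContDiff ℝ 1 fun z => φ z j := contDiff_pi.1 hφ.1 j
  refine integral_mono ?_ (integrable_fderiv_single hp hc j).abs ?_
  · exact (((continuous_fderiv_single hp j).mul hφj.continuous).integrable_of_hasCompactSupport
      (hasCompactSupport_fderiv_single hc j).mul_right).neg
  · intro x
    have : |φ x j| ≤ 1 := (norm_le_pi_norm (φ x) j).trans (hφ.2.2 x)
    calc -(fderiv ℝ p x (Pi.single j 1) * φ x j) ≤ |fderiv ℝ p x (Pi.single j 1) * φ x j| :=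
          neg_le_abs _
      _ = |fderiv ℝ p x (Pi.single j 1)| * |φ x j| := abs_mul _ _
      _ ≤ _ := mul_le_of_le_one_right (abs_nonneg _) this

theorem gradL1_add_le {p q : (Fin d → ℝ) → ℝ} (hp : ContDiff ℝ 1 p)
    (hc : HasCompactSupport p) (hq : ContDiff ℝ 1 q) (hd : HasCompactSupport q) :
    gradL1 (fun x => p x + q x) ≤ gradL1 p + gradL1 q := by
  unfold gradL1
  rw [← Finset.sum_add_distrib]
  refine Finset.sum_le_sum fun j _ => ?_
  rw [← integral_add (integrable_fderiv_single hp hc j).abs (integrable_fderiv_single hq hd j).abs]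
  refine integral_mono_of_nonneg (Eventually.of_forall fun _ => abs_nonneg _)
    ((integrable_fderiv_single hp hc j).abs.add (integrable_fderiv_single hq hd j).abs)
    (Eventually.of_forall fun x => ?_)
  have : fderiv ℝ (fun x => p x + q x) x = fderiv ℝ p x + fderiv ℝ q x :=
    fderiv_fun_add (hp.differentiable one_ne_zero x) (hq.differentiable one_ne_zero x)
  simp only [this, add_apply]
  exact abs_add_le _ _

theorem gradL1_const_mul {p : (Fin d → ℝ) → ℝ} (hp : ContDiff ℝ 1 p) {c : ℝ} (hc : 0 ≤ c) :
    gradL1 (fun x => c * p x) = c * gradL1 p := by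
  unfold gradL1
  rw [Finset.mul_sum]
  refine Finset.sum_congr rfl fun j _ => ?_
  rw [← integral_const_mul]
  congr 1; ext x
  rw [fderiv_const_mul (hp.differentiable one_ne_zero x)]
  simp [abs_mul, abs_of_nonneg hc]

/-- A `C²` compactly supported function realises its variation. -/
theorem gradL1_le_of_varLE {p : (Fin d → ℝ) → ℝ} (hp : ContDiff ℝ 2 p)
    (hc : HasCompactSupport p) {M : ℝ} (h : VarLE p M) : gradL1 p ≤ M := by
  have hp1 : ContDiff ℝ 1 p := hp.of_le one_le_two
  set g : Fin d → (Fin d → ℝ) → ℝ := fun j x => fderiv ℝ p x (Pi.single j 1) with hg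
  have hgC : ∀ j, ContDiff ℝ 1 (g j) := fun j =>
    (hp.fderiv_right (m := 1) (by norm_num)).clm_apply contDiff_const
  have hgI : ∀ j, Integrable (g j) := fun j => integrable_fderiv_single hp1 hc j
  have hgs : ∀ j, HasCompactSupport (g j) := fun j => hasCompactSupport_fderiv_single hc j
  set m : ℝ := ∑ j, (volume (tsupport (g j))).toReal with hm
  have key : ∀ κ : ℝ, 0 < κ → gradL1 p ≤ M + κ * m := by
    intro κ hκ
    have hpos : ∀ j x, 0 < (g j x) ^ 2 + κ ^ 2 := fun j x => by positivity
    have hsC : ∀ j, ContDiff ℝ 1 fun x => √((g j x) ^ 2 + κ ^ 2) := fun j =>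
      (((hgC j).pow 2).add contDiff_const).sqrt fun x => (hpos j x).ne'
    have hsp : ∀ j x, 0 < √((g j x) ^ 2 + κ ^ 2) := fun j x => Real.sqrt_pos.2 (hpos j x)
    let φ : (Fin d → ℝ) → (Fin d → ℝ) := fun x j => -(g j x / √((g j x) ^ 2 + κ ^ 2))
    have hle : ∀ j x, |g j x| ≤ √((g j x) ^ 2 + κ ^ 2) := fun j x =>
      Real.abs_le_sqrt (by nlinarith)
    have hφ : IsTest d φ := by
      refine ⟨contDiff_pi.2 fun j => ((hgC j).div (hsC j) fun x => (hsp j x).ne').neg, ?_, ?_⟩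
      · refine (hc.fderiv (𝕜 := ℝ)).mono' ?_
        intro x hx
        refine subset_tsupport _ ?_
        intro h
        apply hx
        ext j
        simp [φ, g, h]
      · intro x
        refine (pi_norm_le_iff_of_nonneg zero_le_one).2 fun j => ?_
        simp only [φ, norm_neg, Real.norm_eq_abs, abs_div, abs_of_pos (hsp j x)]
        exact (div_le_one (hsp j x)).2 (hle j x)
    have h2 := h φ hφ
    rw [integral_mul_divg hp1 hc hφ.1, ← Finset.sum_neg_distrib] at h2
    have h3 : gradL1 p - κ * m ≤ ∑ j, -∫ x, fderiv ℝ p x (Pi.single j 1) * φ x j := by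
      rw [gradL1, hm, Finset.mul_sum, ← Finset.sum_sub_distrib]
      refine Finset.sum_le_sum fun j _ => ?_
      have hfin : volume (tsupport (g j)) < ⊤ := (hgs j).isCompact.measure_lt_top
      have hi : Integrable ((tsupport (g j)).indicator fun _ => κ) :=
        (integrable_indicator_iff (isClosed_tsupport _).measurableSet).2
          (integrableOn_const hfin.ne)
      have e : κ * (volume (tsupport (g j))).toReal
          = ∫ x, (tsupport (g j)).indicator (fun _ => κ) x := by
        rw [integral_indicator (isClosed_tsupport _).measurableSet, setIntegral_const,
          smul_eq_mul, mul_comm]; rfl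
      rw [e, ← integral_neg, ← integral_sub (hgI j).abs hi]
      refine integral_mono ((hgI j).abs.sub hi) ?_ ?_
      · have : Continuous fun x => -(fderiv ℝ p x (Pi.single j 1) * φ x j) :=
          ((hgC j).continuous.mul (contDiff_pi.1 hφ.1 j).continuous).neg
        exact this.integrable_of_hasCompactSupport ((hgs j).mul_right.neg)
      · intro x
        simp only [φ]
        by_cases hx : x ∈ tsupport (g j)
        · rw [indicator_of_mem hx]
          change |g j x| - κ ≤ -(g j x * -(g j x / √((g j x) ^ 2 + κ ^ 2)))
          have hs := hsp j x
          have h4 : -(g j x * -(g j x / √((g j x) ^ 2 + κ ^ 2)))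
              = (g j x) ^ 2 / √((g j x) ^ 2 + κ ^ 2) := by ring
          rw [h4, le_div_iff₀ hs]
          have h5 : √((g j x) ^ 2 + κ ^ 2) ≤ |g j x| + κ := by
            rw [Real.sqrt_le_left (by positivity)]
            nlinarith [sq_abs (g j x), abs_nonneg (g j x)]
          rcases le_or_gt (|g j x|) κ with h6 | h6
          · nlinarith [sq_nonneg (g j x)]
          · nlinarith [sq_abs (g j x), abs_nonneg (g j x)]
        · rw [indicator_of_notMem hx]
          have : g j x = 0 := image_eq_zero_of_notMem_tsupport hx
          change |g j x| - 0 ≤ -(g j x * -(g j x / √((g j x) ^ 2 + κ ^ 2)))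
          simp [this]
    linarith
  refine le_of_forall_pos_le_add fun η hη => ?_
  have hm0 : 0 ≤ m := Finset.sum_nonneg fun _ _ => ENNReal.toReal_nonneg
  refine (key (η / (m + 1)) (by positivity)).trans ?_
  have : η / (m + 1) * m ≤ η := by
    rw [div_mul_eq_mul_div, div_le_iff₀ (by positivity)]
    nlinarith
  linarith

end Gradient

section Mollification

variable {d : ℕ}

/-- The convolution of `g` with a normalised bump function. -/
def smear (φ : ContDiffBump (0 : Fin d → ℝ)) (g : (Fin d → ℝ) → ℝ) : (Fin d → ℝ) → ℝ :=
  convolution (φ.normed volume) g (ContinuousLinearMap.lsmul ℝ ℝ) volume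

theorem smear_apply (φ : ContDiffBump (0 : Fin d → ℝ)) (g : (Fin d → ℝ) → ℝ) (x : Fin d → ℝ) :
    smear φ g x = ∫ t, φ.normed volume t * g (x - t) := rfl

theorem contDiff_smear (φ : ContDiffBump (0 : Fin d → ℝ)) {g : (Fin d → ℝ) → ℝ}
    (hg : Integrable g) : ContDiff ℝ 2 (smear φ g) :=
  φ.hasCompactSupport_normed.contDiff_convolution_left (n := 2) _ φ.contDiff_normed
    hg.locallyIntegrable

theorem hasCompactSupport_smear (φ : ContDiffBump (0 : Fin d → ℝ)) {g : (Fin d → ℝ) → ℝ}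
    (hg : HasCompactSupport g) : HasCompactSupport (smear φ g) :=
  HasCompactSupport.convolution _ φ.hasCompactSupport_normed hg

theorem integrable_normed (φ : ContDiffBump (0 : Fin d → ℝ)) : Integrable (φ.normed volume) :=
  φ.continuous_normed.integrable_of_hasCompactSupport φ.hasCompactSupport_normed

theorem smear_nonneg (φ : ContDiffBump (0 : Fin d → ℝ)) {g : (Fin d → ℝ) → ℝ}
    (hg : ∀ x, 0 ≤ g x) (x : Fin d → ℝ) : 0 ≤ smear φ g x :=
  integral_nonneg fun _ => mul_nonneg (φ.nonneg_normed _) (hg _)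

theorem integrable_smear (φ : ContDiffBump (0 : Fin d → ℝ)) {g : (Fin d → ℝ) → ℝ}
    (hg : Integrable g) : Integrable (smear φ g) :=
  (integrable_normed φ).integrable_convolution _ hg

theorem integral_smear (φ : ContDiffBump (0 : Fin d → ℝ)) {g : (Fin d → ℝ) → ℝ}
    (hg : Integrable g) : ∫ x, smear φ g x = ∫ x, g x := by
  have := integral_convolution (ContinuousLinearMap.lsmul ℝ ℝ) (integrable_normed φ) hg
    (μ := (volume : Measure (Fin d → ℝ))) (ν := volume)
  rw [smear, this, φ.integral_normed]
  simp

theorem integrable_shift_mul (φ : ContDiffBump (0 : Fin d → ℝ)) {g w : (Fin d → ℝ) → ℝ}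
    (hg : Integrable g) (hw : Continuous w) {K : ℝ} (hK : ∀ x, |w x| ≤ K) :
    Integrable (fun q : (Fin d → ℝ) × (Fin d → ℝ) =>
      φ.normed volume q.2 * g (q.1 - q.2) * w q.1) := by
  have h1 : Integrable (fun q : (Fin d → ℝ) × (Fin d → ℝ) =>
      φ.normed volume q.2 * g (q.1 - q.2)) :=
    (integrable_normed φ).convolution_integrand (ContinuousLinearMap.lsmul ℝ ℝ) hg
  refine h1.mul_bdd (c := K) ?_ (Eventually.of_forall fun q => hK q.1)
  exact (hw.comp continuous_fst).aestronglyMeasurable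

theorem VarLE.smear (φ : ContDiffBump (0 : Fin d → ℝ)) {g : (Fin d → ℝ) → ℝ}
    (hg : Integrable g) {M : ℝ} (h : VarLE g M) : VarLE (smear φ g) M := by
  intro ψ hψ
  obtain ⟨K, -, hK⟩ := exists_abs_divg_le hψ
  have hI := integrable_shift_mul φ hg (continuous_divg hψ.1) hK
  calc ∫ x, Liverani.smear φ g x * divg ψ x
      = ∫ x, ∫ t, φ.normed volume t * g (x - t) * divg ψ x := by
        refine integral_congr_ae (Eventually.of_forall fun x => ?_)
        simp only [smear_apply]
        rw [integral_mul_const]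
    _ = ∫ t, ∫ x, φ.normed volume t * g (x - t) * divg ψ x := integral_integral_swap hI
    _ ≤ ∫ t, φ.normed volume t * M := by
        refine integral_mono hI.integral_prod_right ((integrable_normed φ).mul_const M) fun t => ?_
        simp only [mul_assoc]
        rw [integral_const_mul]
        refine mul_le_mul_of_nonneg_left ?_ (φ.nonneg_normed _)
        have e : ∫ x, g (x - t) * divg ψ x = ∫ x, g x * divg ψ (x + t) := by
          rw [← integral_sub_right_eq_self (fun x => g x * divg ψ (x + t)) t]
          simp
        rw [e]
        have hs : IsTest d fun x => ψ (x + t) := by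
          refine ⟨hψ.1.comp (contDiff_id.add contDiff_const), ?_, fun x => hψ.2.2 _⟩
          exact hψ.2.1.comp_homeomorph (Homeomorph.addRight t)
        have := h _ hs
        simpa [divg, fderiv_comp_add_right] using this
    _ = M := by rw [integral_mul_const, φ.integral_normed, one_mul]

/-- Smooth approximation in `L¹` that does not increase the variation. -/
theorem exists_smooth_approx {g : (Fin d → ℝ) → ℝ} (hg : Integrable g)
    (hc : HasCompactSupport g) (h0 : ∀ x, 0 ≤ g x) {η : ℝ} (hη : 0 < η) :
    ∃ p : (Fin d → ℝ) → ℝ, ContDiff ℝ 2 p ∧ HasCompactSupport p ∧ (∀ x, 0 ≤ p x) ∧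
      ∫ x, |p x - g x| ≤ η ∧ ∀ M, VarLE g M → gradL1 p ≤ M := by
  let φ : ℕ → ContDiffBump (0 : Fin d → ℝ) := fun n =>
    ⟨1 / (n + 1), 2 * (1 / (n + 1)), by positivity, by
      have : (0 : ℝ) < 1 / (n + 1) := by positivity
      linarith⟩
  have hlim : Tendsto (fun n => (φ n).rOut) atTop (𝓝 0) := by
    have := (tendsto_one_div_add_atTop_nhds_zero_nat (𝕜 := ℝ)).const_mul 2
    rw [mul_zero] at this
    exact this
  have hae : ∀ᵐ x, Tendsto (fun n => smear (φ n) g x) atTop (𝓝 (g x)) :=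
    ContDiffBump.ae_convolution_tendsto_right_of_locallyIntegrable (K := 2) hlim
      (Eventually.of_forall fun n => le_rfl) hg.locallyIntegrable
  have hpos : Tendsto (fun n => ∫ x, max (g x - smear (φ n) g x) 0) atTop
      (𝓝 (∫ x : Fin d → ℝ, (0 : ℝ))) := by
    refine tendsto_integral_of_dominated_convergence g (fun n => ?_) hg (fun n => ?_) ?_
    · exact ((hg.sub (integrable_smear (φ n) hg)).pos_part).aestronglyMeasurable
    · refine Eventually.of_forall fun x => ?_
      rw [Real.norm_eq_abs, abs_of_nonneg (le_max_right _ _)]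
      exact max_le (by linarith [smear_nonneg (φ n) h0 x]) (h0 x)
    · filter_upwards [hae] with x hx
      have h1 : Tendsto (fun n => g x - smear (φ n) g x) atTop (𝓝 (g x - g x)) :=
        tendsto_const_nhds.sub hx
      rw [sub_self] at h1
      simpa using h1.max (tendsto_const_nhds (x := (0 : ℝ)))
  simp only [integral_zero] at hpos
  obtain ⟨n, hn⟩ := (hpos.eventually (gt_mem_nhds (half_pos hη))).exists
  refine ⟨smear (φ n) g, contDiff_smear _ hg, hasCompactSupport_smear _ hc, smear_nonneg _ h0, ?_,
    fun M hM => gradL1_le_of_varLE (contDiff_smear _ hg) (hasCompactSupport_smear _ hc)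
      (hM.smear _ hg)⟩
  have hs := integrable_smear (φ n) hg
  have e : ∀ x, |smear (φ n) g x - g x|
      = 2 * max (g x - smear (φ n) g x) 0 - (g x - smear (φ n) g x) := by
    intro x
    rcases le_total (g x) (smear (φ n) g x) with h | h
    · rw [abs_of_nonneg (by linarith), max_eq_right (by linarith)]; ring
    · rw [abs_of_nonpos (by linarith), max_eq_left (by linarith)]; ring
  have hgs : Integrable fun x => g x - smear (φ n) g x := hg.sub hs
  simp_rw [e]
  rw [integral_sub (hgs.pos_part.const_mul 2) hgs, integral_const_mul,
    integral_sub hg hs, integral_smear _ hg]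
  linarith

end Mollification

section Concentration

variable {d : ℕ}

theorem abs_fderiv_apply_le {p : (Fin d → ℝ) → ℝ} (x u : Fin d → ℝ) {r : ℝ}
    (hu : ∀ j, |u j| ≤ r) :
    |fderiv ℝ p x u| ≤ r * ∑ j, |fderiv ℝ p x (Pi.single j 1)| := by
  have e : u = ∑ j, u j • (Pi.single j 1 : Fin d → ℝ) := by
    ext i
    simp [Finset.sum_apply, Pi.single_apply]
  rw [e, map_sum, Finset.mul_sum]
  refine (Finset.abs_sum_le_sum_abs _ _).trans (Finset.sum_le_sum fun j _ => ?_)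
  rw [map_smul, smul_eq_mul, abs_mul]
  exact mul_le_mul_of_nonneg_right (hu j) (abs_nonneg _)

theorem integral_sum_abs_fderiv {p : (Fin d → ℝ) → ℝ} (hp : ContDiff ℝ 1 p)
    (hc : HasCompactSupport p) :
    ∫ x, ∑ j, |fderiv ℝ p x (Pi.single j 1)| = gradL1 p :=
  integral_finsetSum _ fun j _ => (integrable_fderiv_single hp hc j).abs

theorem integral_abs_sub_translate_le {p : (Fin d → ℝ) → ℝ} (hp : ContDiff ℝ 1 p)
    (hc : HasCompactSupport p) {u : Fin d → ℝ} {r : ℝ} (hr : 0 ≤ r) (hu : ∀ j, |u j| ≤ r) :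
    ∫⁻ x, ENNReal.ofReal |p (x + u) - p x| ≤ ENNReal.ofReal (r * gradL1 p) := by
  set D : (Fin d → ℝ) → ℝ := fun x => ∑ j, |fderiv ℝ p x (Pi.single j 1)| with hD
  have hDc : Continuous D := continuous_finsetSum _ fun j _ =>
    (continuous_fderiv_single hp j).abs
  have hD0 : ∀ x, 0 ≤ D x := fun x => Finset.sum_nonneg fun _ _ => abs_nonneg _
  have hDi : Integrable D :=
    integrable_finsetSum _ fun j _ => (integrable_fderiv_single hp hc j).abs
  have hpt : ∀ x, ENNReal.ofReal |p (x + u) - p x|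
      ≤ ∫⁻ t in Icc (0 : ℝ) 1, ENNReal.ofReal (r * D (x + t • u)) := by
    intro x
    have hder : ∀ t ∈ uIcc (0 : ℝ) 1,
        HasDerivAt (fun t : ℝ => p (x + t • u)) (fderiv ℝ p (x + t • u) u) t := by
      intro t _
      have h1 : HasDerivAt (fun t : ℝ => x + t • u) u t := by
        simpa using ((hasDerivAt_id t).smul_const u).const_add x
      exact (hp.differentiable one_ne_zero _).hasFDerivAt.comp_hasDerivAt t h1
    have hcont : Continuous fun t : ℝ => fderiv ℝ p (x + t • u) u :=
      ((hp.continuous_fderiv one_ne_zero).comp (by fun_prop)).clm_apply continuous_const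
    have := intervalIntegral.integral_eq_sub_of_hasDerivAt hder (hcont.intervalIntegrable _ _)
    simp only [one_smul, zero_smul, add_zero] at this
    rw [← this, intervalIntegral.integral_of_le zero_le_one, ← integral_Icc_eq_integral_Ioc]
    rw [← Real.norm_eq_abs, ofReal_norm]
    refine (enorm_integral_le_lintegral_enorm _).trans (lintegral_mono fun t => ?_)
    rw [← ofReal_norm, Real.norm_eq_abs]
    exact ENNReal.ofReal_le_ofReal (abs_fderiv_apply_le _ _ hu)
  calc ∫⁻ x, ENNReal.ofReal |p (x + u) - p x|
      ≤ ∫⁻ x, ∫⁻ t in Icc (0 : ℝ) 1, ENNReal.ofReal (r * D (x + t • u)) := lintegral_mono hpt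
    _ = ∫⁻ t in Icc (0 : ℝ) 1, ∫⁻ x, ENNReal.ofReal (r * D (x + t • u)) := by
        refine lintegral_lintegral_swap ?_
        refine Measurable.aemeasurable ?_
        refine ENNReal.measurable_ofReal.comp (Continuous.measurable ?_)
        refine continuous_const.mul (hDc.comp ?_)
        fun_prop
    _ = ∫⁻ t in Icc (0 : ℝ) 1, ENNReal.ofReal (r * gradL1 p) := by
        refine lintegral_congr fun t => ?_
        rw [lintegral_add_right_eq_self (fun x => ENNReal.ofReal (r * D x)) (t • u),
          ← ofReal_integral_eq_lintegral_ofReal (hDi.const_mul r)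
            (Eventually.of_forall fun x => mul_nonneg hr (hD0 x)), integral_const_mul,
          integral_sum_abs_fderiv hp hc]
    _ = _ := by simp

/-- A function of bounded variation cannot concentrate on small sets. -/
theorem setLIntegral_le_of_gradL1 {p : (Fin d → ℝ) → ℝ} (hp : ContDiff ℝ 1 p)
    (hc : HasCompactSupport p) (A : Set (Fin d → ℝ)) {r : ℝ} (hr : 0 < r) :
    ∫⁻ x in A, ENNReal.ofReal |p x| ≤ ENNReal.ofReal (r * gradL1 p)
      + ENNReal.ofReal ((r ^ d)⁻¹) * volume A * ∫⁻ x, ENNReal.ofReal |p x| := by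
  set Q : Set (Fin d → ℝ) := Icc 0 (fun _ => r) with hQ
  have hQv : volume Q = ENNReal.ofReal (r ^ d) := by
    rw [hQ, Real.volume_Icc_pi]
    simp [ENNReal.ofReal_pow hr.le]
  have hpm : Measurable fun x => ENNReal.ofReal |p x| :=
    ENNReal.measurable_ofReal.comp hp.continuous.abs.measurable
  set N := ∫⁻ x, ENNReal.ofReal |p x| with hN
  set I := ∫⁻ x in A, ENNReal.ofReal |p x| with hI
  have hm2 : Measurable (Function.uncurry fun (x u : Fin d → ℝ) => ENNReal.ofReal |p (x + u)|) :=
    hpm.comp (measurable_fst.add measurable_snd)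
  have hm3 : Measurable (Function.uncurry fun (x u : Fin d → ℝ) =>
      ENNReal.ofReal |p (x + u) - p x|) := by
    refine ENNReal.measurable_ofReal.comp (Continuous.measurable ?_)
    have := hp.continuous
    fun_prop
  have main : volume Q * I ≤ volume Q * ENNReal.ofReal (r * gradL1 p) + volume A * N := by
    calc volume Q * I = ∫⁻ u in Q, ∫⁻ x in A, ENNReal.ofReal |p x| := by
          rw [setLIntegral_const, mul_comm]
      _ ≤ ∫⁻ u in Q, (ENNReal.ofReal (r * gradL1 p) + ∫⁻ x in A, ENNReal.ofReal |p (x + u)|) := by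
          refine setLIntegral_mono' measurableSet_Icc fun u hu => ?_
          have hu' : ∀ j, |u j| ≤ r := fun j => by
            rw [abs_of_nonneg (hu.1 j)]; exact hu.2 j
          calc ∫⁻ x in A, ENNReal.ofReal |p x|
              ≤ ∫⁻ x in A, (ENNReal.ofReal |p (x + u) - p x| + ENNReal.ofReal |p (x + u)|) := by
                refine lintegral_mono fun x => ?_
                rw [← ENNReal.ofReal_add (abs_nonneg _) (abs_nonneg _)]
                refine ENNReal.ofReal_le_ofReal ?_
                have := abs_sub_abs_le_abs_sub (p x) (p (x + u))
                rw [abs_sub_comm] at this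
                linarith
            _ = (∫⁻ x in A, ENNReal.ofReal |p (x + u) - p x|)
                  + ∫⁻ x in A, ENNReal.ofReal |p (x + u)| :=
                lintegral_add_left (hm3.comp (measurable_id.prodMk measurable_const)) _
            _ ≤ _ := by
                gcongr
                exact (setLIntegral_le_lintegral _ _).trans
                  (integral_abs_sub_translate_le hp hc hr.le hu')
      _ = volume Q * ENNReal.ofReal (r * gradL1 p)
            + ∫⁻ u in Q, ∫⁻ x in A, ENNReal.ofReal |p (x + u)| := by
          rw [lintegral_add_left measurable_const, setLIntegral_const, mul_comm]
      _ = volume Q * ENNReal.ofReal (r * gradL1 p)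
            + ∫⁻ x in A, ∫⁻ u in Q, ENNReal.ofReal |p (x + u)| := by
          rw [lintegral_lintegral_swap]
          exact (hm2.comp measurable_swap).aemeasurable
      _ ≤ volume Q * ENNReal.ofReal (r * gradL1 p) + ∫⁻ x in A, N := by
          gcongr with x
          refine (setLIntegral_le_lintegral _ _).trans (le_of_eq ?_)
          exact lintegral_add_left_eq_self (fun u => ENNReal.ofReal |p u|) x
      _ = _ := by rw [setLIntegral_const, mul_comm N]
  have hq0 : volume Q ≠ 0 := by rw [hQv]; simp [hr]
  have hqt : volume Q ≠ ⊤ := by rw [hQv]; simp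
  have e : ENNReal.ofReal ((r ^ d)⁻¹) = (volume Q)⁻¹ := by
    rw [hQv, ENNReal.ofReal_inv_of_pos (by positivity)]
  rw [e]
  calc I = (volume Q)⁻¹ * (volume Q * I) := by
        rw [← mul_assoc, ENNReal.inv_mul_cancel hq0 hqt, one_mul]
    _ ≤ (volume Q)⁻¹ * (volume Q * ENNReal.ofReal (r * gradL1 p) + volume A * N) := by gcongr
    _ = _ := by
        rw [mul_add, ← mul_assoc, ENNReal.inv_mul_cancel hq0 hqt, one_mul, mul_assoc]

theorem VarLE.nonneg {g : (Fin d → ℝ) → ℝ} {M : ℝ} (h : VarLE g M) : 0 ≤ M := by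
  have := h 0 ⟨contDiff_const, HasCompactSupport.zero, by simp⟩
  simpa [divg] using this

theorem setLIntegral_le_of_varLE {g : (Fin d → ℝ) → ℝ} (hg : Integrable g)
    (hc : HasCompactSupport g) (h0 : ∀ x, 0 ≤ g x) {M m : ℝ} (hM : VarLE g M)
    (hm : ∫ x, g x ≤ m) {A : Set (Fin d → ℝ)} (hA : volume A ≠ ⊤) :
    ∫⁻ x in A, ENNReal.ofReal (g x) ≤
      ENNReal.ofReal ((M + m) * (volume A).toReal ^ (1 / (d + 1) : ℝ)) := by
  have hM0 := hM.nonneg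
  have hm0 : 0 ≤ m := (integral_nonneg h0).trans hm
  rcases eq_or_ne (volume A) 0 with hA0 | hA0
  · rw [Measure.restrict_eq_zero.2 hA0]; simp
  set v := (volume A).toReal with hv
  have hv0 : 0 < v := ENNReal.toReal_pos hA0 hA
  set r : ℝ := v ^ (1 / (d + 1) : ℝ) with hr
  have hr0 : 0 < r := Real.rpow_pos_of_pos hv0 _
  have hrv : r ^ (d + 1) = v := by
    rw [hr, ← Real.rpow_natCast, ← Real.rpow_mul hv0.le]
    have : (1 / ((d : ℝ) + 1)) * ((d + 1 : ℕ) : ℝ) = 1 := by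
      push_cast; field_simp
    rw [this, Real.rpow_one]
  have hrv' : (r ^ d)⁻¹ * v = r := by
    rw [← hrv, pow_succ]; field_simp
  have key : ∀ η : ℝ, 0 < η → ∫⁻ x in A, ENNReal.ofReal (g x) ≤
      ENNReal.ofReal ((M + m) * r + (r + 1) * η) := by
    intro η hη
    obtain ⟨p, hp, hpc, hp0, hpg, hpM⟩ := exists_smooth_approx hg hc h0 hη
    have hp1 : ContDiff ℝ 1 p := hp.of_le one_le_two
    have hpi : Integrable p := hp1.continuous.integrable_of_hasCompactSupport hpc
    have h1 := setLIntegral_le_of_gradL1 hp1 hpc A hr0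
    have hd : Integrable fun x => |p x - g x| := (hpi.sub hg).abs
    have h2 : ∫⁻ x, ENNReal.ofReal |p x - g x| ≤ ENNReal.ofReal η := by
      rw [← ofReal_integral_eq_lintegral_ofReal hd (Eventually.of_forall fun x => abs_nonneg _)]
      exact ENNReal.ofReal_le_ofReal hpg
    have h3 : ∫⁻ x, ENNReal.ofReal |p x| ≤ ENNReal.ofReal (m + η) := by
      rw [← ofReal_integral_eq_lintegral_ofReal hpi.abs
        (Eventually.of_forall fun x => abs_nonneg _)]
      refine ENNReal.ofReal_le_ofReal ?_
      calc ∫ x, |p x| ≤ ∫ x, (g x + |p x - g x|) := by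
            refine integral_mono hpi.abs (hg.add hd) fun x => ?_
            simp only [abs_of_nonneg (hp0 x)]
            linarith [le_abs_self (p x - g x)]
        _ = (∫ x, g x) + ∫ x, |p x - g x| := integral_add hg hd
        _ ≤ m + η := add_le_add hm hpg
    calc ∫⁻ x in A, ENNReal.ofReal (g x)
        ≤ ∫⁻ x in A, (ENNReal.ofReal |p x| + ENNReal.ofReal |p x - g x|) := by
          refine lintegral_mono fun x => ?_
          rw [← ENNReal.ofReal_add (abs_nonneg _) (abs_nonneg _)]
          refine ENNReal.ofReal_le_ofReal ?_
          have := le_abs_self (g x - p x)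
          rw [abs_sub_comm] at this
          linarith [le_abs_self (p x)]
      _ = (∫⁻ x in A, ENNReal.ofReal |p x|) + ∫⁻ x in A, ENNReal.ofReal |p x - g x| :=
          lintegral_add_left (ENNReal.measurable_ofReal.comp hp1.continuous.abs.measurable) _
      _ ≤ (ENNReal.ofReal (r * gradL1 p)
            + ENNReal.ofReal ((r ^ d)⁻¹) * volume A * ∫⁻ x, ENNReal.ofReal |p x|)
            + ENNReal.ofReal η :=
          add_le_add h1 ((setLIntegral_le_lintegral _ _).trans h2)
      _ ≤ (ENNReal.ofReal (r * M) + ENNReal.ofReal r * ENNReal.ofReal (m + η))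
            + ENNReal.ofReal η := by
          have : ENNReal.ofReal ((r ^ d)⁻¹) * volume A = ENNReal.ofReal r := by
            rw [← ENNReal.ofReal_toReal hA, ← ENNReal.ofReal_mul (by positivity), hrv']
          rw [this]
          gcongr
          exact hpM M hM
      _ = _ := by
          rw [← ENNReal.ofReal_mul hr0.le, ← ENNReal.ofReal_add (by positivity) (by positivity),
            ← ENNReal.ofReal_add (by positivity) hη.le]
          congr 1; ring
  have hlim : Tendsto (fun η : ℝ => ENNReal.ofReal ((M + m) * r + (r + 1) * η)) (𝓝[>] 0)
      (𝓝 (ENNReal.ofReal ((M + m) * r + (r + 1) * 0))) := by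
    refine (ENNReal.continuous_ofReal.tendsto _).comp ?_
    exact ((by fun_prop : Continuous fun η : ℝ => (M + m) * r + (r + 1) * η).tendsto 0).mono_left
      nhdsWithin_le_nhds
  rw [mul_zero, add_zero] at hlim
  exact ge_of_tendsto hlim (eventually_nhdsWithin_of_forall key)

end Concentration

section Matrices

variable {d : ℕ}

theorem sum_abs_row_le_matNorm (A : Matrix (Fin d) (Fin d) ℝ) (i : Fin d) :
    ∑ j, |A i j| ≤ matNorm A := by
  have : (∑ j, ‖A i j‖₊) ≤ Finset.univ.sup fun i => ∑ j, ‖A i j‖₊ :=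
    Finset.le_sup (f := fun i => ∑ j, ‖A i j‖₊) (Finset.mem_univ i)
  have h2 := NNReal.coe_le_coe.2 this
  simpa [matNorm] using h2

theorem abs_le_matNorm (A : Matrix (Fin d) (Fin d) ℝ) (i j : Fin d) : |A i j| ≤ matNorm A :=
  (Finset.single_le_sum (f := fun j => |A i j|) (fun _ _ => abs_nonneg _)
    (Finset.mem_univ j)).trans (sum_abs_row_le_matNorm A i)

theorem abs_sum_mul_le_matNorm (A : Matrix (Fin d) (Fin d) ℝ) (i : Fin d) {v : Fin d → ℝ} {r : ℝ}
    (hv : ∀ j, |v j| ≤ r) : |∑ j, A i j * v j| ≤ matNorm A * r := by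
  have hr : ∀ j : Fin d, 0 ≤ r := fun j => (abs_nonneg _).trans (hv j)
  refine (Finset.abs_sum_le_sum_abs _ _).trans ?_
  calc ∑ j, |A i j * v j| ≤ ∑ j, |A i j| * r := by
        refine Finset.sum_le_sum fun j _ => ?_
        rw [abs_mul]
        exact mul_le_mul_of_nonneg_left (hv j) (abs_nonneg _)
    _ = (∑ j, |A i j|) * r := by rw [Finset.sum_mul]
    _ ≤ _ := mul_le_mul_of_nonneg_right (sum_abs_row_le_matNorm A i) (hr i)

theorem continuousOn_matNorm {A : (Fin d → ℝ) → Matrix (Fin d) (Fin d) ℝ} {s : Set (Fin d → ℝ)}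
    (h : ∀ i j, ContinuousOn (fun x => A x i j) s) : ContinuousOn (fun x => matNorm (A x)) s := by
  unfold matNorm
  refine NNReal.continuous_coe.comp_continuousOn ?_
  refine ContinuousOn.finset_sup_apply (f := fun i x => ∑ j, ‖A x i j‖₊) fun i _ => ?_
  exact continuousOn_finsetSum _ fun j _ => (h i j).nnnorm

theorem jac_eq_toMatrix (T : (Fin d → ℝ) → (Fin d → ℝ)) (x : Fin d → ℝ) :
    jac T x = LinearMap.toMatrix' (fderiv ℝ T x : (Fin d → ℝ) →ₗ[ℝ] (Fin d → ℝ)) := by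
  ext i j
  simp [jac, LinearMap.toMatrix'_apply]

theorem det_jac (T : (Fin d → ℝ) → (Fin d → ℝ)) (x : Fin d → ℝ) :
    (jac T x).det = (fderiv ℝ T x).det := by
  rw [jac_eq_toMatrix, LinearMap.det_toMatrix']

theorem jacInv_apply {T : (Fin d → ℝ) → (Fin d → ℝ)} {x : Fin d → ℝ}
    (h : (fderiv ℝ T x).IsInvertible) (i j : Fin d) :
    jacInv T x i j = (fderiv ℝ T x).inverse (Pi.single j 1) i := by
  obtain ⟨e, he⟩ := h
  have h1 : jacInv T x = LinearMap.toMatrix'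
      (e.symm : (Fin d → ℝ) →L[ℝ] (Fin d → ℝ)).toLinearMap := by
    unfold jacInv
    refine Matrix.inv_eq_right_inv ?_
    rw [jac_eq_toMatrix, ← he, ← LinearMap.toMatrix'_comp]
    convert LinearMap.toMatrix'_id using 2
    ext v : 2
    simp
  rw [h1, ← he, ContinuousLinearMap.inverse_equiv]
  simp [LinearMap.toMatrix'_apply]

end Matrices

namespace PES

variable {d : ℕ} (S : PES d)

theorem parts_subset (k : ℕ) : S.parts k ⊆ S.Ω := by
  rw [← S.parts_union]; exact subset_iUnion _ k

theorem exists_mem_parts {x : Fin d → ℝ} (hx : x ∈ S.Ω) : ∃ k, x ∈ S.parts k := by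
  rw [← S.parts_union] at hx; exact mem_iUnion.1 hx

theorem contDiffAt_T {k : ℕ} {x : Fin d → ℝ} (hx : x ∈ S.parts k) : ContDiffAt ℝ 2 S.T x :=
  (S.T_C2 k).contDiffAt ((S.parts_open k).mem_nhds hx)

theorem differentiableAt_T {k : ℕ} {x : Fin d → ℝ} (hx : x ∈ S.parts k) :
    DifferentiableAt ℝ S.T x := (S.contDiffAt_T hx).differentiableAt two_ne_zero

theorem injOn_T (k : ℕ) : InjOn S.T (S.parts k) := by
  obtain ⟨R, -, hR⟩ := S.T_inv k
  intro x hx y hy h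
  rw [← hR x hx, ← hR y hy, h]

theorem isInvertible_fderiv {k : ℕ} {x : Fin d → ℝ} (hx : x ∈ S.parts k) :
    (fderiv ℝ S.T x).IsInvertible := by
  obtain ⟨R, hR, hRT⟩ := S.T_inv k
  have h1 : HasFDerivWithinAt S.T (fderiv ℝ S.T x) (S.parts k) x :=
    (S.differentiableAt_T hx).hasFDerivAt.hasFDerivWithinAt
  have h2 := ((hR.differentiableOn one_ne_zero) (S.T x) (mem_image_of_mem _ hx)).hasFDerivWithinAt
  have h3 := h2.comp x h1 (mapsTo_image _ _)
  have h4 : HasFDerivWithinAt (fun y => y) (ContinuousLinearMap.id ℝ (Fin d → ℝ)) (S.parts k) x :=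
    hasFDerivWithinAt_id _ _
  have h5 := (S.parts_open k).uniqueDiffWithinAt hx |>.eq h3
    (h4.congr (fun y hy => hRT y hy) (hRT x hx))
  have hinj : Function.Injective (fderiv ℝ S.T x).toLinearMap := by
    intro u v huv
    have hu := congrArg (fun L : (Fin d → ℝ) →L[ℝ] (Fin d → ℝ) => L u) h5
    have hv := congrArg (fun L : (Fin d → ℝ) →L[ℝ] (Fin d → ℝ) => L v) h5
    simp only [ContinuousLinearMap.comp_apply, ContinuousLinearMap.id_apply] at hu hv
    have huv' : fderiv ℝ S.T x u = fderiv ℝ S.T x v := huv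
    rw [← hu, ← hv, huv']
  refine ⟨(LinearEquiv.ofInjectiveEndo _ hinj).toContinuousLinearEquiv, ?_⟩
  ext1 v
  rfl

theorem det_jac_ne_zero {k : ℕ} {x : Fin d → ℝ} (hx : x ∈ S.parts k) : (jac S.T x).det ≠ 0 := by
  obtain ⟨e, he⟩ := S.isInvertible_fderiv hx
  rw [det_jac, ← he]
  have : (e : (Fin d → ℝ) →L[ℝ] (Fin d → ℝ)).det
      = LinearMap.det (e.toLinearEquiv : (Fin d → ℝ) →ₗ[ℝ] (Fin d → ℝ)) := rfl
  rw [this]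
  exact (LinearEquiv.isUnit_det' e.toLinearEquiv).ne_zero

theorem contDiffAt_fderiv {k : ℕ} {x : Fin d → ℝ} (hx : x ∈ S.parts k) :
    ContDiffAt ℝ 1 (fderiv ℝ S.T) x := (S.contDiffAt_T hx).fderiv_right (by norm_num)

theorem contDiffAt_jac {k : ℕ} {x : Fin d → ℝ} (hx : x ∈ S.parts k) (i j : Fin d) :
    ContDiffAt ℝ 1 (fun z => jac S.T z i j) x :=
  contDiffAt_pi.1 ((S.contDiffAt_fderiv hx).clm_apply contDiffAt_const) i

theorem contDiffAt_det {k : ℕ} {x : Fin d → ℝ} (hx : x ∈ S.parts k) :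
    ContDiffAt ℝ 1 (fun z => (jac S.T z).det) x := by
  simp only [Matrix.det_apply]
  refine ContDiffAt.sum fun σ _ => ?_
  refine ContDiffAt.const_smul _ ?_
  exact contDiffAt_prod fun i _ => S.contDiffAt_jac hx _ _

theorem contDiffAt_jacInv {k : ℕ} {x : Fin d → ℝ} (hx : x ∈ S.parts k) (i j : Fin d) :
    ContDiffAt ℝ 1 (fun z => jacInv S.T z i j) x := by
  have h1 : ContDiffAt ℝ 1 (fun z => (fderiv ℝ S.T z).inverse) x := by
    have := S.isInvertible_fderiv hx
    obtain ⟨e, he⟩ := this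
    have h := contDiffAt_map_inverse (n := 1) e
    rw [he] at h
    exact h.comp x (S.contDiffAt_fderiv hx)
  have h2 : ContDiffAt ℝ 1 (fun z => (fderiv ℝ S.T z).inverse (Pi.single j 1) i) x :=
    contDiffAt_pi.1 (h1.clm_apply contDiffAt_const) i
  refine h2.congr_of_eventuallyEq ?_
  filter_upwards [(S.parts_open k).mem_nhds hx] with z hz
  exact jacInv_apply (S.isInvertible_fderiv hz) i j

theorem update_mem_iff (j : Fin d) (x : Fin d → ℝ) (k : ℕ) (y : ℝ) :
    Function.update x j y ∈ S.parts k ↔ ∃ ℓ, y ∈ S.Ifam j x k ℓ := by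
  have := S.Ifam_union j x k
  rw [Set.ext_iff] at this
  simpa using this y

theorem lam_pos : 0 < S.lam := zero_lt_one.trans S.lam_gt_one

theorem matNorm_jacInv_le (j : Fin d) {x : Fin d → ℝ} (hx : x ∈ S.Ω) :
    matNorm (jacInv S.T x) ≤ S.lam⁻¹ := by
  obtain ⟨k, hk⟩ := S.exists_mem_parts hx
  have hk' := hk
  rw [← Function.update_eq_self j x, S.update_mem_iff] at hk'
  obtain ⟨ℓ, hℓ⟩ := hk'
  have h := (ENNReal.le_tsum (k, ℓ)).trans (S.h3 x (S.Ω_subset hx) j)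
  have hne : (Icc (x j - S.δ) (x j + S.δ) ∩ S.Ifam j x k ℓ).Nonempty :=
    ⟨x j, ⟨by linarith [S.δ_pos], by linarith [S.δ_pos]⟩, hℓ⟩
  rw [if_pos hne] at h
  have h2 := (le_iSup₂ (f := fun y (_ : y ∈ S.Ifam j x k ℓ) =>
    ENNReal.ofReal (matNorm (jacInv S.T (Function.update x j y)))) (x j) hℓ).trans h
  rw [Function.update_eq_self] at h2
  exact (ENNReal.ofReal_le_ofReal_iff (inv_nonneg.2 S.lam_pos.le)).1 h2

theorem norm_inverse_apply_le {x : Fin d → ℝ} (hx : x ∈ S.Ω) (v : Fin d → ℝ) :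
    ‖(fderiv ℝ S.T x).inverse v‖ ≤ S.lam⁻¹ * ‖v‖ := by
  obtain ⟨k, hk⟩ := S.exists_mem_parts hx
  have hinv := S.isInvertible_fderiv hk
  have e : ∀ i, (fderiv ℝ S.T x).inverse v i = ∑ j, jacInv S.T x i j * v j := by
    intro i
    have hv : v = ∑ j, v j • (Pi.single j 1 : Fin d → ℝ) := by
      ext i
      simp [Finset.sum_apply, Pi.single_apply]
    conv_lhs => rw [hv, map_sum]
    rw [Finset.sum_apply]
    refine Finset.sum_congr rfl fun j _ => ?_
    rw [map_smul, jacInv_apply hinv, Pi.smul_apply, smul_eq_mul, mul_comm]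
  refine (pi_norm_le_iff_of_nonneg (mul_nonneg (inv_nonneg.2 S.lam_pos.le) (norm_nonneg _))).2
    fun i => ?_
  rw [e, Real.norm_eq_abs]
  refine (abs_sum_mul_le_matNorm _ i (fun j => norm_le_pi_norm v j)).trans ?_
  exact mul_le_mul_of_nonneg_right (S.matNorm_jacInv_le i hx) (norm_nonneg _)

theorem one_le_factorial_mul_abs_det {x : Fin d → ℝ} (hx : x ∈ S.Ω) :
    1 ≤ (d.factorial : ℝ) * |(jac S.T x).det| := by
  obtain ⟨k, hk⟩ := S.exists_mem_parts hx
  have hne := S.det_jac_ne_zero hk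
  have h1 : |(jacInv S.T x).det| ≤ d.factorial := by
    have := Matrix.det_le (A := jacInv S.T x) (abv := AbsoluteValue.abs) (x := 1) (fun i j =>
      (abs_le_matNorm _ i j).trans ((S.matNorm_jacInv_le j hx).trans
        (inv_le_one_of_one_le₀ S.lam_gt_one.le)))
    simpa using this
  have h2 : (jacInv S.T x).det * (jac S.T x).det = 1 := by
    rw [← Matrix.det_mul, jacInv, Matrix.nonsing_inv_mul _ (isUnit_iff_ne_zero.2 hne),
      Matrix.det_one]
  calc (1 : ℝ) = |(jacInv S.T x).det| * |(jac S.T x).det| := by rw [← abs_mul, h2, abs_one]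
    _ ≤ _ := mul_le_mul_of_nonneg_right h1 (abs_nonneg _)

theorem isOpen_image (k : ℕ) {s : Set (Fin d → ℝ)} (hs : IsOpen s) (hsk : s ⊆ S.parts k) :
    IsOpen (S.T '' s) := by
  rw [isOpen_iff_mem_nhds]
  rintro _ ⟨x, hx, rfl⟩
  obtain ⟨e, he⟩ := S.isInvertible_fderiv (hsk hx)
  have h := (S.contDiffAt_T (hsk hx)).hasStrictFDerivAt two_ne_zero
  rw [← he] at h
  rw [← h.map_nhds_eq_of_equiv]
  exact image_mem_map (hs.mem_nhds hx)

theorem continuousOn_T : ContinuousOn S.T S.Ω := by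
  intro x hx
  obtain ⟨k, hk⟩ := S.exists_mem_parts hx
  exact (S.contDiffAt_T hk).continuousAt.continuousWithinAt

end PES

namespace PES

variable {d : ℕ} (S : PES d)

/-- The inverse branch of `T` on `parts k`. -/
def br (k : ℕ) : (Fin d → ℝ) → (Fin d → ℝ) := Classical.choose (S.T_inv k)

theorem br_T {k : ℕ} {x : Fin d → ℝ} (hx : x ∈ S.parts k) : S.br k (S.T x) = x :=
  (Classical.choose_spec (S.T_inv k)).2 x hx

theorem continuousOn_br (k : ℕ) : ContinuousOn (S.br k) (S.T '' S.parts k) :=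
  (Classical.choose_spec (S.T_inv k)).1.continuousOn

/-- The transfer operator acting on `[0,∞]`-valued functions. -/
def Lop (f : (Fin d → ℝ) → ℝ≥0∞) (x : Fin d → ℝ) : ℝ≥0∞ :=
  ∑' k, (S.T '' S.parts k).indicator
    (fun x => f (S.br k x) * (ENNReal.ofReal |(jac S.T (S.br k x)).det|)⁻¹) x

theorem measurableSet_Ω : MeasurableSet S.Ω := S.Ω_open.measurableSet

theorem volume_Ω_le_one : volume S.Ω ≤ 1 := by
  refine (measure_mono S.Ω_subset).trans ?_
  rw [Real.volume_Icc_pi]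
  simp

theorem measurableSet_image (k : ℕ) : MeasurableSet (S.T '' S.parts k) :=
  (S.isOpen_image k (S.parts_open k) subset_rfl).measurableSet

theorem measurable_jac (i j : Fin d) : Measurable fun x => jac S.T x i j :=
  (measurable_pi_apply i).comp (measurable_fderiv_apply_const ℝ S.T (Pi.single j 1))

theorem measurable_det : Measurable fun x => (jac S.T x).det := by
  simp only [Matrix.det_apply]
  refine Finset.measurable_fun_sum _ fun σ _ => ?_
  exact (Finset.measurable_fun_prod _ fun i _ => S.measurable_jac _ _).const_smul _

theorem measurable_branch {F : (Fin d → ℝ) → ℝ≥0∞} (hF : Measurable F) (k : ℕ) :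
    Measurable ((S.T '' S.parts k).indicator fun x => F (S.br k x)) := by
  have h : Measurable ((S.T '' S.parts k).piecewise (S.br k) fun _ => 0) :=
    (S.continuousOn_br k).measurable_piecewise continuousOn_const (S.measurableSet_image k)
  convert (hF.comp h).indicator (S.measurableSet_image k) using 1
  ext x
  by_cases hx : x ∈ S.T '' S.parts k <;> simp [hx]

theorem measurable_Lop {f : (Fin d → ℝ) → ℝ≥0∞} (hf : Measurable f) : Measurable (S.Lop f) :=
  Measurable.tsum fun k =>
    S.measurable_branch (F := fun x => f x * (ENNReal.ofReal |(jac S.T x).det|)⁻¹)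
      (hf.mul (S.measurable_det.norm.ennreal_ofReal.inv)) k

theorem measurable_Lop_iterate {f : (Fin d → ℝ) → ℝ≥0∞} (hf : Measurable f) (n : ℕ) :
    Measurable (S.Lop^[n] f) := by
  induction n with
  | zero => exact hf
  | succ n ih => rw [Function.iterate_succ_apply']; exact S.measurable_Lop ih

theorem setLIntegral_image_branch (k : ℕ) (f g : (Fin d → ℝ) → ℝ≥0∞) :
    ∫⁻ x in S.T '' S.parts k,
      g x * (f (S.br k x) * (ENNReal.ofReal |(jac S.T (S.br k x)).det|)⁻¹)
      = ∫⁻ x in S.parts k, g (S.T x) * f x := by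
  rw [lintegral_image_eq_lintegral_abs_det_fderiv_mul volume (S.parts_open k).measurableSet
    (fun x hx => (S.differentiableAt_T hx).hasFDerivAt.hasFDerivWithinAt) (S.injOn_T k)]
  refine setLIntegral_congr_fun (S.parts_open k).measurableSet fun x hx => ?_
  have h0 : ENNReal.ofReal |(fderiv ℝ S.T x).det| ≠ 0 := by
    rw [← det_jac]
    simpa using S.det_jac_ne_zero hx
  simp only [S.br_T hx, det_jac]
  rw [mul_left_comm, mul_left_comm (ENNReal.ofReal _),
    ENNReal.mul_inv_cancel h0 ENNReal.ofReal_ne_top,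
    mul_one]

theorem lintegral_mul_Lop {f g : (Fin d → ℝ) → ℝ≥0∞} (hf : Measurable f) (hg : Measurable g) :
    ∫⁻ x, g x * S.Lop f x = ∫⁻ x in S.Ω, g (S.T x) * f x := by
  simp only [Lop, ← ENNReal.tsum_mul_left]
  have hm : ∀ k, AEMeasurable (fun x => g x * (S.T '' S.parts k).indicator
      (fun x => f (S.br k x) * (ENNReal.ofReal |(jac S.T (S.br k x)).det|)⁻¹) x) volume := fun k =>
    (hg.mul (S.measurable_branch (F := fun x => f x * (ENNReal.ofReal |(jac S.T x).det|)⁻¹)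
      (hf.mul (S.measurable_det.norm.ennreal_ofReal.inv)) k)).aemeasurable
  rw [lintegral_tsum hm]
  rw [← S.parts_union, lintegral_iUnion (fun k => (S.parts_open k).measurableSet) S.parts_disj]
  refine tsum_congr fun k => ?_
  rw [← S.setLIntegral_image_branch, ← lintegral_indicator (S.measurableSet_image k)]
  refine lintegral_congr fun x => ?_
  by_cases hx : x ∈ S.T '' S.parts k <;> simp [hx]

theorem lintegral_Lop {f : (Fin d → ℝ) → ℝ≥0∞} (hf : Measurable f) :
    ∫⁻ x, S.Lop f x = ∫⁻ x in S.Ω, f x := by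
  simpa using S.lintegral_mul_Lop hf (measurable_const (a := 1))

theorem setLIntegral_Lop {f : (Fin d → ℝ) → ℝ≥0∞} (hf : Measurable f) {A : Set (Fin d → ℝ)}
    (hA : MeasurableSet A) :
    ∫⁻ x in A, S.Lop f x = ∫⁻ x in S.Ω, A.indicator 1 (S.T x) * f x := by
  rw [← S.lintegral_mul_Lop hf (measurable_one.indicator hA), ← lintegral_indicator hA]
  refine lintegral_congr fun x => ?_
  by_cases hx : x ∈ A <;> simp [hx]

theorem Lop_add (f g : (Fin d → ℝ) → ℝ≥0∞) : S.Lop (f + g) = S.Lop f + S.Lop g := by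
  ext x
  simp only [Lop, Pi.add_apply, ← ENNReal.tsum_add]
  refine tsum_congr fun k => ?_
  by_cases hx : x ∈ S.T '' S.parts k <;> simp [hx, add_mul]

theorem Lop_mono {f g : (Fin d → ℝ) → ℝ≥0∞} (h : ∀ x ∈ S.Ω, f x ≤ g x) (x : Fin d → ℝ) :
    S.Lop f x ≤ S.Lop g x := by
  refine ENNReal.tsum_le_tsum fun k => ?_
  by_cases hx : x ∈ S.T '' S.parts k
  · simp only [indicator_of_mem hx]
    obtain ⟨y, hy, rfl⟩ := hx
    rw [S.br_T hy]
    exact mul_le_mul_left (h y (S.parts_subset k hy)) _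
  · simp [hx]

theorem Lop_congr {f g : (Fin d → ℝ) → ℝ≥0∞} (h : ∀ x ∈ S.Ω, f x = g x) : S.Lop f = S.Lop g :=
  funext fun x => le_antisymm (S.Lop_mono (fun y hy => (h y hy).le) x)
    (S.Lop_mono (fun y hy => (h y hy).ge) x)

theorem Lop_eq_zero {f : (Fin d → ℝ) → ℝ≥0∞} {x : Fin d → ℝ} (hx : x ∉ closure S.Ω) :
    S.Lop f x = 0 := by
  refine ENNReal.tsum_eq_zero.2 fun k => indicator_of_notMem ?_ _
  rintro ⟨y, hy, rfl⟩
  exact hx (S.T_maps (S.parts_subset k hy))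

theorem volume_frontier : volume (frontier S.Ω) = 0 := by
  simpa using S.h0 0

theorem closure_ae_eq : (closure S.Ω : Set (Fin d → ℝ)) =ᵐ[volume] S.Ω :=
  closure_ae_eq_of_null_frontier S.volume_frontier

theorem closure_subset_Icc : closure S.Ω ⊆ Icc 0 1 :=
  closure_minimal S.Ω_subset isClosed_Icc

theorem setLIntegral_Ω_Lop {f : (Fin d → ℝ) → ℝ≥0∞} (hf : Measurable f) :
    ∫⁻ x in S.Ω, S.Lop f x = ∫⁻ x in S.Ω, f x := by
  rw [← S.lintegral_Lop hf, ← setLIntegral_congr S.closure_ae_eq]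
  refine setLIntegral_eq_of_support_subset fun x hx => ?_
  by_contra h
  exact hx (S.Lop_eq_zero h)

theorem setLIntegral_Ω_Lop_iterate {f : (Fin d → ℝ) → ℝ≥0∞} (hf : Measurable f) (n : ℕ) :
    ∫⁻ x in S.Ω, S.Lop^[n] f x = ∫⁻ x in S.Ω, f x := by
  induction n with
  | zero => rfl
  | succ n ih =>
    rw [Function.iterate_succ_apply', S.setLIntegral_Ω_Lop (S.measurable_Lop_iterate hf n), ih]

theorem lintegral_Lop_iterate_le {f : (Fin d → ℝ) → ℝ≥0∞} (hf : Measurable f) (n : ℕ) :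
    ∫⁻ x, S.Lop^[n] f x ≤ ∫⁻ x, f x := by
  induction n with
  | zero => exact le_rfl
  | succ n ih =>
    rw [Function.iterate_succ_apply', S.lintegral_Lop (S.measurable_Lop_iterate hf n)]
    exact (setLIntegral_le_lintegral _ _).trans ih

theorem lintegral_Lop_tsub_le {f g : (Fin d → ℝ) → ℝ≥0∞} (hf : Measurable f) (hg : Measurable g) :
    ∫⁻ x, (S.Lop f x - S.Lop g x) ≤ ∫⁻ x, (f x - g x) := by
  calc ∫⁻ x, (S.Lop f x - S.Lop g x) ≤ ∫⁻ x, S.Lop (fun x => f x - g x) x := by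
        refine lintegral_mono fun x => ?_
        rw [tsub_le_iff_left]
        have := congrFun (S.Lop_add g fun x => f x - g x) x
        rw [Pi.add_apply] at this
        rw [← this]
        exact S.Lop_mono (fun y _ => le_add_tsub) x
    _ ≤ _ := by
        have hm : Measurable fun x => f x - g x := hf.sub hg
        rw [S.lintegral_Lop hm]
        exact setLIntegral_le_lintegral _ _

theorem lintegral_Lop_iterate_tsub_le {f g : (Fin d → ℝ) → ℝ≥0∞} (hf : Measurable f)
    (hg : Measurable g) (n : ℕ) :
    ∫⁻ x, (S.Lop^[n] f x - S.Lop^[n] g x) ≤ ∫⁻ x, (f x - g x) := by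
  induction n with
  | zero => exact le_rfl
  | succ n ih =>
    simp only [Function.iterate_succ_apply']
    exact (S.lintegral_Lop_tsub_le (S.measurable_Lop_iterate hf n)
      (S.measurable_Lop_iterate hg n)).trans ih

theorem aemeasurable_T : AEMeasurable S.T (volume.restrict S.Ω) :=
  S.continuousOn_T.aemeasurable S.measurableSet_Ω

theorem map_withDensity {f : (Fin d → ℝ) → ℝ≥0∞} (hf : Measurable f) :
    Measure.map S.T ((volume.restrict S.Ω).withDensity f) = volume.withDensity (S.Lop f) := by
  have hT : AEMeasurable S.T ((volume.restrict S.Ω).withDensity f) :=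
    S.aemeasurable_T.mono_ac (withDensity_absolutelyContinuous _ _)
  ext A hA
  rw [Measure.map_apply_of_aemeasurable hT hA, withDensity_apply _ hA, S.setLIntegral_Lop hf hA]
  obtain ⟨T', hT', hTT'⟩ := S.aemeasurable_T
  have h1 : ((volume.restrict S.Ω).withDensity f) (S.T ⁻¹' A)
      = ((volume.restrict S.Ω).withDensity f) (T' ⁻¹' A) := by
    refine measure_congr ?_
    filter_upwards [(withDensity_absolutelyContinuous (volume.restrict S.Ω) f).ae_le hTT']
      with x hx
    exact propext (by change S.T x ∈ A ↔ T' x ∈ A; rw [hx])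
  rw [h1, withDensity_apply _ (hT' hA), ← lintegral_indicator (hT' hA)]
  refine lintegral_congr_ae ?_
  filter_upwards [hTT'] with x hx
  rw [hx]
  by_cases h : T' x ∈ A <;> simp [indicator, h]

theorem integral_Lop_mul {f : (Fin d → ℝ) → ℝ≥0∞} (hf : Measurable f) (hfi : ∫⁻ x, f x ≠ ⊤)
    {G : (Fin d → ℝ) → ℝ} (hG : Continuous G) :
    ∫ x, (S.Lop f x).toReal * G x = ∫ x in S.Ω, (f x).toReal * G (S.T x) := by
  have hLi : ∫⁻ x, S.Lop f x ≠ ⊤ := ne_top_of_le_ne_top hfi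
    (S.lintegral_Lop_iterate_le hf 1)
  have hT : AEMeasurable S.T ((volume.restrict S.Ω).withDensity f) :=
    S.aemeasurable_T.mono_ac (withDensity_absolutelyContinuous _ _)
  have h1 := integral_withDensity_eq_integral_toReal_smul (S.measurable_Lop hf)
    (ae_lt_top (S.measurable_Lop hf) hLi) G
  have h2 := integral_withDensity_eq_integral_toReal_smul hf
    (ae_lt_top (μ := volume.restrict S.Ω) hf
      (ne_top_of_le_ne_top hfi (setLIntegral_le_lintegral _ _))) (fun x => G (S.T x))
  rw [← S.map_withDensity hf, integral_map hT hG.aestronglyMeasurable, h2] at h1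
  simpa using h1.symm

/-- `T` is non-singular on `Ω`. -/
theorem volume_preimage_eq_zero {N : Set (Fin d → ℝ)} (hN : volume N = 0) :
    volume (S.Ω ∩ S.T ⁻¹' N) = 0 := by
  have hm := measurableSet_toMeasurable volume N
  have h := S.setLIntegral_Lop (measurable_const (a := 1)) hm
  rw [Measure.restrict_eq_zero.2 ((measure_toMeasurable N).trans hN), lintegral_zero_measure] at h
  have h0 : AEMeasurable (fun x => (toMeasurable volume N).indicator (1 : (Fin d → ℝ) → ℝ≥0∞)
      (S.T x) * 1) (volume.restrict S.Ω) :=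
    ((measurable_one.indicator hm).comp_aemeasurable S.aemeasurable_T).mul_const 1
  have h1 := (ae_restrict_iff' S.measurableSet_Ω).1 ((lintegral_eq_zero_iff' h0).1 h.symm)
  rw [ae_iff] at h1
  refine measure_mono_null ?_ h1
  rintro x ⟨hx, hxN⟩
  have : S.T x ∈ toMeasurable volume N := subset_toMeasurable _ _ hxN
  simp [hx, this]

end PES

section OneDim

theorem enorm_sub_le_setLIntegral {f : ℝ → ℝ} (hf : ContDiff ℝ 1 f) {A : Set ℝ} {s t : ℝ}
    (hA : uIoc s t ⊆ A) : ‖f t - f s‖ₑ ≤ ∫⁻ y in A, ‖deriv f y‖ₑ := by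
  have h1 : ∫ y in s..t, deriv f y = f t - f s :=
    intervalIntegral.integral_deriv_eq_sub
      (fun y _ => (hf.differentiable one_ne_zero).differentiableAt)
      ((hf.continuous_deriv le_rfl).intervalIntegrable _ _)
  rw [← h1, ← enorm_norm, intervalIntegral.norm_integral_eq_norm_integral_uIoc, enorm_norm]
  exact (enorm_integral_le_lintegral_enorm _).trans (lintegral_mono_set hA)

theorem enorm_le_setLIntegral_window {f : ℝ → ℝ} (hf : ContDiff ℝ 1 f) {δ : ℝ} (hδ : 0 < δ)
    {a t : ℝ} (ht : t ∈ Icc a (a + δ)) :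
    ‖f t‖ₑ ≤ ∫⁻ y in Ioc a (a + δ), (‖deriv f y‖ₑ + (ENNReal.ofReal δ)⁻¹ * ‖f y‖ₑ) := by
  have hδ0 : ENNReal.ofReal δ ≠ 0 := by simpa using hδ
  set B := ∫⁻ y in Ioc a (a + δ), ‖deriv f y‖ₑ with hB
  have hle : ∀ y ∈ Ioc a (a + δ), ‖f t‖ₑ ≤ ‖f y‖ₑ + B := by
    intro y hy
    have h := enorm_sub_le_setLIntegral hf (A := Ioc a (a + δ)) (s := y) (t := t) (by
      rintro z ⟨h1, h2⟩
      exact ⟨(le_min hy.1.le ht.1).trans_lt h1, h2.trans (max_le hy.2 ht.2)⟩)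
    calc ‖f t‖ₑ = ‖f y + (f t - f y)‖ₑ := by congr 1; ring
      _ ≤ ‖f y‖ₑ + ‖f t - f y‖ₑ := enorm_add_le _ _
      _ ≤ _ := add_le_add_right h _
  have h2 : ENNReal.ofReal δ * ‖f t‖ₑ
      ≤ (∫⁻ y in Ioc a (a + δ), ‖f y‖ₑ) + ENNReal.ofReal δ * B := by
    have := setLIntegral_mono' (μ := volume) measurableSet_Ioc hle
    rw [setLIntegral_const, lintegral_add_right _ measurable_const, setLIntegral_const,
      Real.volume_Ioc, add_sub_cancel_left] at this
    rwa [mul_comm, mul_comm _ B]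
  rw [lintegral_add_left (hf.continuous_deriv le_rfl).measurable.enorm, ← hB,
    lintegral_const_mul _ hf.continuous.measurable.enorm]
  calc ‖f t‖ₑ = (ENNReal.ofReal δ)⁻¹ * (ENNReal.ofReal δ * ‖f t‖ₑ) := by
        rw [← mul_assoc, ENNReal.inv_mul_cancel hδ0 ENNReal.ofReal_ne_top, one_mul]
    _ ≤ (ENNReal.ofReal δ)⁻¹ * ((∫⁻ y in Ioc a (a + δ), ‖f y‖ₑ) + ENNReal.ofReal δ * B) := by
        gcongr
    _ = _ := by
        rw [mul_add, ← mul_assoc, ENNReal.inv_mul_cancel hδ0 ENNReal.ofReal_ne_top, one_mul,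
          add_comm]

/-- Integration by parts on a compact subinterval, with boundary terms absorbed in a window. -/
theorem enorm_intervalIntegral_le {f ψ u v : ℝ → ℝ} (hf : ContDiff ℝ 1 f) {δ : ℝ} (hδ : 0 < δ)
    {s t : ℝ} (hst : s ≤ t) {a : ℝ≥0∞} (hψ : ∀ y ∈ Icc s t, HasDerivAt ψ (u y + v y) y)
    (hu : ContinuousOn u (Icc s t)) (hv : ContinuousOn v (Icc s t))
    (ha : ∀ y ∈ Icc s t, ‖ψ y‖ₑ ≤ a) :
    ‖∫ y in Icc s t, f y * u y‖ₑ ≤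
      a * (∫⁻ y in Icc (s - δ) (t + δ), (‖deriv f y‖ₑ + (ENNReal.ofReal δ)⁻¹ * ‖f y‖ₑ))
        + ∫⁻ y in Icc s t, ‖f y‖ₑ * ‖v y‖ₑ := by
  set W : ℝ → ℝ≥0∞ := fun y => ‖deriv f y‖ₑ + (ENNReal.ofReal δ)⁻¹ * ‖f y‖ₑ with hW
  have hψc : ContinuousOn ψ (Icc s t) := fun y hy => (hψ y hy).continuousAt.continuousWithinAt
  have hd : ∀ y ∈ uIcc s t, HasDerivAt (fun y => f y * ψ y)
      (deriv f y * ψ y + f y * (u y + v y)) y := by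
    intro y hy
    rw [uIcc_of_le hst] at hy
    exact ((hf.differentiable one_ne_zero).differentiableAt.hasDerivAt).mul (hψ y hy)
  have hf'c := hf.continuous_deriv le_rfl
  have hWm : Measurable W :=
    hf'c.measurable.enorm.add (hf.continuous.measurable.enorm.const_mul _)
  have i1 : IntegrableOn (fun y => deriv f y * ψ y) (Icc s t) :=
    (hf'c.continuousOn.mul hψc).integrableOn_compact isCompact_Icc
  have i2 : IntegrableOn (fun y => f y * u y) (Icc s t) :=
    (hf.continuous.continuousOn.mul hu).integrableOn_compact isCompact_Icc
  have i3 : IntegrableOn (fun y => f y * v y) (Icc s t) :=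
    (hf.continuous.continuousOn.mul hv).integrableOn_compact isCompact_Icc
  have hftc := intervalIntegral.integral_eq_sub_of_hasDerivAt hd (by
    rw [intervalIntegrable_iff_integrableOn_Icc_of_le hst]
    simp only [mul_add]
    exact i1.add (i2.add i3))
  rw [intervalIntegral.integral_of_le hst, ← integral_Icc_eq_integral_Ioc] at hftc
  simp only [mul_add] at hftc
  have i23 : IntegrableOn (fun y => f y * u y + f y * v y) (Icc s t) := i2.add i3
  rw [integral_add i1 i23, integral_add i2 i3] at hftc
  have e : ∫ y in Icc s t, f y * u y = (f t * ψ t + -(f s * ψ s))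
      + (-(∫ y in Icc s t, deriv f y * ψ y) + -∫ y in Icc s t, f y * v y) := by linarith
  have b1 : ‖∫ y in Icc s t, deriv f y * ψ y‖ₑ ≤ a * ∫⁻ y in Ioc s t, W y := by
    refine (enorm_integral_le_lintegral_enorm _).trans ?_
    rw [setLIntegral_congr Ioc_ae_eq_Icc, ← lintegral_const_mul a hWm]
    refine setLIntegral_mono' measurableSet_Icc fun y hy => ?_
    rw [enorm_mul, mul_comm]
    exact mul_le_mul' (ha y hy) le_self_add
  have b2 : ‖∫ y in Icc s t, f y * v y‖ₑ ≤ ∫⁻ y in Icc s t, ‖f y‖ₑ * ‖v y‖ₑ := by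
    refine (enorm_integral_le_lintegral_enorm _).trans ?_
    simp only [enorm_mul]
    exact le_rfl
  have b3 : ‖f t * ψ t‖ₑ ≤ a * ∫⁻ y in Ioc t (t + δ), W y := by
    rw [enorm_mul, mul_comm]
    exact mul_le_mul' (ha t ⟨hst, le_rfl⟩)
      (enorm_le_setLIntegral_window hf hδ ⟨le_rfl, by linarith⟩)
  have b4 : ‖-(f s * ψ s)‖ₑ ≤ a * ∫⁻ y in Ioc (s - δ) s, W y := by
    rw [enorm_neg, enorm_mul, mul_comm]
    refine mul_le_mul' (ha s ⟨le_rfl, hst⟩) ?_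
    have := enorm_le_setLIntegral_window hf hδ (a := s - δ) (t := s) ⟨by linarith, by linarith⟩
    rwa [sub_add_cancel] at this
  have hsplit : (∫⁻ y in Ioc (s - δ) s, W y) + ((∫⁻ y in Ioc s t, W y)
      + ∫⁻ y in Ioc t (t + δ), W y) = ∫⁻ y in Icc (s - δ) (t + δ), W y := by
    rw [← lintegral_union measurableSet_Ioc (Ioc_disjoint_Ioc_of_le le_rfl),
      Ioc_union_Ioc_eq_Ioc hst (by linarith),
      ← lintegral_union measurableSet_Ioc (Ioc_disjoint_Ioc_of_le le_rfl),
      Ioc_union_Ioc_eq_Ioc (by linarith) (by linarith), setLIntegral_congr Ioc_ae_eq_Icc]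
  rw [e, ← hsplit, mul_add, mul_add]
  calc _ ≤ (‖f t * ψ t‖ₑ + ‖-(f s * ψ s)‖ₑ) + (‖∫ y in Icc s t, deriv f y * ψ y‖ₑ
        + ‖∫ y in Icc s t, f y * v y‖ₑ) := by
        refine (enorm_add_le _ _).trans (add_le_add (enorm_add_le _ _) ?_)
        refine (enorm_add_le _ _).trans ?_
        rw [enorm_neg, enorm_neg]
    _ ≤ _ := add_le_add (add_le_add b3 b4) (add_le_add b1 b2)
    _ = _ := by ring

/-- The interval form of the Lasota–Yorke estimate on a single branch domain. -/
theorem enorm_setIntegral_le {f ψ u v : ℝ → ℝ} (hf : ContDiff ℝ 1 f) {δ : ℝ} (hδ : 0 < δ)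
    {I : Set ℝ} (hI : IsOpen I) (hIc : IsPreconnected I) (hIb : I ⊆ Icc 0 1) {a : ℝ≥0∞}
    (hψ : ∀ y ∈ I, HasDerivAt ψ (u y + v y) y)
    (hu : ContinuousOn u I) (hv : ContinuousOn v I)
    (ha : ∀ y ∈ I, ‖ψ y‖ₑ ≤ a) (hi : IntegrableOn (fun y => f y * u y) I) :
    ‖∫ y in I, f y * u y‖ₑ ≤
      a * (∫⁻ y in {y | (Icc (y - δ) (y + δ) ∩ I).Nonempty},
          (‖deriv f y‖ₑ + (ENNReal.ofReal δ)⁻¹ * ‖f y‖ₑ))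
        + ∫⁻ y in I, ‖f y‖ₑ * ‖v y‖ₑ := by
  rcases I.eq_empty_or_nonempty with rfl | hne
  · simp
  have hbb : BddBelow I := ⟨0, fun y hy => (hIb hy).1⟩
  have hba : BddAbove I := ⟨1, fun y hy => (hIb hy).2⟩
  have hIeq : I = Ioo (sInf I) (sSup I) := by
    refine subset_antisymm (fun y hy => ?_)
      (IsConnected.Ioo_csInf_csSup_subset ⟨hne, hIc⟩ hbb hba)
    obtain ⟨l, u, hlu, hsub⟩ := mem_nhds_iff_exists_Ioo_subset.1 (hI.mem_nhds hy)
    obtain ⟨l', h1, h2⟩ := exists_between hlu.1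
    obtain ⟨u', h3, h4⟩ := exists_between hlu.2
    exact ⟨(csInf_le hbb (hsub ⟨h1, h2.trans hlu.2⟩)).trans_lt h2,
      h3.trans_le (le_csSup hba (hsub ⟨hlu.1.trans h3, h4⟩))⟩
  have hlt : sInf I < sSup I := by
    obtain ⟨y, hy⟩ := hne
    rw [hIeq] at hy
    exact hy.1.trans hy.2
  obtain ⟨s, hs_anti, hs_mem, hs_lim⟩ := exists_seq_strictAnti_tendsto' hlt
  obtain ⟨t, ht_mono, ht_mem, ht_lim⟩ := exists_seq_strictMono_tendsto' hlt
  have hcov : AECover (volume.restrict I) atTop fun n => Icc (s n) (t n) := by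
    rw [hIeq]
    exact aecover_Ioo_of_Icc hs_lim ht_lim
  have hlim := (hcov.integral_tendsto_of_countably_generated hi).enorm
  refine le_of_tendsto hlim ?_
  filter_upwards [hs_lim.eventually_lt ht_lim hlt] with n hn
  have hsub : Icc (s n) (t n) ⊆ I := by
    refine hIc.Icc_subset ?_ ?_
    · rw [hIeq]; exact hs_mem n
    · rw [hIeq]; exact ht_mem n
  rw [Measure.restrict_restrict measurableSet_Icc, inter_eq_left.2 hsub]
  refine (enorm_intervalIntegral_le hf hδ hn.le (fun y hy => hψ y (hsub hy)) (hu.mono hsub)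
    (hv.mono hsub) (fun y hy => ha y (hsub hy))).trans ?_
  refine add_le_add (mul_le_mul' le_rfl (lintegral_mono_set ?_)) (lintegral_mono_set hsub)
  rintro y ⟨h1, h2⟩
  rcases le_total y (s n) with h | h
  · exact ⟨s n, ⟨by linarith, by linarith⟩, hsub ⟨le_rfl, hn.le⟩⟩
  rcases le_total y (t n) with h' | h'
  · exact ⟨y, ⟨by linarith, by linarith⟩, hsub ⟨h, h'⟩⟩
  · exact ⟨t n, ⟨by linarith, by linarith⟩, hsub ⟨hn.le, le_rfl⟩⟩

theorem enorm_le_lintegral_enorm_deriv {f : ℝ → ℝ} (hf : ContDiff ℝ 1 f) (hc : HasCompactSupport f)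
    (t : ℝ) : ‖f t‖ₑ ≤ ∫⁻ y, ‖deriv f y‖ₑ := by
  obtain ⟨R, hR⟩ := hc.isCompact.bddAbove
  have h0 : f (R + 1) = 0 := by
    refine image_eq_zero_of_notMem_tsupport fun h => ?_
    have := hR h
    linarith
  have := enorm_sub_le_setLIntegral hf (A := univ) (s := R + 1) (t := t) (subset_univ _)
  simpa [h0] using this

end OneDim

namespace PES

variable {d : ℕ} (S : PES d)

/-- The vector field `(DT)⁻¹ (φ ∘ T)`. -/
def pull (φ : (Fin d → ℝ) → (Fin d → ℝ)) (j : Fin d) (x : Fin d → ℝ) : ℝ :=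
  ∑ i, jacInv S.T x j i * φ (S.T x) i

/-- The part of `∂_j` of `pull` in which the derivative hits `φ ∘ T`. -/
def pullMain (φ : (Fin d → ℝ) → (Fin d → ℝ)) (j : Fin d) (x : Fin d → ℝ) : ℝ :=
  ∑ i, jacInv S.T x j i * fderiv ℝ φ (S.T x) (fderiv ℝ S.T x (Pi.single j 1)) i

/-- The part of `∂_j` of `pull` in which the derivative hits `(DT)⁻¹`. -/
def pullRest (φ : (Fin d → ℝ) → (Fin d → ℝ)) (j : Fin d) (x : Fin d → ℝ) : ℝ :=
  ∑ i, jacDj S.T j x j i * φ (S.T x) i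

variable {S}

theorem hasDerivAt_jacInv {k : ℕ} {x : Fin d → ℝ} {j : Fin d} {y : ℝ}
    (h : Function.update x j y ∈ S.parts k) (i i' : Fin d) :
    HasDerivAt (fun y => jacInv S.T (Function.update x j y) i i')
      (jacDj S.T j (Function.update x j y) i i') y := by
  have h1 : DifferentiableAt ℝ (fun y => jacInv S.T (Function.update x j y) i i') y :=
    DifferentiableAt.comp (g := fun z => jacInv S.T z i i') y
      ((S.contDiffAt_jacInv h i i').differentiableAt one_ne_zero)
      (hasDerivAt_update x j y).differentiableAt
  have h2 := h1.hasDerivAt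
  simpa [jacDj] using h2

theorem jacDj_eq_fderiv {k : ℕ} {x : Fin d → ℝ} (hx : x ∈ S.parts k) (j i i' : Fin d) :
    jacDj S.T j x i i' = fderiv ℝ (fun z => jacInv S.T z i i') x (Pi.single j 1) := by
  have h : Function.update x j (x j) ∈ S.parts k := by rwa [Function.update_eq_self]
  have h1 := hasDerivAt_jacInv h i i'
  have h2 := HasFDerivAt.comp_hasDerivAt (l := fun z => jacInv S.T z i i') (x j)
    ((S.contDiffAt_jacInv h i i').differentiableAt one_ne_zero).hasFDerivAt
    (hasDerivAt_update x j (x j))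
  have h3 := h1.unique h2
  rwa [Function.update_eq_self] at h3

theorem continuousOn_jacDj (k : ℕ) (j i i' : Fin d) :
    ContinuousOn (fun x => jacDj S.T j x i i') (S.parts k) := by
  have : ContinuousOn (fun x => fderiv ℝ (fun z => jacInv S.T z i i') x (Pi.single j 1))
      (S.parts k) := fun x hx =>
    (((S.contDiffAt_jacInv hx i i').fderiv_right (m := 0) (by norm_num)).continuousAt.clm_apply
      continuousAt_const).continuousWithinAt
  exact this.congr fun x hx => jacDj_eq_fderiv hx j i i'

theorem continuousOn_T_parts (k : ℕ) : ContinuousOn S.T (S.parts k) :=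
  S.continuousOn_T.mono (S.parts_subset k)

theorem continuousOn_pullMain {φ : (Fin d → ℝ) → (Fin d → ℝ)} (hφ : ContDiff ℝ 1 φ) (j : Fin d)
    (k : ℕ) : ContinuousOn (S.pullMain φ j) (S.parts k) := by
  refine continuousOn_finsetSum _ fun i _ => ContinuousOn.mul ?_ ?_
  · exact fun x hx => (S.contDiffAt_jacInv hx j i).continuousAt.continuousWithinAt
  · have h1 : ContinuousOn (fun x => fderiv ℝ φ (S.T x)) (S.parts k) :=
      (hφ.continuous_fderiv one_ne_zero).comp_continuousOn (continuousOn_T_parts k)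
    have h2 : ContinuousOn (fun x => fderiv ℝ S.T x (Pi.single j 1)) (S.parts k) := fun x hx =>
      ((S.contDiffAt_fderiv hx).continuousAt.clm_apply continuousAt_const).continuousWithinAt
    exact (continuous_apply i).comp_continuousOn (h1.clm_apply h2)

theorem continuousOn_pullRest {φ : (Fin d → ℝ) → (Fin d → ℝ)} (hφ : ContDiff ℝ 1 φ) (j : Fin d)
    (k : ℕ) : ContinuousOn (S.pullRest φ j) (S.parts k) := by
  refine continuousOn_finsetSum _ fun i _ => ContinuousOn.mul (continuousOn_jacDj k j j i) ?_
  exact (continuous_apply i).comp_continuousOn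
    (hφ.continuous.comp_continuousOn (continuousOn_T_parts k))

theorem hasDerivAt_pull {φ : (Fin d → ℝ) → (Fin d → ℝ)} (hφ : ContDiff ℝ 1 φ) {k : ℕ}
    {x : Fin d → ℝ} {j : Fin d} {y : ℝ} (h : Function.update x j y ∈ S.parts k) :
    HasDerivAt (fun y => S.pull φ j (Function.update x j y))
      (S.pullMain φ j (Function.update x j y) + S.pullRest φ j (Function.update x j y)) y := by
  have hT : HasDerivAt (fun y => S.T (Function.update x j y))
      (fderiv ℝ S.T (Function.update x j y) (Pi.single j 1)) y :=
    HasFDerivAt.comp_hasDerivAt (l := S.T) y (S.differentiableAt_T h).hasFDerivAt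
      (hasDerivAt_update x j y)
  have hφT := HasFDerivAt.comp_hasDerivAt (l := φ) y
    (hφ.differentiable one_ne_zero _).hasFDerivAt hT
  have := HasDerivAt.fun_sum (u := Finset.univ) fun i (_ : i ∈ Finset.univ) =>
    (hasDerivAt_jacInv h j i).mul (hasDerivAt_pi.1 hφT i)
  refine HasDerivAt.congr_deriv (f := fun y => S.pull φ j (Function.update x j y)) this ?_
  rw [pullMain, pullRest, ← Finset.sum_add_distrib]
  exact Finset.sum_congr rfl fun i _ => add_comm _ _

theorem abs_pull_le {φ : (Fin d → ℝ) → (Fin d → ℝ)} (hφ : ∀ x, ‖φ x‖ ≤ 1) (j : Fin d)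
    (x : Fin d → ℝ) : |S.pull φ j x| ≤ matNorm (jacInv S.T x) := by
  simpa [pull] using abs_sum_mul_le_matNorm (jacInv S.T x) j (v := φ (S.T x)) (r := 1)
    fun i => (norm_le_pi_norm _ i).trans (hφ _)

theorem abs_pullRest_le {φ : (Fin d → ℝ) → (Fin d → ℝ)} (hφ : ∀ x, ‖φ x‖ ≤ 1) (j : Fin d)
    (x : Fin d → ℝ) : |S.pullRest φ j x| ≤ matNorm (jacDj S.T j x) := by
  simpa [pullRest] using abs_sum_mul_le_matNorm (jacDj S.T j x) j (v := φ (S.T x)) (r := 1)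
    fun i => (norm_le_pi_norm _ i).trans (hφ _)

theorem pullMain_eq (φ : (Fin d → ℝ) → (Fin d → ℝ)) (j : Fin d) (x : Fin d → ℝ) :
    S.pullMain φ j x = ∑ i, ∑ k, (jac S.T x k j * jacInv S.T x j i) *
      fderiv ℝ φ (S.T x) (Pi.single k 1) i := by
  refine Finset.sum_congr rfl fun i _ => ?_
  have e : fderiv ℝ S.T x (Pi.single j 1) = ∑ k, jac S.T x k j • (Pi.single k 1 : Fin d → ℝ) := by
    ext k
    simp [jac, Finset.sum_apply, Pi.single_apply]
  rw [e, map_sum, Finset.sum_apply, Finset.mul_sum]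
  refine Finset.sum_congr rfl fun k _ => ?_
  rw [map_smul, Pi.smul_apply, smul_eq_mul]
  ring

theorem sum_pullMain (φ : (Fin d → ℝ) → (Fin d → ℝ)) {x : Fin d → ℝ} (hx : x ∈ S.Ω) :
    ∑ j, S.pullMain φ j x = divg φ (S.T x) := by
  obtain ⟨k, hk⟩ := S.exists_mem_parts hx
  have hinv : jac S.T x * jacInv S.T x = 1 :=
    Matrix.mul_nonsing_inv _ (isUnit_iff_ne_zero.2 (S.det_jac_ne_zero hk))
  simp only [pullMain_eq]
  rw [Finset.sum_comm, divg]
  refine Finset.sum_congr rfl fun i _ => ?_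
  rw [Finset.sum_comm]
  have : ∀ k, ∑ j, jac S.T x k j * jacInv S.T x j i * fderiv ℝ φ (S.T x) (Pi.single k 1) i
      = (1 : Matrix (Fin d) (Fin d) ℝ) k i * fderiv ℝ φ (S.T x) (Pi.single k 1) i := by
    intro k
    rw [← Finset.sum_mul, ← hinv, Matrix.mul_apply]
  simp only [this, Matrix.one_apply]
  simp

theorem integrableOn_mul_pullMain {φ : (Fin d → ℝ) → (Fin d → ℝ)} (hφ : IsTest d φ)
    {p : (Fin d → ℝ) → ℝ} (hp : Continuous p) (hc : HasCompactSupport p) (j : Fin d) :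
    IntegrableOn (fun x => p x * S.pullMain φ j x) S.Ω := by
  simp only [pullMain_eq, Finset.mul_sum]
  refine integrable_finsetSum _ fun i _ => integrable_finsetSum _ fun k _ => ?_
  have hcont : Continuous fun x => fderiv ℝ φ x (Pi.single k 1) i :=
    (continuous_apply i).comp ((hφ.1.continuous_fderiv one_ne_zero).clm_apply continuous_const)
  obtain ⟨C, hC⟩ := (hφ.2.1.fderiv (𝕜 := ℝ)).exists_bound_of_continuous
    (hφ.1.continuous_fderiv one_ne_zero)
  obtain ⟨D, hD⟩ := hc.exists_bound_of_continuous hp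
  have hb : ∀ x, ‖fderiv ℝ φ x (Pi.single k 1) i‖ ≤ C := fun x => by
    refine (norm_le_pi_norm _ i).trans ((ContinuousLinearMap.le_opNorm _ _).trans ?_)
    rw [Pi.norm_single, norm_one, mul_one]
    exact hC x
  have h1 : AEStronglyMeasurable (fun x => fderiv ℝ φ (S.T x) (Pi.single k 1) i)
      (volume.restrict S.Ω) :=
    (hcont.measurable.comp_aemeasurable S.aemeasurable_T).aestronglyMeasurable
  have h2 := ((S.h5 i j k).mul_bdd (c := C) h1 (ae_of_all _ fun x => hb _)).bdd_mul (c := D)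
    hp.aestronglyMeasurable (ae_of_all _ hD)
  exact h2

end PES

section InnerPart

variable {d : ℕ}

theorem ball_subset_of_le_infDist {U : Set (Fin d → ℝ)} (hU : IsOpen U) {x : Fin d → ℝ}
    (hx : x ∈ U) {ε : ℝ} (h : ε ≤ Metric.infDist x (frontier U)) : Metric.ball x ε ⊆ U := by
  rcases le_or_gt ε 0 with h0 | h0
  · simp [Metric.ball_eq_empty.2 h0]
  refine IsPreconnected.subset_left_of_subset_union hU isClosed_closure.isOpen_compl
    (disjoint_compl_right.mono_left subset_closure |>.mono_right subset_rfl) (fun z hz => ?_)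
    ⟨x, Metric.mem_ball_self h0, hx⟩ (convex_ball x ε).isPreconnected
  by_contra hz'
  rw [mem_union, not_or, notMem_compl_iff] at hz'
  have hzf : z ∈ frontier U := by
    rw [frontier, hU.interior_eq]
    exact ⟨hz'.2, hz'.1⟩
  have := Metric.infDist_le_dist_of_mem (x := x) hzf
  rw [Metric.mem_ball, dist_comm] at hz
  linarith

theorem isCompact_innerPart {U : Set (Fin d → ℝ)} (hU : IsOpen U) (hb : Bornology.IsBounded U)
    {ε : ℝ} (hε : 0 < ε) : IsCompact (innerPart U ε) := by
  have e : innerPart U ε = closure U ∩ {x | ε ≤ Metric.infDist x (frontier U)} := by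
    ext x
    refine ⟨fun h => ⟨subset_closure h.1, h.2⟩, fun h => ⟨?_, h.2⟩⟩
    by_contra hx
    have hf : x ∈ frontier U := by
      rw [frontier, hU.interior_eq]
      exact ⟨h.1, hx⟩
    have h2 : ε ≤ Metric.infDist x (frontier U) := h.2
    rw [Metric.infDist_zero_of_mem hf] at h2
    linarith
  rw [e]
  exact hb.isCompact_closure.inter_right
    (isClosed_le continuous_const (Metric.continuous_infDist_pt _))

end InnerPart

namespace PES

variable {d : ℕ} {S : PES d}

theorem isBounded_parts (k : ℕ) : Bornology.IsBounded (S.parts k) :=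
  (isCompact_Icc.isBounded.subset S.Ω_subset).subset (S.parts_subset k)

theorem finite_innerPart_nonempty {ε : ℝ} (hε : 0 < ε) :
    {k | (innerPart (S.parts k) ε).Nonempty}.Finite := by
  have hne : volume (⋃ k, S.parts k) ≠ ⊤ := by
    rw [S.parts_union]
    exact ne_top_of_le_ne_top ENNReal.one_ne_top S.volume_Ω_le_one
  refine (Measure.finite_const_le_meas_of_disjoint_iUnion volume
    (ε := volume (Metric.ball (0 : Fin d → ℝ) ε)) (Metric.measure_ball_pos _ _ hε)
    (fun k => (S.parts_open k).measurableSet) S.parts_disj hne).subset ?_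
  rintro k ⟨x, hx⟩
  have := measure_mono (μ := volume) (ball_subset_of_le_infDist (S.parts_open k) hx.1 hx.2)
  rwa [Measure.addHaar_ball_center] at this

theorem exists_jacDj_bound {ε : ℝ} (hε : 0 < ε) (j : Fin d) :
    ∃ K : ℝ≥0, ∀ k, ∀ z ∈ innerPart (S.parts k) ε,
      ENNReal.ofReal (matNorm (jacDj S.T j z)) ≤ K := by
  have hcomp : IsCompact (⋃ k ∈ {k | (innerPart (S.parts k) ε).Nonempty},
      innerPart (S.parts k) ε) :=
    (finite_innerPart_nonempty hε).isCompact_biUnion fun k _ =>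
      isCompact_innerPart (S.parts_open k) (isBounded_parts k) hε
  obtain ⟨K, hK⟩ := hcomp.bddAbove_image (f := fun z => matNorm (jacDj S.T j z)) (by
    intro z hz
    simp only [mem_iUnion] at hz
    obtain ⟨k, -, hk⟩ := hz
    exact ((continuousOn_matNorm fun i i' => continuousOn_jacDj k j i i').continuousAt
      ((S.parts_open k).mem_nhds hk.1)).continuousWithinAt)
  refine ⟨K.toNNReal, fun k z hz => ENNReal.ofReal_le_ofReal (hK ⟨z, ?_, rfl⟩)⟩
  simp only [mem_iUnion]
  exact ⟨k, ⟨z, hz⟩, hz⟩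

theorem measurableSet_window {δ : ℝ} {I : Set ℝ} (hI : IsPreconnected I) :
    MeasurableSet {y : ℝ | (Icc (y - δ) (y + δ) ∩ I).Nonempty} := by
  refine OrdConnected.measurableSet ⟨?_⟩
  rintro y₁ ⟨s₁, ⟨h1, h2⟩, hs₁⟩ y₂ ⟨s₂, ⟨h3, h4⟩, hs₂⟩ y ⟨h5, h6⟩
  rcases le_or_gt (y - δ) s₁ with h7 | h7
  · exact ⟨s₁, ⟨h7, by linarith⟩, hs₁⟩
  rcases le_or_gt s₂ (y + δ) with h8 | h8
  · exact ⟨s₂, ⟨by linarith, h8⟩, hs₂⟩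
  rcases le_or_gt 0 δ with h9 | h9
  · exact ⟨y, ⟨by linarith, by linarith⟩, hI.ordConnected.out hs₁ hs₂ ⟨by linarith, by linarith⟩⟩
  · linarith

theorem Ifam_subset_Icc (j : Fin d) (x : Fin d → ℝ) (k ℓ : ℕ) : S.Ifam j x k ℓ ⊆ Icc 0 1 := by
  intro y hy
  have h := S.Ω_subset (S.parts_subset k ((S.update_mem_iff j x k y).2 ⟨ℓ, hy⟩))
  exact ⟨by simpa using h.1 j, by simpa using h.2 j⟩

theorem tsum_window_le {x : Fin d → ℝ} {j : Fin d} {y₀ : ℝ} (h₀ : Function.update x j y₀ ∈ S.Ω)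
    (y : ℝ) :
    (∑' q : ℕ × ℕ, if (Icc (y - S.δ) (y + S.δ) ∩ S.Ifam j x q.1 q.2).Nonempty then
        ⨆ t ∈ S.Ifam j x q.1 q.2, ENNReal.ofReal (matNorm (jacInv S.T (Function.update x j t)))
      else 0) ≤ ENNReal.ofReal S.lam⁻¹ := by
  set c : ℝ := max 0 (min 1 y) with hc
  have hx' : Function.update x j c ∈ Icc (0 : Fin d → ℝ) 1 := by
    have h := S.Ω_subset h₀
    refine ⟨fun i => ?_, fun i => ?_⟩
    · rcases eq_or_ne i j with rfl | hi
      · simp [hc]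
      · simpa [hi] using h.1 i
    · rcases eq_or_ne i j with rfl | hi
      · simp [hc]
      · simpa [hi] using h.2 i
  refine le_trans (ENNReal.tsum_le_tsum fun q => ?_) (S.h3 _ hx' j)
  have hI : S.Ifam j (Function.update x j c) q.1 q.2 = S.Ifam j x q.1 q.2 :=
    S.Ifam_indep j _ _ _ _ fun i hi => by simp [hi]
  simp only [hI, Function.update_self, Function.update_idem]
  split_ifs with h1 h2
  · exact le_rfl
  · refine absurd ?_ h2
    obtain ⟨s, ⟨h3, h4⟩, hs⟩ := h1
    obtain ⟨h5, h6⟩ := Ifam_subset_Icc j x _ _ hs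
    refine ⟨s, ⟨?_, ?_⟩, hs⟩
    · rw [hc, sub_le_iff_le_add]
      refine max_le (by linarith [S.δ_pos]) ((min_le_right _ _).trans (by linarith))
    · rw [hc, ← sub_le_iff_le_add]
      exact le_max_of_le_right (le_min (by linarith [S.δ_pos]) (by linarith))
  · exact zero_le
  · exact le_rfl

theorem pairwise_disjoint_Ifam (j : Fin d) (x : Fin d → ℝ) :
    Pairwise (Function.onFun Disjoint fun q : ℕ × ℕ => S.Ifam j x q.1 q.2) := by
  rintro ⟨k, ℓ⟩ ⟨k', ℓ'⟩ hne
  rcases eq_or_ne k k' with rfl | hk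
  · exact S.Ifam_disj j x k fun h => hne (Prod.ext rfl h)
  · refine Set.disjoint_left.2 fun y hy hy' => ?_
    exact Set.disjoint_left.1 (S.parts_disj hk) ((S.update_mem_iff j x k y).2 ⟨ℓ, hy⟩)
      ((S.update_mem_iff j x k' y).2 ⟨ℓ', hy'⟩)

theorem slice_eq_iUnion (j : Fin d) (x : Fin d → ℝ) :
    {y : ℝ | Function.update x j y ∈ S.Ω} = ⋃ q : ℕ × ℕ, S.Ifam j x q.1 q.2 := by
  ext y
  simp only [mem_ofPred_eq, mem_iUnion, Prod.exists, ← S.update_mem_iff, ← S.parts_union]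

theorem enorm_slice_le {p : (Fin d → ℝ) → ℝ} (hp : ContDiff ℝ 1 p) (hc : HasCompactSupport p)
    {φ : (Fin d → ℝ) → (Fin d → ℝ)} (hφ : IsTest d φ) (j : Fin d) {ε : ℝ} {κ K : ℝ≥0∞}
    (hκ : ∀ x, ∑' k, ∫⁻ y in Icc (0 : ℝ) 1, (bLayer (S.parts k) ε).indicator
      (fun z => ENNReal.ofReal (matNorm (jacDj S.T j z))) (Function.update x j y) ≤ κ)
    (hK : ∀ k, ∀ z ∈ innerPart (S.parts k) ε, ENNReal.ofReal (matNorm (jacDj S.T j z)) ≤ K)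
    {x : Fin d → ℝ} (hi : IntegrableOn (fun y => p (Function.update x j y) *
      S.pullMain φ j (Function.update x j y)) {y | Function.update x j y ∈ S.Ω}) :
    ‖∫ y in {y | Function.update x j y ∈ S.Ω}, p (Function.update x j y) *
      S.pullMain φ j (Function.update x j y)‖ₑ ≤
      (ENNReal.ofReal S.lam⁻¹ + κ) *
        (∫⁻ y, ‖fderiv ℝ p (Function.update x j y) (Pi.single j 1)‖ₑ) +
      (ENNReal.ofReal S.lam⁻¹ * (ENNReal.ofReal S.δ)⁻¹ + K) *
        ∫⁻ y, ‖p (Function.update x j y)‖ₑ := by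
  rcases Set.eq_empty_or_nonempty {y | Function.update x j y ∈ S.Ω} with h0 | ⟨y₀, hy₀⟩
  · simp [h0]
  set I : ℕ × ℕ → Set ℝ := fun q => S.Ifam j x q.1 q.2 with hI
  set f : ℝ → ℝ := fun y => p (Function.update x j y) with hfdef
  have hf : ContDiff ℝ 1 f := hp.comp (contDiff_update 1 x j)
  have hf' : ∀ y, deriv f y = fderiv ℝ p (Function.update x j y) (Pi.single j 1) := fun y =>
    (((hp.differentiable one_ne_zero) _).hasFDerivAt.comp_hasDerivAt y
      (hasDerivAt_update x j y)).deriv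
  have hfc : HasCompactSupport f := by
    refine HasCompactSupport.intro (hc.isCompact.image (continuous_apply j)) fun y hy => ?_
    exact image_eq_zero_of_notMem_tsupport (f := p) fun h => hy ⟨Function.update x j y, h, by simp⟩
  have hIo : ∀ q, IsOpen (I q) := fun q => S.Ifam_open _ _ _ _
  have hmem : ∀ q y, y ∈ I q → Function.update x j y ∈ S.parts q.1 := fun q y hy =>
    (S.update_mem_iff j x q.1 y).2 ⟨q.2, hy⟩
  set a : ℕ × ℕ → ℝ≥0∞ := fun q =>
    ⨆ t ∈ I q, ENNReal.ofReal (matNorm (jacInv S.T (Function.update x j t))) with ha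
  set W : ℕ × ℕ → Set ℝ := fun q => {y | (Icc (y - S.δ) (y + S.δ) ∩ I q).Nonempty} with hW
  set g : ℝ → ℝ≥0∞ := fun y => ‖deriv f y‖ₑ + (ENNReal.ofReal S.δ)⁻¹ * ‖f y‖ₑ with hg
  set D : ℝ≥0∞ := ∫⁻ y, ‖deriv f y‖ₑ with hD
  set v : ℝ → ℝ := fun y => S.pullRest φ j (Function.update x j y) with hv
  have hcu : ∀ q, ContinuousOn (fun y => Function.update x j y) (I q) := fun q =>
    (contDiff_update (𝕜 := ℝ) 1 x j).continuous.continuousOn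
  rw [slice_eq_iUnion] at hi ⊢
  have hmeasf : Measurable fun y => ‖f y‖ₑ := hf.continuous.enorm.measurable
  have hmeasd : Measurable fun y => ‖deriv f y‖ₑ :=
    (hf.continuous_deriv le_rfl).enorm.measurable
  have hmeasg : Measurable g := hmeasd.add (hmeasf.const_mul _)
  have hDtop : D ≠ ⊤ :=
    ((hf.continuous_deriv le_rfl).integrable_of_hasCompactSupport hfc.deriv).2.ne
  have key : ∀ q, ‖∫ y in I q, f y * S.pullMain φ j (Function.update x j y)‖ₑ ≤
      a q * (∫⁻ y in W q, g y) + ∫⁻ y in I q, ‖f y‖ₑ * ‖v y‖ₑ := fun q =>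
    enorm_setIntegral_le hf S.δ_pos (hIo q) (S.Ifam_conn _ _ _ _) (Ifam_subset_Icc _ _ _ _)
      (fun y hy => hasDerivAt_pull hφ.1 (hmem q y hy))
      ((continuousOn_pullMain hφ.1 j q.1).comp (hcu q) (hmem q))
      ((continuousOn_pullRest hφ.1 j q.1).comp (hcu q) (hmem q))
      (fun y hy => by
        refine le_trans ?_ (le_iSup₂ (f := fun t (_ : t ∈ I q) =>
          ENNReal.ofReal (matNorm (jacInv S.T (Function.update x j t)))) y hy)
        rw [Real.enorm_eq_ofReal_abs]
        exact ENNReal.ofReal_le_ofReal (abs_pull_le hφ.2.2 _ _))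
      (hi.mono_set (subset_iUnion I q))
  have hmain : ∑' q, a q * ∫⁻ y in W q, g y ≤ ENNReal.ofReal S.lam⁻¹ * ∫⁻ y, g y := by
    have e : ∀ q, a q * ∫⁻ y in W q, g y = ∫⁻ y, (if y ∈ W q then a q else 0) * g y := by
      intro q
      rw [← lintegral_indicator (measurableSet_window (S.Ifam_conn _ _ _ _)),
        ← lintegral_const_mul _ (hmeasg.indicator (measurableSet_window (S.Ifam_conn _ _ _ _)))]
      refine lintegral_congr fun y => ?_
      by_cases hy : y ∈ W q
      · rw [indicator_of_mem hy, if_pos hy]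
      · rw [indicator_of_notMem hy, if_neg hy, mul_zero, zero_mul]
    simp_rw [e]
    have hmeas : ∀ q, Measurable fun y => (if y ∈ W q then a q else 0) * g y := fun q =>
      (Measurable.ite (measurableSet_window (S.Ifam_conn _ _ _ _))
        measurable_const measurable_const).mul hmeasg
    rw [← lintegral_tsum fun q => (hmeas q).aemeasurable, ← lintegral_const_mul _ hmeasg]
    refine lintegral_mono fun y => ?_
    simp only [ENNReal.tsum_mul_right]
    gcongr
    exact tsum_window_le hy₀ y
  have hrest : ∑' q, ∫⁻ y in I q, ‖f y‖ₑ * ‖v y‖ₑ ≤ κ * D + K * ∫⁻ y, ‖f y‖ₑ := by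
    set G : ℕ → ℝ → ℝ≥0∞ := fun k y => (bLayer (S.parts k) ε).indicator
      (fun z => ENNReal.ofReal (matNorm (jacDj S.T j z))) (Function.update x j y) with hG
    have h1 : ∀ q, ∫⁻ y in I q, ‖f y‖ₑ * ‖v y‖ₑ ≤
        (∫⁻ y in I q, G q.1 y) * D + K * ∫⁻ y in I q, ‖f y‖ₑ := by
      intro q
      rw [← lintegral_mul_const' _ _ hDtop, ← lintegral_const_mul _ hmeasf,
        ← lintegral_add_right _ (hmeasf.const_mul _)]
      refine setLIntegral_mono' (hIo q).measurableSet fun y hy => ?_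
      have hvy : ‖v y‖ₑ ≤ ENNReal.ofReal (matNorm (jacDj S.T j (Function.update x j y))) := by
        rw [Real.enorm_eq_ofReal_abs]
        exact ENNReal.ofReal_le_ofReal (abs_pullRest_le hφ.2.2 _ _)
      by_cases hin : Function.update x j y ∈ innerPart (S.parts q.1) ε
      · rw [mul_comm]
        exact le_add_left (mul_le_mul_left (hvy.trans (hK _ _ hin)) _)
      · have hb : Function.update x j y ∈ bLayer (S.parts q.1) ε := ⟨hmem q y hy, hin⟩
        rw [hG]
        simp only [indicator_of_mem hb]
        rw [mul_comm]
        exact le_add_right (mul_le_mul' hvy (enorm_le_lintegral_enorm_deriv hf hfc y))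
    refine (ENNReal.tsum_le_tsum h1).trans ?_
    rw [ENNReal.tsum_add, ENNReal.tsum_mul_right, ENNReal.tsum_mul_left]
    gcongr
    · rw [ENNReal.tsum_prod']
      refine (ENNReal.tsum_le_tsum fun k => ?_).trans (hκ x)
      refine (lintegral_iUnion (s := fun ℓ => I (k, ℓ)) (fun ℓ => (hIo (k, ℓ)).measurableSet)
        (S.Ifam_disj j x k) (G k)).ge.trans ?_
      exact lintegral_mono_set (iUnion_subset fun ℓ => Ifam_subset_Icc _ _ _ _)
    · rw [← lintegral_iUnion (fun q => (hIo q).measurableSet) (pairwise_disjoint_Ifam j x)]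
      exact setLIntegral_le_lintegral _ _
  rw [integral_iUnion (fun q => (hIo q).measurableSet) (pairwise_disjoint_Ifam j x) hi]
  refine enorm_tsum_le_tsum_enorm.trans ((ENNReal.tsum_le_tsum key).trans ?_)
  rw [ENNReal.tsum_add]
  refine (add_le_add hmain hrest).trans (le_of_eq ?_)
  have hgD : ∫⁻ y, g y = D + (ENNReal.ofReal S.δ)⁻¹ * ∫⁻ y, ‖f y‖ₑ := by
    rw [hg, lintegral_add_left hmeasd, lintegral_const_mul _ hmeasf]
  simp only [← hf', hgD]
  ring

end PES

section Slices

variable {n : ℕ}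

theorem update_insertNth_eq (j : Fin (n + 1)) :
    (fun q : ℝ × (Fin n → ℝ) => Function.update (j.insertNth (α := fun _ => ℝ) 0 q.2) j q.1) =
      (MeasurableEquiv.piFinSuccAbove (fun _ : Fin (n + 1) => ℝ) j).symm := by
  funext q
  rw [Fin.update_insertNth]
  rfl

theorem measurePreserving_insertNth (j : Fin (n + 1)) :
    MeasurePreserving (fun q : ℝ × (Fin n → ℝ) =>
      Function.update (j.insertNth (α := fun _ => ℝ) 0 q.2) j q.1) volume volume := by
  rw [update_insertNth_eq]
  exact (volume_preserving_piFinSuccAbove (fun _ : Fin (n + 1) => ℝ) j).symm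

theorem measurableEmbedding_insertNth (j : Fin (n + 1)) :
    MeasurableEmbedding (fun q : ℝ × (Fin n → ℝ) =>
      Function.update (j.insertNth (α := fun _ => ℝ) 0 q.2) j q.1) := by
  rw [update_insertNth_eq]
  exact (MeasurableEquiv.piFinSuccAbove (fun _ : Fin (n + 1) => ℝ) j).symm.measurableEmbedding

theorem lintegral_eq_lintegral_slice (j : Fin (n + 1)) {g : (Fin (n + 1) → ℝ) → ℝ≥0∞}
    (hg : Measurable g) :
    ∫⁻ x, g x = ∫⁻ z : Fin n → ℝ, ∫⁻ y,
      g (Function.update (j.insertNth (α := fun _ => ℝ) 0 z) j y) := by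
  have h := measurePreserving_insertNth j
  rw [← h.lintegral_comp hg]
  exact lintegral_prod_symm' _ (hg.comp h.measurable)

theorem enorm_integral_le_lintegral_slice (j : Fin (n + 1)) {g : (Fin (n + 1) → ℝ) → ℝ}
    (hg : Integrable g) :
    ‖∫ x, g x‖ₑ ≤ ∫⁻ z : Fin n → ℝ,
      ‖∫ y, g (Function.update (j.insertNth (α := fun _ => ℝ) 0 z) j y)‖ₑ := by
  have h := measurePreserving_insertNth j
  rw [← h.integral_comp (measurableEmbedding_insertNth j)]
  have hi := (h.integrable_comp_emb (measurableEmbedding_insertNth j)).2 hg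
  rw [Measure.volume_eq_prod] at hi ⊢
  refine le_trans (le_of_eq (congrArg _ (integral_prod_symm _ hi))) ?_
  exact enorm_integral_le_lintegral_enorm _

theorem ae_integrable_slice (j : Fin (n + 1)) {g : (Fin (n + 1) → ℝ) → ℝ}
    (hg : Integrable g) : ∀ᵐ z : Fin n → ℝ,
      Integrable fun y => g (Function.update (j.insertNth (α := fun _ => ℝ) 0 z) j y) :=
  (((measurePreserving_insertNth j).integrable_comp_emb
    (measurableEmbedding_insertNth j)).2 hg).prod_left_ae

end Slices

namespace PES

variable {n : ℕ} {S : PES (n + 1)}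

theorem enorm_integral_mul_pullMain_le {p : (Fin (n + 1) → ℝ) → ℝ} (hp : ContDiff ℝ 1 p)
    (hc : HasCompactSupport p) {φ : (Fin (n + 1) → ℝ) → (Fin (n + 1) → ℝ)}
    (hφ : IsTest (n + 1) φ) (j : Fin (n + 1)) {ε : ℝ} {κ K : ℝ≥0∞}
    (hκ : ∀ x, ∑' k, ∫⁻ y in Icc (0 : ℝ) 1, (bLayer (S.parts k) ε).indicator
      (fun z => ENNReal.ofReal (matNorm (jacDj S.T j z))) (Function.update x j y) ≤ κ)
    (hK : ∀ k, ∀ z ∈ innerPart (S.parts k) ε, ENNReal.ofReal (matNorm (jacDj S.T j z)) ≤ K) :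
    ‖∫ x in S.Ω, p x * S.pullMain φ j x‖ₑ ≤
      (ENNReal.ofReal S.lam⁻¹ + κ) * (∫⁻ x, ‖fderiv ℝ p x (Pi.single j 1)‖ₑ) +
      (ENNReal.ofReal S.lam⁻¹ * (ENNReal.ofReal S.δ)⁻¹ + K) * ∫⁻ x, ‖p x‖ₑ := by
  have hi := integrableOn_mul_pullMain (S := S) hφ hp.continuous hc j
  have hg := (integrable_indicator_iff S.measurableSet_Ω).2 hi
  have hm1 : Measurable fun x => ‖fderiv ℝ p x (Pi.single j 1)‖ₑ :=
    (continuous_fderiv_single hp j).enorm.measurable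
  have hm2 : Measurable fun x => ‖p x‖ₑ := hp.continuous.enorm.measurable
  rw [← integral_indicator S.measurableSet_Ω]
  refine (enorm_integral_le_lintegral_slice j hg).trans ?_
  rw [lintegral_eq_lintegral_slice j hm1, lintegral_eq_lintegral_slice j hm2]
  have hu : Measurable fun q : (Fin n → ℝ) × ℝ =>
      Function.update (j.insertNth (α := fun _ => ℝ) 0 q.1) j q.2 :=
    (measurePreserving_insertNth j).measurable.comp measurable_swap
  have hs1 := (hm1.comp hu).lintegral_prod_right' (ν := volume)
  have hs2 := (hm2.comp hu).lintegral_prod_right' (ν := volume)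
  simp only [Function.comp_def] at hs1 hs2
  rw [← lintegral_const_mul _ hs1, ← lintegral_const_mul _ hs2,
    ← lintegral_add_left (hs1.const_mul _)]
  refine lintegral_mono_ae ?_
  filter_upwards [ae_integrable_slice j hg] with z hz
  set x := j.insertNth (α := fun _ => ℝ) 0 z
  have e : (fun y => S.Ω.indicator (fun x => p x * S.pullMain φ j x) (Function.update x j y)) =
      {y | Function.update x j y ∈ S.Ω}.indicator
        (fun y => p (Function.update x j y) * S.pullMain φ j (Function.update x j y)) := rfl
  have hms : MeasurableSet {y | Function.update x j y ∈ S.Ω} :=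
    (contDiff_update (𝕜 := ℝ) 1 x j).continuous.measurable S.measurableSet_Ω
  rw [e] at hz ⊢
  rw [integral_indicator hms]
  exact enorm_slice_le hp hc hφ j hκ hK ((integrable_indicator_iff hms).1 hz)

/-- The Lasota–Yorke inequality, in dual form. -/
theorem exists_lasotaYorke (S : PES (n + 1)) : ∃ θ C : ℝ, 0 ≤ θ ∧ θ < 1 ∧ 0 ≤ C ∧
    ∀ p : (Fin (n + 1) → ℝ) → ℝ, ContDiff ℝ 1 p → HasCompactSupport p → ∀ φ, IsTest (n + 1) φ →
      ∫ x in S.Ω, p x * divg φ (S.T x) ≤ θ * gradL1 p + C * ∫ x, |p x| := by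
  have hlam : S.lam⁻¹ < 1 := inv_lt_one_of_one_lt₀ S.lam_gt_one
  have hlam0 : 0 < S.lam⁻¹ := inv_pos.2 S.lam_pos
  set κ : ℝ := (1 - S.lam⁻¹) / 2 with hκdef
  have hκ0 : 0 < κ := by rw [hκdef]; linarith
  have hev : ∀ᶠ ε in 𝓝[>] (0 : ℝ), ∀ j : Fin (n + 1), (⨆ x : Fin (n + 1) → ℝ, ∑' k : ℕ,
      ∫⁻ y in Set.Icc (0 : ℝ) 1, Set.indicator (bLayer (S.parts k) ε)
        (fun z => ENNReal.ofReal (matNorm (jacDj S.T j z))) (Function.update x j y))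
        < ENNReal.ofReal κ :=
    eventually_all.2 fun j => (S.h4 j).eventually_lt_const (ENNReal.ofReal_pos.2 hκ0)
  obtain ⟨ε, hε, hε0⟩ := (hev.and self_mem_nhdsWithin).exists
  choose K hK using fun j => exists_jacDj_bound (S := S) hε0 j
  set C : ℝ := ∑ j, (S.lam⁻¹ * S.δ⁻¹ + K j) with hC
  have hterm : ∀ j, 0 ≤ S.lam⁻¹ * S.δ⁻¹ + K j := fun j =>
    add_nonneg (mul_nonneg hlam0.le (inv_nonneg.2 S.δ_pos.le)) (K j).2
  refine ⟨S.lam⁻¹ + κ, C, by positivity, by rw [hκdef]; linarith,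
    Finset.sum_nonneg fun j _ => hterm j, ?_⟩
  intro p hp hc φ hφ
  have hpi : Integrable p := hp.continuous.integrable_of_hasCompactSupport hc
  have hj : ∀ j, ∫ x in S.Ω, p x * S.pullMain φ j x ≤
      (S.lam⁻¹ + κ) * (∫ x, |fderiv ℝ p x (Pi.single j 1)|) +
        (S.lam⁻¹ * S.δ⁻¹ + K j) * ∫ x, |p x| := by
    intro j
    have h := enorm_integral_mul_pullMain_le hp hc hφ j (S := S)
      (fun x => (le_iSup _ x).trans (hε j).le) (hK j)
    have e1 : ∫⁻ x, ‖fderiv ℝ p x (Pi.single j 1)‖ₑ =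
        ENNReal.ofReal (∫ x, |fderiv ℝ p x (Pi.single j 1)|) :=
      (ofReal_integral_norm_eq_lintegral_enorm (integrable_fderiv_single hp hc j)).symm
    have e2 : ∫⁻ x, ‖p x‖ₑ = ENNReal.ofReal (∫ x, |p x|) :=
      (ofReal_integral_norm_eq_lintegral_enorm hpi).symm
    rw [e1, e2, ← ENNReal.ofReal_inv_of_pos S.δ_pos, ← ENNReal.ofReal_mul hlam0.le,
      ← ENNReal.ofReal_add hlam0.le hκ0.le, ← ENNReal.ofReal_mul (by positivity),
      ← ENNReal.ofReal_coe_nnreal (p := K j),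
      ← ENNReal.ofReal_add (mul_nonneg hlam0.le (inv_nonneg.2 S.δ_pos.le))
        (NNReal.coe_nonneg (K j)),
      ← ENNReal.ofReal_mul (hterm j), ← ENNReal.ofReal_add
        (mul_nonneg (by positivity) (integral_nonneg fun _ => abs_nonneg _))
        (mul_nonneg (hterm j) (integral_nonneg fun _ => abs_nonneg _)),
      Real.enorm_eq_ofReal_abs, ENNReal.ofReal_le_ofReal_iff (add_nonneg
        (mul_nonneg (by positivity) (integral_nonneg fun _ => abs_nonneg _))
        (mul_nonneg (hterm j) (integral_nonneg fun _ => abs_nonneg _)))] at h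
    exact (le_abs_self _).trans h
  calc ∫ x in S.Ω, p x * divg φ (S.T x)
      = ∫ x in S.Ω, ∑ j, p x * S.pullMain φ j x :=
        setIntegral_congr_fun S.measurableSet_Ω fun x hx => by
          simp only [← sum_pullMain φ hx, Finset.mul_sum]
    _ = ∑ j, ∫ x in S.Ω, p x * S.pullMain φ j x :=
        integral_finsetSum _ fun j _ => integrableOn_mul_pullMain hφ hp.continuous hc j
    _ ≤ ∑ j, ((S.lam⁻¹ + κ) * (∫ x, |fderiv ℝ p x (Pi.single j 1)|) +
        (S.lam⁻¹ * S.δ⁻¹ + K j) * ∫ x, |p x|) := Finset.sum_le_sum fun j _ => hj j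
    _ = (S.lam⁻¹ + κ) * gradL1 p + C * ∫ x, |p x| := by
        rw [Finset.sum_add_distrib, ← Finset.mul_sum, ← Finset.sum_mul, gradL1]

end PES

/-- A nonnegative density with mass at most `m` and variation at most `M`. -/
structure BVBound {d : ℕ} (f : (Fin d → ℝ) → ℝ≥0∞) (M m : ℝ) : Prop where
  measurable : Measurable f
  mass : ∫⁻ x, f x ≤ ENNReal.ofReal m
  supp : HasCompactSupport fun x => (f x).toReal
  var : VarLE (fun x => (f x).toReal) M

namespace BVBound

variable {d : ℕ} {f : (Fin d → ℝ) → ℝ≥0∞} {M M' m : ℝ}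

theorem mono (h : BVBound f M m) (hM : M ≤ M') : BVBound f M' m :=
  ⟨h.measurable, h.mass, h.supp, fun φ hφ => (h.var φ hφ).trans hM⟩

theorem lintegral_ne_top (h : BVBound f M m) : ∫⁻ x, f x ≠ ⊤ :=
  ne_top_of_le_ne_top ENNReal.ofReal_ne_top h.mass

theorem integrable (h : BVBound f M m) : Integrable fun x => (f x).toReal :=
  integrable_toReal_of_lintegral_ne_top h.measurable.aemeasurable h.lintegral_ne_top

theorem integral_le (h : BVBound f M m) (hm : 0 ≤ m) : ∫ x, (f x).toReal ≤ m := by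
  rw [integral_toReal h.measurable.aemeasurable
    (ae_lt_top h.measurable h.lintegral_ne_top)]
  exact ENNReal.toReal_le_of_le_ofReal hm h.mass

theorem setLIntegral_le (h : BVBound f M m) (hm : 0 ≤ m) {A : Set (Fin d → ℝ)}
    (hA : volume A ≠ ⊤) :
    ∫⁻ x in A, f x ≤ ENNReal.ofReal ((M + m) * (volume A).toReal ^ (1 / (d + 1) : ℝ)) := by
  refine le_trans (le_of_eq ?_) (setLIntegral_le_of_varLE h.integrable h.supp
    (fun _ => ENNReal.toReal_nonneg) h.var (h.integral_le hm) hA)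
  refine lintegral_congr_ae (ae_restrict_of_ae ?_)
  filter_upwards [ae_lt_top h.measurable h.lintegral_ne_top] with x hx
  rw [ENNReal.ofReal_toReal hx.ne]

theorem of_contDiff {p : (Fin d → ℝ) → ℝ} (hp : ContDiff ℝ 1 p) (hc : HasCompactSupport p)
    (h0 : ∀ x, 0 ≤ p x) : BVBound (fun x => ENNReal.ofReal (p x)) (gradL1 p) (∫ x, p x) where
  measurable := hp.continuous.measurable.ennreal_ofReal
  mass := (ofReal_integral_eq_lintegral_ofReal
    (hp.continuous.integrable_of_hasCompactSupport hc) (ae_of_all _ h0)).ge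
  supp := by simpa only [ENNReal.toReal_ofReal (h0 _)] using hc
  var := by simpa only [ENNReal.toReal_ofReal (h0 _)] using varLE_gradL1 hp hc

end BVBound

namespace PES

variable {n : ℕ} {S : PES (n + 1)}

theorem bvBound_Lop {θ C : ℝ} (hθ : 0 ≤ θ) (hC : 0 ≤ C)
    (hLY : ∀ p : (Fin (n + 1) → ℝ) → ℝ, ContDiff ℝ 1 p → HasCompactSupport p →
      ∀ φ, IsTest (n + 1) φ →
        ∫ x in S.Ω, p x * divg φ (S.T x) ≤ θ * gradL1 p + C * ∫ x, |p x|)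
    {f : (Fin (n + 1) → ℝ) → ℝ≥0∞} {M m : ℝ} (hm : 0 ≤ m) (hf : BVBound f M m) :
    BVBound (S.Lop f) (θ * M + C * m) m where
  measurable := S.measurable_Lop hf.measurable
  mass := (S.lintegral_Lop_iterate_le hf.measurable 1).trans hf.mass
  supp := HasCompactSupport.of_support_subset_isCompact
    (isCompact_Icc (a := (0 : Fin (n + 1) → ℝ)) (b := 1)) fun x hx => by
      by_contra h
      exact hx (by simp [S.Lop_eq_zero fun h' => h (S.closure_subset_Icc h')])
  var := by
    intro φ hφ
    set g : (Fin (n + 1) → ℝ) → ℝ := fun x => (f x).toReal with hg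
    obtain ⟨K, hK0, hK⟩ := exists_abs_divg_le hφ
    have hcd : Continuous (divg φ) := continuous_divg hφ.1
    rw [S.integral_Lop_mul hf.measurable hf.lintegral_ne_top hcd]
    have hbd : ∀ {q : (Fin (n + 1) → ℝ) → ℝ}, Integrable q →
        IntegrableOn (fun x => q x * divg φ (S.T x)) S.Ω := fun hq =>
      hq.integrableOn.mul_bdd (c := K)
        (hcd.comp_aestronglyMeasurable S.aemeasurable_T.aestronglyMeasurable)
        (ae_of_all _ fun x => by simpa using hK (S.T x))
    have key : ∀ η > 0, ∫ x in S.Ω, g x * divg φ (S.T x) ≤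
        θ * M + C * m + (C + K) * η := by
      intro η hη
      obtain ⟨p, hp, hpc, hp0, hpg, hpM⟩ := exists_smooth_approx hf.integrable hf.supp
        (fun _ => ENNReal.toReal_nonneg) hη
      have hp1 : ContDiff ℝ 1 p := hp.of_le (by norm_num)
      have hpi : Integrable p := hp.continuous.integrable_of_hasCompactSupport hpc
      have hdi : Integrable fun x => |p x - g x| := (hpi.sub hf.integrable).abs
      have h1 : ∫ x in S.Ω, g x * divg φ (S.T x) ≤
          (∫ x in S.Ω, p x * divg φ (S.T x)) + K * η := by
        have h2 : (∫ x in S.Ω, g x * divg φ (S.T x)) - (∫ x in S.Ω, p x * divg φ (S.T x)) ≤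
            ∫ x in S.Ω, K * |p x - g x| := by
          rw [← integral_sub (hbd hf.integrable) (hbd hpi)]
          refine integral_mono ((hbd hf.integrable).sub (hbd hpi))
            (hdi.const_mul K).integrableOn fun x => ?_
          have h3 : g x * divg φ (S.T x) - p x * divg φ (S.T x) =
            (g x - p x) * divg φ (S.T x) := by ring
          refine (h3.le.trans (le_abs_self _)).trans ?_
          rw [abs_mul, abs_sub_comm, mul_comm]
          exact mul_le_mul_of_nonneg_right (hK _) (abs_nonneg _)
        have h3 : ∫ x in S.Ω, K * |p x - g x| ≤ K * η := by
          rw [integral_const_mul]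
          refine mul_le_mul_of_nonneg_left ?_ hK0
          exact (setIntegral_le_integral hdi (ae_of_all _ fun _ => abs_nonneg _)).trans hpg
        linarith
      have h4 : ∫ x, |p x| ≤ m + η := by
        have h5 : ∫ x, |p x| ≤ ∫ x, (g x + |p x - g x|) :=
          integral_mono hpi.abs (hf.integrable.add hdi) fun x => by
            have h6 : |g x| = g x := abs_of_nonneg ENNReal.toReal_nonneg
            have h7 := abs_add_le (g x) (p x - g x)
            rw [add_sub_cancel, h6] at h7
            exact h7
        rw [integral_add hf.integrable hdi] at h5
        linarith [hf.integral_le hm]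
      have h8 := hLY p hp1 hpc φ hφ
      have h9 := mul_le_mul_of_nonneg_left (hpM M hf.var) hθ
      have h10 := mul_le_mul_of_nonneg_left h4 hC
      linarith
    refine le_of_forall_pos_le_add fun η hη => ?_
    have hCK : 0 < C + K + 1 := by positivity
    refine (key (η / (C + K + 1)) (by positivity)).trans ?_
    gcongr
    rw [mul_div_assoc', div_le_iff₀ hCK]
    nlinarith

/-- Uniform bounds for the variation along the orbits of the transfer operator. -/
theorem exists_bvBound_iterate (S : PES (n + 1)) : ∃ θ B : ℝ, 0 ≤ θ ∧ θ < 1 ∧ 0 ≤ B ∧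
    ∀ f M m, 0 ≤ m → BVBound f M m → ∀ k, BVBound (S.Lop^[k] f) (θ ^ k * M + B * m) m := by
  obtain ⟨θ, C, hθ, hθ1, hC, hLY⟩ := S.exists_lasotaYorke
  have h1 : 0 < 1 - θ := by linarith
  refine ⟨θ, C / (1 - θ), hθ, hθ1, by positivity, fun f M m hm hf k => ?_⟩
  induction k with
  | zero =>
    refine hf.mono ?_
    rw [pow_zero, one_mul]
    linarith [mul_nonneg (div_nonneg hC h1.le) hm]
  | succ k ih =>
    rw [Function.iterate_succ_apply']
    refine (bvBound_Lop hθ hC hLY hm ih).mono (le_of_eq ?_)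
    field_simp
    ring

end PES

namespace PES

variable {d : ℕ} {S : PES d}

/-- Inverse branches are defined on definite balls around images of interior points. -/
theorem exists_lift {k : ℕ} {y x' : Fin d → ℝ} {ρ ν : ℝ} (hν : S.lam⁻¹ < ν)
    (hb : Metric.ball y ρ ⊆ S.parts k) (h : ν * ‖x' - S.T y‖ < ρ) :
    ∃ y' ∈ S.parts k, ‖y' - y‖ ≤ ν * ‖x' - S.T y‖ ∧ S.T y' = x' := by
  have hlam0 : 0 < S.lam⁻¹ := inv_pos.2 S.lam_pos
  have hν0 : 0 < ν := hlam0.trans hν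
  obtain ⟨r, hr1, hr2⟩ := exists_between h
  have hr0 : 0 ≤ r := (mul_nonneg hν0.le (norm_nonneg _)).trans hr1.le
  have hKU : Metric.closedBall y r ⊆ S.parts k := (Metric.closedBall_subset_ball hr2).trans hb
  set F : (Fin d → ℝ) → ℝ := fun z => ‖S.T z - x'‖ + ‖z - y‖ / ν with hF
  have hFc : ContinuousOn F (Metric.closedBall y r) :=
    (((S.continuousOn_T.mono (hKU.trans (S.parts_subset k))).sub continuousOn_const).norm).add
      ((continuousOn_id.sub continuousOn_const).norm.div_const ν)
  obtain ⟨z, hz, hmin⟩ := (isCompact_closedBall y r).exists_isMinOn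
    ⟨y, Metric.mem_closedBall_self hr0⟩ hFc
  have hFz : F z ≤ ‖x' - S.T y‖ := by
    have h1 := hmin (Metric.mem_closedBall_self hr0)
    simpa [hF, norm_sub_rev] using h1
  have hzy : ‖z - y‖ ≤ ν * ‖x' - S.T y‖ := by
    have h1 : ‖z - y‖ / ν ≤ ‖x' - S.T y‖ := by
      refine le_trans ?_ hFz
      simp [hF]
    rwa [div_le_iff₀' hν0] at h1
  refine ⟨z, hKU hz, hzy, ?_⟩
  by_contra hne
  set e : ℝ := ‖S.T z - x'‖ with he
  have he0 : 0 < e := norm_pos_iff.2 (sub_ne_zero.2 hne)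
  set v : Fin d → ℝ := (fderiv ℝ S.T z).inverse (x' - S.T z) with hv
  have hDv : fderiv ℝ S.T z v = x' - S.T z :=
    (S.isInvertible_fderiv (hKU hz)).self_apply_inverse _
  have hvn : ‖v‖ ≤ S.lam⁻¹ * e := by
    rw [he, norm_sub_rev]
    exact S.norm_inverse_apply_le (S.parts_subset k (hKU hz)) _
  have hline : HasDerivAt (fun s : ℝ => z + s • v) v 0 := by
    simpa using ((hasDerivAt_id (0 : ℝ)).smul_const v).const_add z
  have hder : HasDerivAt (fun s : ℝ => S.T (z + s • v)) (x' - S.T z) 0 := by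
    have h0 : z + (0 : ℝ) • v = z := by simp
    have h1 : HasFDerivAt S.T (fderiv ℝ S.T z) (z + (0 : ℝ) • v) := by
      rw [h0]
      exact (S.differentiableAt_T (hKU hz)).hasFDerivAt
    have h2 := h1.comp_hasDerivAt (0 : ℝ) hline
    rwa [hDv] at h2
  set q : ℝ := S.lam⁻¹ / ν with hq
  have hq1 : q < 1 := (div_lt_one hν0).2 hν
  have hc : 0 < (1 - q) * e / 2 := by
    have : 0 < 1 - q := by linarith
    positivity
  have hev1 : ∀ᶠ s : ℝ in 𝓝[>] 0, ‖S.T (z + s • v) - S.T z - s • (x' - S.T z)‖ ≤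
      (1 - q) * e / 2 * ‖s‖ := by
    have := (hasDerivAt_iff_isLittleO.1 hder).def hc
    refine (this.filter_mono nhdsWithin_le_nhds).mono fun s hs => ?_
    simpa using hs
  have hev2 : ∀ᶠ s : ℝ in 𝓝[>] 0, z + s • v ∈ Metric.closedBall y r := by
    have h1 : Tendsto (fun s : ℝ => z + s • v) (𝓝[>] 0) (𝓝 z) := by
      simpa using hline.continuousAt.tendsto.mono_left nhdsWithin_le_nhds
    refine h1.eventually (mem_of_superset (Metric.isOpen_ball.mem_nhds ?_)
      Metric.ball_subset_closedBall)
    rw [Metric.mem_ball, dist_eq_norm]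
    exact hzy.trans_lt hr1
  have hev3 : ∀ᶠ s : ℝ in 𝓝[>] 0, s < 1 :=
    nhdsWithin_le_nhds (isOpen_Iio.mem_nhds (by simp))
  obtain ⟨s, ⟨⟨h1, h2⟩, h3⟩, h4⟩ :=
    (((hev1.and hev2).and hev3).and self_mem_nhdsWithin).exists
  have hs0 : 0 < s := h4
  have h5 : F z ≤ F (z + s • v) := hmin h2
  have h6 : ‖S.T (z + s • v) - x'‖ ≤ (1 - q) * e / 2 * s + (1 - s) * e := by
    have e1 : S.T (z + s • v) - x' =
        (S.T (z + s • v) - S.T z - s • (x' - S.T z)) + (1 - s) • (S.T z - x') := by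
      rw [sub_smul, one_smul, smul_sub, smul_sub]
      abel
    rw [e1]
    refine (norm_add_le _ _).trans ?_
    rw [norm_smul, Real.norm_of_nonneg (by linarith : (0 : ℝ) ≤ 1 - s)]
    rw [Real.norm_of_nonneg hs0.le] at h1
    exact add_le_add h1 le_rfl
  have h7 : ‖z + s • v - y‖ / ν ≤ ‖z - y‖ / ν + s * (q * e) := by
    have e1 : z + s • v - y = (z - y) + s • v := by abel
    rw [e1, hq, div_le_iff₀ hν0, add_mul, div_mul_cancel₀ _ hν0.ne']
    refine (norm_add_le _ _).trans (add_le_add le_rfl ?_)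
    rw [norm_smul, Real.norm_of_nonneg hs0.le]
    have e2 : s * (S.lam⁻¹ / ν * e) * ν = s * (S.lam⁻¹ * e) := by
      field_simp
    rw [e2]
    exact mul_le_mul_of_nonneg_left hvn hs0.le
  have h8 : F (z + s • v) ≤ F z - s * ((1 - q) * e / 2) := by
    simp only [hF, ← he]
    linarith
  have h9 : 0 < s * ((1 - q) * e / 2) := mul_pos hs0 hc
  linarith

end PES

namespace PES6

variable {d : ℕ} {S : PES6 d}

theorem norm_fderiv_det_le {x : Fin d → ℝ} (hx : x ∈ S.Ω) :
    ‖fderiv ℝ (fun y => (jac S.T y).det) x‖ ≤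
      d * (S.Cb * Metric.infDist x (frontier S.Ω) ^ (-S.ab)) := by
  have h0 : 0 ≤ S.Cb * Metric.infDist x (frontier S.Ω) ^ (-S.ab) :=
    mul_nonneg S.Cb_pos.le (Real.rpow_nonneg Metric.infDist_nonneg _)
  refine ContinuousLinearMap.opNorm_le_bound _ (by positivity) fun v => ?_
  rw [Real.norm_eq_abs]
  have e : fderiv ℝ (fun y => (jac S.T y).det) x v =
      ∑ i, v i * fderiv ℝ (fun y => (jac S.T y).det) x (Pi.single i 1) := by
    conv_lhs => rw [← Finset.univ_sum_single v]
    rw [map_sum]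
    refine Finset.sum_congr rfl fun i _ => ?_
    rw [← smul_eq_mul, ← map_smul, ← Pi.single_smul', smul_eq_mul, mul_one]
  rw [e]
  refine (Finset.abs_sum_le_sum_abs _ _).trans ?_
  refine (Finset.sum_le_card_nsmul _ _
    (S.Cb * Metric.infDist x (frontier S.Ω) ^ (-S.ab) * ‖v‖) fun i _ => ?_).trans (le_of_eq ?_)
  · rw [abs_mul, mul_comm]
    exact mul_le_mul (S.h6b x hx i) (norm_le_pi_norm v i) (abs_nonneg _) h0
  · simp [mul_assoc]

theorem abs_det_le {k : ℕ} {y y' : Fin d → ℝ} {ρ : ℝ} (hρ : 0 < ρ)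
    (hy : y ∈ innerPart (S.parts k) ρ) (hyy' : ‖y' - y‖ ≤ ρ / 2) :
    |(jac S.T y').det| ≤ (1 + d.factorial * d * S.Cb * (ρ / 2) ^ (-S.ab) * ‖y' - y‖) *
      |(jac S.T y).det| := by
  have hball : Metric.ball y ρ ⊆ S.parts k :=
    ball_subset_of_le_infDist (S.parts_open k) hy.1 hy.2
  have hcb : Metric.closedBall y (ρ / 2) ⊆ S.parts k :=
    (Metric.closedBall_subset_ball (by linarith)).trans hball
  have hab : 0 < S.ab := lt_of_lt_of_le one_pos S.ab_ge_one
  have hdist : ∀ z ∈ Metric.closedBall y (ρ / 2),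
      Metric.infDist z (frontier S.Ω) ^ (-S.ab) ≤ (ρ / 2) ^ (-S.ab) := by
    intro z hz
    rcases Set.eq_empty_or_nonempty (frontier S.Ω) with h0 | hne
    · rw [h0, Metric.infDist_empty, Real.zero_rpow (by linarith)]
      positivity
    · refine Real.rpow_le_rpow_of_nonpos (by positivity) ?_ (by linarith)
      refine (Metric.le_infDist hne).2 fun w hw => ?_
      have hw' : w ∉ Metric.ball y ρ := fun h =>
        (S.Ω_open.frontier_eq ▸ hw).2 (S.parts_subset k (hball h))
      rw [Metric.mem_ball, not_lt] at hw'
      rw [Metric.mem_closedBall] at hz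
      have := dist_triangle w z y
      rw [dist_comm w z] at this
      linarith
  set L : ℝ := d * (S.Cb * (ρ / 2) ^ (-S.ab)) with hL
  have hL0 : 0 ≤ L := by
    have := S.Cb_pos
    positivity
  have hy0 : y ∈ Metric.closedBall y (ρ / 2) := Metric.mem_closedBall_self (by linarith)
  have hy'0 : y' ∈ Metric.closedBall y (ρ / 2) := by rwa [mem_closedBall_iff_norm]
  have h1 : ‖(jac S.T y').det - (jac S.T y).det‖ ≤ L * ‖y' - y‖ :=
    (convex_closedBall y (ρ / 2)).norm_image_sub_le_of_norm_fderiv_le (𝕜 := ℝ)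
      (f := fun y => (jac S.T y).det)
      (fun z hz => (S.contDiffAt_det (hcb hz)).differentiableAt one_ne_zero)
      (fun z hz => (norm_fderiv_det_le (S.parts_subset k (hcb hz))).trans
        (mul_le_mul_of_nonneg_left (mul_le_mul_of_nonneg_left (hdist z hz) S.Cb_pos.le)
          (Nat.cast_nonneg d))) hy0 hy'0
  have h2 := S.one_le_factorial_mul_abs_det (S.parts_subset k hy.1)
  have h3 := abs_sub_abs_le_abs_sub (jac S.T y').det (jac S.T y).det
  rw [Real.norm_eq_abs] at h1
  have h4 : 0 ≤ L * ‖y' - y‖ := mul_nonneg hL0 (norm_nonneg _)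
  have h5 := mul_le_mul_of_nonneg_left h2 h4
  calc |(jac S.T y').det| ≤ |(jac S.T y).det| + L * ‖y' - y‖ * 1 := by linarith
    _ ≤ |(jac S.T y).det| + L * ‖y' - y‖ * (d.factorial * |(jac S.T y).det|) := by linarith
    _ = _ := by rw [hL]; ring

end PES6

theorem measurableSet_bLayer {d : ℕ} {U : Set (Fin d → ℝ)} (hU : IsOpen U) (ε : ℝ) :
    MeasurableSet (bLayer U ε) :=
  hU.measurableSet.diff (hU.measurableSet.inter
    (isClosed_le continuous_const (Metric.continuous_infDist_pt _)).measurableSet)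

namespace PES

variable {d : ℕ} (S : PES d)

theorem measurableSet_Gam (ε : ℝ) : MeasurableSet (Gam S.parts ε) :=
  MeasurableSet.iUnion fun k => measurableSet_bLayer (S.parts_open k) ε

theorem Gam_subset (ε : ℝ) : Gam S.parts ε ⊆ S.Ω :=
  iUnion_subset fun k => sdiff_subset.trans (S.parts_subset k)

/-- The iterated transfer operator which discards, at each step, the mass in the boundary
layers of width `ε ^ b`, the scale `ε` being contracted by `ν` along the backward orbit. -/
def tl (ν b : ℝ) : ℕ → ℝ → ((Fin d → ℝ) → ℝ≥0∞) → (Fin d → ℝ) → ℝ≥0∞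
  | 0, _, f => f
  | n + 1, ε, f => S.Lop ((Gam S.parts (ε ^ b))ᶜ.indicator (tl ν b n (ν * ε) f))

end PES

namespace PES6

variable {d : ℕ} (S : PES6 d)

/-- The Hölder constant of `log |det DT|` at distance `ε ^ b` from the singularities. -/
def distConst : ℝ := d.factorial * d * S.Cb * 2 ^ S.ab

theorem distConst_nonneg : 0 ≤ S.distConst := by
  have := S.Cb_pos
  unfold distConst
  positivity

variable {S}

theorem Lop_indicator_le {ν ε b : ℝ} (hν : S.lam⁻¹ < ν) (hν1 : ν ≤ 1) (hε : 0 < ε)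
    (hε1 : ε ≤ 1 / 4) (hb : b = 1 / (2 * S.ab)) {F G : (Fin d → ℝ) → ℝ≥0∞} {c : ℝ≥0∞}
    (hFG : ∀ y ∈ S.Ω, ∀ y' ∈ S.Ω, ‖y' - y‖ ≤ ν * ε → F y ≤ c * G y') {x x' : Fin d → ℝ}
    (hx : ‖x' - x‖ ≤ ε) :
    S.Lop ((Gam S.parts (ε ^ b))ᶜ.indicator F) x ≤
      ENNReal.ofReal (Real.exp (S.distConst * √ε)) * c * S.Lop G x' := by
  have hν0 : 0 < ν := (inv_pos.2 S.lam_pos).trans hν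
  have hab : 0 < S.ab := one_pos.trans_le S.ab_ge_one
  have hρ0 : 0 < ε ^ b := Real.rpow_pos_of_pos hε b
  have hsq : ε ≤ √ε / 2 := by
    have h1 : √ε ≤ 1 / 2 := by
      rw [Real.sqrt_le_left (by norm_num)]
      norm_num
      linarith
    have h2 := Real.mul_self_sqrt hε.le
    nlinarith [Real.sqrt_nonneg ε]
  have hρ : √ε ≤ ε ^ b := by
    rw [Real.sqrt_eq_rpow, hb]
    refine Real.rpow_le_rpow_of_exponent_ge hε (by linarith) ?_
    exact one_div_le_one_div_of_le two_pos (by linarith [S.ab_ge_one])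
  have hερ : ε ≤ ε ^ b / 2 := by linarith
  have hpow : (ε ^ b / 2) ^ (-S.ab) * ε = 2 ^ S.ab * √ε := by
    rw [Real.div_rpow hρ0.le (by norm_num), ← Real.rpow_mul hε.le, hb,
      Real.rpow_neg (by norm_num : (0 : ℝ) ≤ 2), div_inv_eq_mul]
    have e1 : 1 / (2 * S.ab) * -S.ab = -(1 / 2) := by field_simp
    rw [e1, Real.rpow_neg hε.le, ← Real.sqrt_eq_rpow]
    have h2 := Real.mul_self_sqrt hε.le
    have h3 : √ε ≠ 0 := (Real.sqrt_pos.2 hε).ne'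
    field_simp
    rw [sq, h2]
  unfold PES.Lop
  rw [← ENNReal.tsum_mul_left]
  refine ENNReal.tsum_le_tsum fun k => ?_
  by_cases hxk : x ∈ S.T '' S.parts k
  swap
  · rw [indicator_of_notMem hxk]
    exact zero_le
  obtain ⟨y, hy, rfl⟩ := hxk
  rw [indicator_of_mem (mem_image_of_mem _ hy), S.br_T hy]
  by_cases hyG : y ∈ Gam S.parts (ε ^ b)
  · rw [indicator_of_notMem (by simpa using hyG), zero_mul]
    exact zero_le
  have hyin : y ∈ innerPart (S.parts k) (ε ^ b) := by
    by_contra h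
    exact hyG (mem_iUnion.2 ⟨k, hy, h⟩)
  have hle : ν * ‖x' - S.T y‖ ≤ ν * ε := mul_le_mul_of_nonneg_left hx hν0.le
  have hνε : ν * ε ≤ ε := mul_le_of_le_one_left hε.le hν1
  obtain ⟨y', hy', hyy', rfl⟩ := PES.exists_lift (S := S.toPES) hν
    (ball_subset_of_le_infDist (S.parts_open k) hyin.1 hyin.2) (x' := x') (by linarith)
  rw [indicator_of_mem hyG, indicator_of_mem (mem_image_of_mem _ hy'), S.br_T hy']
  have hdet := abs_det_le hρ0 hyin (y' := y') (by linarith)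
  have hdist : 1 + d.factorial * d * S.Cb * (ε ^ b / 2) ^ (-S.ab) * ‖y' - y‖ ≤
      Real.exp (S.distConst * √ε) := by
    refine le_trans ?_ (Real.add_one_le_exp _)
    have h0 : 0 ≤ d.factorial * d * S.Cb * (ε ^ b / 2) ^ (-S.ab) := by
      have := S.Cb_pos
      positivity
    have h1 : d.factorial * d * S.Cb * (ε ^ b / 2) ^ (-S.ab) * ε = S.distConst * √ε := by
      rw [mul_assoc, hpow, distConst]
      ring
    have h2 := mul_le_mul_of_nonneg_left (hyy'.trans (hle.trans hνε)) h0
    linarith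
  have hdet2 : |(jac S.T y').det| ≤ Real.exp (S.distConst * √ε) * |(jac S.T y).det| :=
    hdet.trans (mul_le_mul_of_nonneg_right hdist (abs_nonneg _))
  have hp : 0 < |(jac S.T y).det| := abs_pos.2 (S.det_jac_ne_zero hy)
  have hp' : 0 < |(jac S.T y').det| := abs_pos.2 (S.det_jac_ne_zero hy')
  have hinv : (ENNReal.ofReal |(jac S.T y).det|)⁻¹ ≤
      ENNReal.ofReal (Real.exp (S.distConst * √ε)) *
        (ENNReal.ofReal |(jac S.T y').det|)⁻¹ := by
    rw [← ENNReal.ofReal_inv_of_pos hp, ← ENNReal.ofReal_inv_of_pos hp',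
      ← ENNReal.ofReal_mul (Real.exp_pos _).le]
    refine ENNReal.ofReal_le_ofReal ?_
    rw [← div_eq_mul_inv, le_div_iff₀ hp', inv_mul_le_iff₀ hp, mul_comm]
    exact hdet2
  calc F y * (ENNReal.ofReal |(jac S.T y).det|)⁻¹
      ≤ (c * G y') * (ENNReal.ofReal (Real.exp (S.distConst * √ε)) *
        (ENNReal.ofReal |(jac S.T y').det|)⁻¹) :=
        mul_le_mul' (hFG y (S.parts_subset k hy) y' (S.parts_subset k hy')
          (hyy'.trans hle)) hinv
    _ = _ := by ring

theorem tl_le {ν b : ℝ} (hν : S.lam⁻¹ < ν) (hν1 : ν < 1) (hb : b = 1 / (2 * S.ab))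
    {f : (Fin d → ℝ) → ℝ≥0∞} {n : ℕ} {ε : ℝ} (hε : 0 < ε) (hε1 : ε ≤ 1 / 4)
    (hf : ∀ z ∈ S.Ω, ∀ z' ∈ S.Ω, ‖z' - z‖ ≤ ν ^ n * ε → f z ≤ 2 * f z')
    {x x' : Fin d → ℝ} (hx : x ∈ S.Ω) (hx' : x' ∈ S.Ω) (hxx' : ‖x' - x‖ ≤ ε) :
    S.tl ν b n ε f x ≤
      ENNReal.ofReal (Real.exp (S.distConst / (1 - √ν) * √ε)) * 2 * S.Lop^[n] f x' := by
  have hν0 : 0 < ν := (inv_pos.2 S.lam_pos).trans hν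
  have hs1 : 0 < 1 - √ν := by
    have := Real.sqrt_lt_sqrt hν0.le hν1
    rw [Real.sqrt_one] at this
    linarith
  induction n generalizing ε x x' with
  | zero =>
    refine (hf x hx x' hx' (by simpa using hxx')).trans ?_
    rw [Function.iterate_zero, id]
    gcongr
    refine le_mul_of_one_le_left zero_le ?_
    rw [ENNReal.one_le_ofReal]
    refine Real.one_le_exp (mul_nonneg (div_nonneg S.distConst_nonneg hs1.le)
      (Real.sqrt_nonneg _))
  | succ n ih =>
    have hνε : ν * ε ≤ ε := mul_le_of_le_one_left hε.le hν1.le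
    rw [PES.tl, Function.iterate_succ_apply']
    refine (Lop_indicator_le hν hν1.le hε hε1 hb
      (c := ENNReal.ofReal (Real.exp (S.distConst / (1 - √ν) * √(ν * ε))) * 2)
      (G := S.Lop^[n] f) (fun y hy y' hy' hyy' => ih (mul_pos hν0 hε) (hνε.trans hε1)
        (fun z hz z' hz' h => hf z hz z' hz' (by rwa [pow_succ, mul_assoc])) hy hy' hyy')
      hxx').trans (le_of_eq ?_)
    rw [← mul_assoc, ← ENNReal.ofReal_mul (Real.exp_pos _).le, ← Real.exp_add]
    congr 5
    rw [Real.sqrt_mul hν0.le]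
    field_simp
    ring

/-- The mass lost by discarding the boundary layers. -/
theorem exists_le_tl_add {ν b : ℝ} (hν0 : 0 < ν) (hν1 : ν < 1) {K s : ℝ} (hK : 0 ≤ K)
    (hs : 0 < s) {f : (Fin d → ℝ) → ℝ≥0∞} (hf : Measurable f)
    (hloss : ∀ j, ∀ ε, 0 < ε →
      ∫⁻ x in Gam S.parts (ε ^ b), S.Lop^[j] f x ≤ ENNReal.ofReal (K * ε ^ s))
    (n : ℕ) {ε : ℝ} (hε : 0 < ε) :
    ∃ R : (Fin d → ℝ) → ℝ≥0∞, Measurable R ∧ (∀ x, S.Lop^[n] f x ≤ S.tl ν b n ε f x + R x) ∧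
      ∫⁻ x, R x ≤ ENNReal.ofReal (K / (1 - ν ^ s) * ε ^ s) := by
  have hνs : 0 < 1 - ν ^ s := by
    have := Real.rpow_lt_one hν0.le hν1 hs
    linarith
  induction n generalizing ε with
  | zero => exact ⟨0, measurable_zero, fun x => by simp [PES.tl], by simp⟩
  | succ n ih =>
    obtain ⟨R, hR, hle, hRi⟩ := ih (mul_pos hν0 hε)
    set P := Gam S.parts (ε ^ b) with hP
    have hPm : MeasurableSet P := S.measurableSet_Gam _
    have hfn : Measurable (S.Lop^[n] f) := S.measurable_Lop_iterate hf n
    refine ⟨S.Lop (R + P.indicator (S.Lop^[n] f)),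
      S.measurable_Lop (hR.add (hfn.indicator hPm)), fun x => ?_, ?_⟩
    · rw [Function.iterate_succ_apply', PES.tl, ← Pi.add_apply, ← S.Lop_add]
      refine S.Lop_mono (fun y _ => ?_) x
      rw [← hP]
      by_cases hy : y ∈ P
      · rw [Pi.add_apply, Pi.add_apply, indicator_of_mem hy]
        exact le_add_left le_add_self
      · simpa [hy] using hle y
    · refine (S.lintegral_Lop_iterate_le (hR.add (hfn.indicator hPm)) 1).trans ?_
      simp only [Pi.add_apply]
      rw [lintegral_add_left hR, lintegral_indicator hPm]
      refine (add_le_add hRi (hloss n ε hε)).trans (le_of_eq ?_)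
      rw [← ENNReal.ofReal_add (by positivity) (by positivity), Real.mul_rpow hν0.le hε.le]
      congr 1
      field_simp
      ring

end PES6

namespace PES6

variable {n : ℕ} (S : PES6 (n + 1))

theorem setLIntegral_Gam_le {f : (Fin (n + 1) → ℝ) → ℝ≥0∞} {M m : ℝ} (hM : 0 ≤ M) (hm : 0 ≤ m)
    (hf : BVBound f M m) {r : ℝ} (hr : 0 < r) :
    ∫⁻ x in Gam S.parts r, f x ≤ ENNReal.ofReal
      ((M + m) * (S.Cb ^ (n + 1)) ^ (1 / ((n + 1 : ℕ) + 1) : ℝ) *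
        r ^ (S.αb * (1 / ((n + 1 : ℕ) + 1)))) := by
  have h := S.h6a r hr
  have hC := S.Cb_pos
  refine (hf.setLIntegral_le hm (ne_top_of_le_ne_top ENNReal.ofReal_ne_top h)).trans
    (ENNReal.ofReal_le_ofReal ?_)
  rw [mul_assoc, Real.rpow_mul hr.le, ← Real.mul_rpow (by positivity) (by positivity)]
  refine mul_le_mul_of_nonneg_left ?_ (by positivity)
  exact Real.rpow_le_rpow ENNReal.toReal_nonneg (ENNReal.toReal_le_of_le_ofReal
    (by positivity) h) (by positivity)

/-- If all the iterates of `f` have bounded variation and `f` is almost constant at a small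
scale, some iterate is bounded below on a ball of a fixed size. -/
theorem exists_ball_le_Lop_iterate : ∃ ν : ℝ, 0 < ν ∧ ν < 1 ∧ ∀ M m : ℝ, 0 ≤ M → 0 ≤ m →
    ∃ ε > 0, ∀ f : (Fin (n + 1) → ℝ) → ℝ≥0∞, (∀ j, BVBound (S.Lop^[j] f) M m) →
      ENNReal.ofReal (3 / 4) ≤ ∫⁻ x in S.Ω, f x → ∀ N : ℕ,
      (∀ z ∈ S.Ω, ∀ z' ∈ S.Ω, ‖z' - z‖ ≤ ν ^ N * ε → f z ≤ 2 * f z') →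
      ∃ x, Metric.ball x ε ⊆ S.Ω ∧
        ∀ x' ∈ Metric.ball x ε, ENNReal.ofReal (1 / 16) ≤ S.Lop^[N] f x' := by
  have hl0 : 0 < S.lam⁻¹ := inv_pos.2 S.lam_pos
  have hl1 : S.lam⁻¹ < 1 := inv_lt_one_of_one_lt₀ S.lam_gt_one
  obtain ⟨ν, hν, hν1⟩ := exists_between hl1
  have hν0 : 0 < ν := hl0.trans hν
  refine ⟨ν, hν0, hν1, fun M m hM hm => ?_⟩
  have hC := S.Cb_pos
  have hα := S.αb_mem.1
  have hab : 0 < S.ab := one_pos.trans_le S.ab_ge_one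
  set b : ℝ := 1 / (2 * S.ab) with hb
  have hb0 : 0 < b := by positivity
  set K : ℝ := (M + m) * (S.Cb ^ (n + 1)) ^ (1 / ((n + 1 : ℕ) + 1) : ℝ) with hK
  have hK0 : 0 ≤ K := by positivity
  set s : ℝ := S.αb * (1 / ((n + 1 : ℕ) + 1)) with hs
  have hs0 : 0 < s := by positivity
  have hbs0 : 0 < b * s := mul_pos hb0 hs0
  have hlim : ∀ {F : ℝ → ℝ} {c : ℝ}, ContinuousAt F 0 → F 0 < c →
      ∀ᶠ ε in 𝓝[>] (0 : ℝ), F ε < c := fun hF hc =>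
    (hF.tendsto.mono_left nhdsWithin_le_nhds).eventually_lt_const hc
  have e1 : ∀ᶠ ε in 𝓝[>] (0 : ℝ), Real.exp (S.distConst / (1 - √ν) * √ε) < 2 :=
    hlim (by fun_prop) (by simp)
  have e2 : ∀ᶠ ε in 𝓝[>] (0 : ℝ), K / (1 - ν ^ (b * s)) * ε ^ (b * s) < 1 / 8 :=
    hlim (continuousAt_const.mul (Real.continuousAt_rpow_const _ _ (Or.inr hbs0.le)))
      (by simp [Real.zero_rpow hbs0.ne'])
  have e3 : ∀ᶠ ε in 𝓝[>] (0 : ℝ), K * (2 * ε) ^ s < 1 / 8 :=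
    hlim (continuousAt_const.mul ((continuousAt_const.mul continuousAt_id).rpow_const
      (Or.inr hs0.le))) (by simp [Real.zero_rpow hs0.ne'])
  have e4 : ∀ᶠ ε in 𝓝[>] (0 : ℝ), ε < 1 / 4 := hlim continuousAt_id (by norm_num)
  obtain ⟨ε, h1, h2, h3, h4, hε⟩ := (e1.and (e2.and (e3.and
    (e4.and self_mem_nhdsWithin)))).exists
  have hε : 0 < ε := hε
  refine ⟨ε, hε, fun f hf hfΩ N hrat => ?_⟩
  have hfm : Measurable f := (hf 0).measurable
  have hFm : Measurable (S.Lop^[N] f) := (hf N).measurable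
  obtain ⟨R, hR, hle, hRi⟩ := exists_le_tl_add (S := S) (b := b) hν0 hν1 hK0 hbs0 hfm
    (fun j r hr => by
      rw [Real.rpow_mul hr.le]
      exact S.setLIntegral_Gam_le hM hm (hf j) (Real.rpow_pos_of_pos hr b)) N hε
  set P := Gam S.parts (2 * ε) with hP
  have hPm : MeasurableSet P := S.measurableSet_Gam _
  have hPi : ∫⁻ x in P, S.Lop^[N] f x ≤ ENNReal.ofReal (1 / 8) :=
    (S.setLIntegral_Gam_le hM hm (hf N) (by positivity)).trans
      (ENNReal.ofReal_le_ofReal h3.le)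
  obtain ⟨x, hxΩ, hxP, hx⟩ : ∃ x ∈ S.Ω, x ∉ P ∧
      ENNReal.ofReal (1 / 4) ≤ S.tl ν b N ε f x := by
    by_contra! hcon
    have hsub : P ⊆ S.Ω := S.Gam_subset _
    have c1 : ∫⁻ x in S.Ω \ P, S.Lop^[N] f x ≤ ENNReal.ofReal (1 / 4) + ENNReal.ofReal (1 / 8) := by
      calc ∫⁻ x in S.Ω \ P, S.Lop^[N] f x
          ≤ ∫⁻ x in S.Ω \ P, (ENNReal.ofReal (1 / 4) + R x) :=
            setLIntegral_mono' (S.measurableSet_Ω.diff hPm) fun x hx =>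
              (hle x).trans (add_le_add_left (hcon x hx.1 hx.2).le _)
        _ = ENNReal.ofReal (1 / 4) * volume (S.Ω \ P) + ∫⁻ x in S.Ω \ P, R x := by
            rw [lintegral_add_left measurable_const, setLIntegral_const]
        _ ≤ _ := add_le_add
            (mul_le_of_le_one_right' ((measure_mono sdiff_subset).trans S.volume_Ω_le_one))
            ((setLIntegral_le_lintegral _ _).trans (hRi.trans (ENNReal.ofReal_le_ofReal h2.le)))
    have c2 := lintegral_inter_add_sdiff (μ := volume) (S.Lop^[N] f) S.Ω hPm
    rw [inter_eq_right.2 hsub, S.setLIntegral_Ω_Lop_iterate hfm] at c2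
    have c3 := hfΩ.trans (c2.symm.le.trans (add_le_add hPi c1))
    rw [← ENNReal.ofReal_add (by norm_num) (by norm_num),
      ← ENNReal.ofReal_add (by norm_num) (by norm_num),
      ENNReal.ofReal_le_ofReal_iff (by norm_num)] at c3
    norm_num at c3
  obtain ⟨k, hxk⟩ := S.exists_mem_parts hxΩ
  have hxin : x ∈ innerPart (S.parts k) (2 * ε) := by
    by_contra h
    exact hxP (mem_iUnion.2 ⟨k, hxk, h⟩)
  have hball : Metric.ball x ε ⊆ S.Ω :=
    (Metric.ball_subset_ball (by linarith)).trans
      ((ball_subset_of_le_infDist (S.parts_open k) hxk hxin.2).trans (S.parts_subset k))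
  refine ⟨x, hball, fun x' hx' => ?_⟩
  have h5 := hx.trans (tl_le hν hν1 hb hε h4.le hrat hxΩ (hball hx')
    (by rw [← dist_eq_norm]; exact (Metric.mem_ball.1 hx').le))
  have h6 : ENNReal.ofReal (1 / 4) ≤ ENNReal.ofReal 4 * S.Lop^[N] f x' := by
    refine h5.trans ?_
    gcongr
    rw [show (4 : ℝ) = 2 * 2 by norm_num, ENNReal.ofReal_mul zero_le_two, ENNReal.ofReal_ofNat]
    gcongr
    rw [← ENNReal.ofReal_ofNat]
    exact ENNReal.ofReal_le_ofReal h1.le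
  rw [show (1 : ℝ) / 16 = 4⁻¹ * (1 / 4) by norm_num, ENNReal.ofReal_mul (by norm_num),
    ENNReal.ofReal_inv_of_pos (by norm_num)]
  rw [mul_comm, ← div_eq_mul_inv]
  exact ENNReal.div_le_of_le_mul' h6

end PES6

theorem exists_smooth_approx_lintegral {d : ℕ} {G : (Fin d → ℝ) → ℝ≥0∞} (hG : Measurable G)
    (hGi : ∫⁻ x, G x ≠ ⊤) (hc : HasCompactSupport fun x => (G x).toReal) {η : ℝ} (hη : 0 < η) :
    ∃ p : (Fin d → ℝ) → ℝ, ContDiff ℝ 1 p ∧ HasCompactSupport p ∧ (∀ x, 0 ≤ p x) ∧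
      (∀ M, VarLE (fun x => (G x).toReal) M → gradL1 p ≤ M) ∧
      ∫ x, p x ≤ (∫⁻ x, G x).toReal + η ∧
      ∫⁻ x, (ENNReal.ofReal (p x) - G x) ≤ ENNReal.ofReal η ∧
      ∫⁻ x, (G x - ENNReal.ofReal (p x)) ≤ ENNReal.ofReal η := by
  have hGint : Integrable fun x => (G x).toReal :=
    integrable_toReal_of_lintegral_ne_top hG.aemeasurable hGi
  have hfin : ∀ᵐ x, G x < ⊤ := ae_lt_top hG hGi
  obtain ⟨p, hp, hpc, hp0, hpη, hpM⟩ :=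
    exists_smooth_approx hGint hc (fun _ => ENNReal.toReal_nonneg) hη
  have hpi : Integrable p := hp.continuous.integrable_of_hasCompactSupport hpc
  have hdi : Integrable fun x => |p x - (G x).toReal| := (hpi.sub hGint).abs
  have hD : ∫⁻ x, ENNReal.ofReal |p x - (G x).toReal| ≤ ENNReal.ofReal η := by
    rw [← ofReal_integral_eq_lintegral_ofReal hdi (ae_of_all _ fun _ => abs_nonneg _)]
    exact ENNReal.ofReal_le_ofReal hpη
  refine ⟨p, hp.of_le (by norm_num), hpc, hp0, hpM, ?_, ?_, ?_⟩
  · rw [← integral_toReal hG.aemeasurable hfin]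
    calc ∫ x, p x ≤ ∫ x, ((G x).toReal + |p x - (G x).toReal|) :=
          integral_mono hpi (hGint.add hdi) fun x => by
            have := le_abs_self (p x - (G x).toReal)
            linarith
      _ ≤ _ := by
          rw [integral_add hGint hdi]
          linarith
  · refine (lintegral_mono_ae ?_).trans hD
    filter_upwards [hfin] with x hx
    rw [tsub_le_iff_right]
    nth_rw 2 [← ENNReal.ofReal_toReal hx.ne]
    rw [← ENNReal.ofReal_add (abs_nonneg _) ENNReal.toReal_nonneg]
    refine ENNReal.ofReal_le_ofReal ?_
    linarith [le_abs_self (p x - (G x).toReal)]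
  · refine (lintegral_mono_ae ?_).trans hD
    filter_upwards [hfin] with x hx
    rw [tsub_le_iff_right]
    nth_rw 1 [← ENNReal.ofReal_toReal hx.ne]
    rw [← ENNReal.ofReal_add (abs_nonneg _) (hp0 x)]
    refine ENNReal.ofReal_le_ofReal ?_
    linarith [neg_abs_le (p x - (G x).toReal)]

/-- A small perturbation of `p` which is bounded below on the unit cube, hence almost constant
at small scales. -/
theorem exists_perturbation {d : ℕ} {p : (Fin d → ℝ) → ℝ} (hp : ContDiff ℝ 1 p)
    (hc : HasCompactSupport p) (h0 : ∀ x, 0 ≤ p x) {η : ℝ} (hη : 0 < η) :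
    ∃ q : (Fin d → ℝ) → ℝ, ContDiff ℝ 1 q ∧ HasCompactSupport q ∧ (∀ x, p x ≤ q x) ∧
      gradL1 q ≤ gradL1 p + η ∧ ∫ x, q x ≤ (∫ x, p x) + η ∧
      ∫⁻ x, (ENNReal.ofReal (q x) - ENNReal.ofReal (p x)) ≤ ENNReal.ofReal η ∧
      ∃ δ > 0, ∀ z ∈ Icc (0 : Fin d → ℝ) 1, ∀ z' ∈ Icc (0 : Fin d → ℝ) 1, ‖z' - z‖ < δ →
        ENNReal.ofReal (q z) ≤ 2 * ENNReal.ofReal (q z') := by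
  let χ : ContDiffBump (0 : Fin d → ℝ) := ⟨1, 2, one_pos, one_lt_two⟩
  have hχ : ContDiff ℝ 1 χ := χ.contDiff
  have hχc : HasCompactSupport χ := χ.hasCompactSupport
  have hχi : Integrable χ := χ.continuous.integrable_of_hasCompactSupport hχc
  have hpi : Integrable p := hp.continuous.integrable_of_hasCompactSupport hc
  have hg := gradL1_nonneg (χ : (Fin d → ℝ) → ℝ)
  have hI : 0 ≤ ∫ x, χ x := integral_nonneg fun x => χ.nonneg
  set κ : ℝ := η / (gradL1 χ + (∫ x, χ x) + 1) with hκ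
  have hκ0 : 0 < κ := by positivity
  have hκη : κ * gradL1 χ + κ * (∫ x, χ x) + κ = η := by
    rw [hκ]
    field_simp
  have hκg : 0 ≤ κ * gradL1 χ := by positivity
  have hκI : 0 ≤ κ * ∫ x, χ x := by positivity
  have hκχ : ContDiff ℝ 1 fun x => κ * χ x := contDiff_const.mul hχ
  have hκχc : HasCompactSupport fun x => κ * χ x := hχc.mul_left
  have hqc : HasCompactSupport fun x => p x + κ * χ x := hc.add hκχc
  have hq : ContDiff ℝ 1 fun x => p x + κ * χ x := hp.add hκχ
  refine ⟨fun x => p x + κ * χ x, hq, hqc,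
    fun x => le_add_of_nonneg_right (mul_nonneg hκ0.le χ.nonneg), ?_, ?_, ?_, ?_⟩
  · refine (gradL1_add_le hp hc hκχ hκχc).trans ?_
    rw [gradL1_const_mul hχ hκ0.le]
    linarith
  · rw [integral_add hpi (hχi.const_mul κ), integral_const_mul]
    linarith
  · calc ∫⁻ x, (ENNReal.ofReal (p x + κ * χ x) - ENNReal.ofReal (p x))
        ≤ ∫⁻ x, ENNReal.ofReal (κ * χ x) := lintegral_mono fun x => by
          rw [tsub_le_iff_left]
          exact ENNReal.ofReal_add_le
      _ ≤ _ := by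
          rw [← ofReal_integral_eq_lintegral_ofReal (hχi.const_mul κ)
            (ae_of_all _ fun x => mul_nonneg hκ0.le χ.nonneg), integral_const_mul]
          exact ENNReal.ofReal_le_ofReal (by linarith)
  · obtain ⟨δ, hδ, huc⟩ := Metric.uniformContinuous_iff.1
      (hqc.uniformContinuous_of_continuous hq.continuous) κ hκ0
    refine ⟨δ, hδ, fun z _ z' hz' hzz' => ?_⟩
    have h1 := huc (a := z') (b := z) (by rwa [dist_eq_norm])
    have h2 : χ z' = 1 := by
      refine χ.one_of_mem_closedBall ?_
      rw [mem_closedBall_zero_iff]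
      refine (pi_norm_le_iff_of_nonneg zero_le_one).2 fun i => ?_
      rw [Real.norm_eq_abs, abs_le]
      have a1 := hz'.1 i
      have a2 := hz'.2 i
      simp only [Pi.zero_apply, Pi.one_apply] at a1 a2
      constructor <;> linarith
    rw [Real.dist_eq, abs_lt] at h1
    rw [← ENNReal.ofReal_ofNat, ← ENNReal.ofReal_mul zero_le_two]
    refine ENNReal.ofReal_le_ofReal ?_
    simp only [h2] at h1 ⊢
    linarith [h0 z']

namespace PES6

variable {n : ℕ} (S : PES6 (n + 1))

/-- Every initial density is, up to an arbitrarily small mass and after enough iterations,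
bounded below on some ball of a fixed size. -/
theorem exists_ball_lintegral_tsub_le : ∃ ε > 0, ∀ g : (Fin (n + 1) → ℝ) → ℝ≥0∞, Measurable g →
    (∀ x ∉ S.Ω, g x = 0) → ∫⁻ x, g x = 1 → ∀ η : ℝ, 0 < η → ∃ N x, Metric.ball x ε ⊆ S.Ω ∧
      ∫⁻ y in Metric.ball x ε, (ENNReal.ofReal (1 / 16) - S.Lop^[N] g y) ≤ ENNReal.ofReal η := by
  obtain ⟨ν, hν0, hν1, hball⟩ := S.exists_ball_le_Lop_iterate
  obtain ⟨θ, B, hθ, hθ1, hB, hBV⟩ := S.exists_bvBound_iterate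
  obtain ⟨ε, hε, hball⟩ := hball (4 + 6 * B) 4 (by positivity) (by norm_num)
  refine ⟨ε, hε, fun g hg hgΩ hg1 η₀ hη₀ => ?_⟩
  obtain ⟨η, hη, hη1, hη2⟩ : ∃ η : ℝ, 0 < η ∧ η ≤ 1 / 12 ∧ 3 * η ≤ η₀ :=
    ⟨min (1 / 12) (η₀ / 3), by positivity, min_le_left _ _, by
      linarith [min_le_right (1 / 12) (η₀ / 3)]⟩
  have hgc : HasCompactSupport fun x => (g x).toReal :=
    HasCompactSupport.of_support_subset_isCompact
      (isCompact_Icc (a := (0 : Fin (n + 1) → ℝ)) (b := 1)) fun x hx => by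
        by_contra h
        exact hx (by simp [hgΩ x fun h' => h (S.Ω_subset h')])
  obtain ⟨p₀, hp₀, hp₀c, hp₀0, -, hp₀m, hp₀g, hgp₀⟩ :=
    exists_smooth_approx_lintegral hg (by simp [hg1]) hgc hη
  rw [hg1, ENNReal.toReal_one] at hp₀m
  set F₀ : (Fin (n + 1) → ℝ) → ℝ≥0∞ := fun x => ENNReal.ofReal (p₀ x) with hF₀
  have hF₀m : Measurable F₀ := hp₀.continuous.measurable.ennreal_ofReal
  have hbv₀ : BVBound F₀ (gradL1 p₀) 2 :=
    have h := BVBound.of_contDiff hp₀ hp₀c hp₀0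
    ⟨h.measurable, h.mass.trans (ENNReal.ofReal_le_ofReal (by linarith)), h.supp, h.var⟩
  obtain ⟨j, hj⟩ : ∃ j : ℕ, θ ^ j * gradL1 p₀ ≤ 1 := by
    have h := (tendsto_pow_atTop_nhds_zero_of_lt_one hθ hθ1).mul_const (gradL1 p₀)
    rw [zero_mul] at h
    exact (h.eventually_le_const one_pos).exists
  have hbv₁ : BVBound (S.Lop^[j] F₀) (1 + 2 * B) 2 :=
    (hBV _ _ _ zero_le_two hbv₀ j).mono (by linarith)
  set F := S.Lop^[j] F₀ with hF
  obtain ⟨p, hp, hpc, hp0, hpV, hpm, hpF, hFp⟩ :=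
    exists_smooth_approx_lintegral hbv₁.measurable hbv₁.lintegral_ne_top hbv₁.supp hη
  have hpm' := ENNReal.toReal_le_of_le_ofReal zero_le_two hbv₁.mass
  have hpV := hpV _ hbv₁.var
  obtain ⟨q, hq, hqc, hpq, hqV, hqm, hqp, δ, hδ, hqδ⟩ := exists_perturbation hp hpc hp0 hη
  have hq0 : ∀ x, 0 ≤ q x := fun x => (hp0 x).trans (hpq x)
  set f : (Fin (n + 1) → ℝ) → ℝ≥0∞ := fun x => ENNReal.ofReal (q x) with hf
  have hfm : Measurable f := hq.continuous.measurable.ennreal_ofReal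
  have hpm₁ : Measurable fun x => ENNReal.ofReal (p x) :=
    hp.continuous.measurable.ennreal_ofReal
  have hbv : BVBound f (2 + 2 * B) 4 :=
    have h := BVBound.of_contDiff hq hqc hq0
    ⟨h.measurable, h.mass.trans (ENNReal.ofReal_le_ofReal (by linarith)), h.supp,
      (h.mono (by linarith)).var⟩
  have hbvj : ∀ j, BVBound (S.Lop^[j] f) (4 + 6 * B) 4 := fun j =>
    (hBV _ _ _ zero_le_four hbv j).mono (by
      have h1 := mul_le_of_le_one_left (b := 2 + 2 * B) (by positivity)
        (pow_le_one₀ hθ hθ1.le : θ ^ j ≤ 1)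
      linarith)
  have hmass : ENNReal.ofReal (3 / 4) ≤ ∫⁻ x in S.Ω, f x := by
    have step : ∀ {u v : (Fin (n + 1) → ℝ) → ℝ≥0∞}, Measurable v →
        ∫⁻ x, (u x - v x) ≤ ENNReal.ofReal η →
        ∫⁻ x in S.Ω, u x ≤ (∫⁻ x in S.Ω, v x) + ENNReal.ofReal η := fun {u v} hv h => by
      calc ∫⁻ x in S.Ω, u x ≤ ∫⁻ x in S.Ω, (v x + (u x - v x)) :=
            lintegral_mono fun x => le_add_tsub
        _ ≤ _ := by
            rw [lintegral_add_left hv]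
            exact add_le_add_right ((setLIntegral_le_lintegral _ _).trans h) _
    have h1 := step hF₀m hgp₀
    rw [setLIntegral_eq_of_support_subset (fun x hx => by_contra fun h => hx (hgΩ x h)), hg1] at h1
    rw [← S.setLIntegral_Ω_Lop_iterate hF₀m j] at h1
    have h2 := step hpm₁ hFp
    have h3 : ∫⁻ x in S.Ω, ENNReal.ofReal (p x) ≤ ∫⁻ x in S.Ω, f x :=
      lintegral_mono fun x => ENNReal.ofReal_le_ofReal (hpq x)
    have h4 : 1 ≤ (∫⁻ x in S.Ω, f x) + ENNReal.ofReal (2 * η) := by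
      refine h1.trans ((add_le_add_left (h2.trans (add_le_add_left h3 _)) _).trans (le_of_eq ?_))
      rw [add_assoc, ← ENNReal.ofReal_add hη.le hη.le, two_mul]
    have h5 : ENNReal.ofReal (3 / 4) ≤ 1 - ENNReal.ofReal (2 * η) := by
      rw [← ENNReal.ofReal_one, ← ENNReal.ofReal_sub _ (by positivity)]
      exact ENNReal.ofReal_le_ofReal (by linarith)
    exact h5.trans (tsub_le_iff_right.2 h4)
  obtain ⟨N, hN⟩ : ∃ N : ℕ, ν ^ N * ε < δ := by
    have h := (tendsto_pow_atTop_nhds_zero_of_lt_one hν0.le hν1).mul_const ε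
    rw [zero_mul] at h
    exact (h.eventually_lt_const hδ).exists
  obtain ⟨x, hx, hxf⟩ := hball f hbvj hmass N fun z hz z' hz' h =>
    hqδ z (S.Ω_subset hz) z' (S.Ω_subset hz') (h.trans_lt hN)
  refine ⟨N + j, x, hx, ?_⟩
  have mf := S.measurable_Lop_iterate hfm N
  have mF := S.measurable_Lop_iterate hbv₁.measurable N
  have d1 : ∫⁻ y, (S.Lop^[N] f y - S.Lop^[N] F y) ≤ ENNReal.ofReal η + ENNReal.ofReal η := by
    refine (S.lintegral_Lop_iterate_tsub_le hfm hbv₁.measurable N).trans ?_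
    refine (lintegral_mono fun y => tsub_le_tsub_add_tsub (b := ENNReal.ofReal (p y))).trans ?_
    exact (lintegral_add_left (f := fun y => f y - ENNReal.ofReal (p y)) (hfm.sub hpm₁) _).trans_le
      (add_le_add hqp hpF)
  have d2 : ∫⁻ y, (S.Lop^[N] F y - S.Lop^[N + j] g y) ≤ ENNReal.ofReal η := by
    rw [hF, ← Function.iterate_add_apply]
    exact (S.lintegral_Lop_iterate_tsub_le hF₀m hg (N + j)).trans hp₀g
  calc ∫⁻ y in Metric.ball x ε, (ENNReal.ofReal (1 / 16) - S.Lop^[N + j] g y)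
      ≤ ∫⁻ y in Metric.ball x ε, (S.Lop^[N] f y - S.Lop^[N + j] g y) :=
        setLIntegral_mono' measurableSet_ball fun y hy => tsub_le_tsub_right (hxf y hy) _
    _ ≤ ∫⁻ y, ((S.Lop^[N] f y - S.Lop^[N] F y) + (S.Lop^[N] F y - S.Lop^[N + j] g y)) :=
        (setLIntegral_le_lintegral _ _).trans
          (lintegral_mono fun y => tsub_le_tsub_add_tsub)
    _ ≤ ENNReal.ofReal η + ENNReal.ofReal η + ENNReal.ofReal η := by
        exact (lintegral_add_left (f := fun y => S.Lop^[N] f y - S.Lop^[N] F y)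
          (mf.sub mF) _).trans_le (add_le_add d1 d2)
    _ ≤ ENNReal.ofReal η₀ := by
        rw [← ENNReal.ofReal_add hη.le hη.le, ← ENNReal.ofReal_add (by positivity) hη.le]
        exact ENNReal.ofReal_le_ofReal (by linarith)

end PES6

theorem lintegral_tsub_eq_zero_iff {α : Type*} [MeasurableSpace α] {μ : Measure α}
    {f g : α → ℝ≥0∞} (hf : Measurable f) (hg : Measurable g) :
    ∫⁻ x, (f x - g x) ∂μ = 0 ↔ f ≤ᵐ[μ] g := by
  have hfg : Measurable fun x => f x - g x := hf.sub hg
  rw [lintegral_eq_zero_iff hfg]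
  exact eventually_congr (ae_of_all _ fun x => tsub_eq_zero_iff_le)

/-- If `c ≤ H` up to an arbitrarily small mass on balls of radius `ε`, then `c ≤ H` on some
ball of radius `ε / 2`. -/
theorem exists_ball_half_ae_le {d : ℕ} {Ω : Set (Fin d → ℝ)} (hΩ : Ω ⊆ Icc 0 1) {ε : ℝ}
    (hε : 0 < ε) {c : ℝ≥0∞} {H : (Fin d → ℝ) → ℝ≥0∞} (hH : Measurable H)
    (h : ∀ η : ℝ, 0 < η → ∃ x, Metric.ball x ε ⊆ Ω ∧
      ∫⁻ y in Metric.ball x ε, (c - H y) ≤ ENNReal.ofReal η) :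
    ∃ x₀, Metric.ball x₀ (ε / 2) ⊆ Ω ∧
      ∀ᵐ y ∂volume.restrict (Metric.ball x₀ (ε / 2)), c ≤ H y := by
  choose x hxΩ hx using fun k : ℕ => h (1 / ((k : ℝ) + 1)) Nat.one_div_pos_of_nat
  obtain ⟨x₀, -, φ, hφ, hlim⟩ := isCompact_Icc.tendsto_subseq (x := x) fun k =>
    hΩ (hxΩ k (Metric.mem_ball_self hε))
  have hsub : ∀ᶠ k in atTop, Metric.ball x₀ (ε / 2) ⊆ Metric.ball (x (φ k)) ε := by
    filter_upwards [hlim.eventually (Metric.ball_mem_nhds x₀ (half_pos hε))] with k hk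
    refine Metric.ball_subset_ball' ?_
    have : dist x₀ (x (φ k)) < ε / 2 := by simpa [dist_comm] using hk
    linarith
  obtain ⟨k, hk⟩ := hsub.exists
  refine ⟨x₀, hk.trans (hxΩ _), ?_⟩
  have h0 : ∫⁻ y in Metric.ball x₀ (ε / 2), (c - H y) = 0 := by
    have hz : Tendsto (fun k => ENNReal.ofReal (1 / ((φ k : ℝ) + 1))) atTop (𝓝 0) := by
      rw [← ENNReal.ofReal_zero]
      exact ENNReal.tendsto_ofReal (tendsto_one_div_add_atTop_nhds_zero_nat.comp
        hφ.tendsto_atTop)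
    refine le_antisymm (ge_of_tendsto hz ?_) zero_le
    filter_upwards [hsub] with k hk
    exact (lintegral_mono_set hk).trans (hx _)
  exact (lintegral_tsub_eq_zero_iff measurable_const hH).1 h0

theorem IsDensity.exists_measurable {d : ℕ} {μ : Measure (Fin d → ℝ)} [IsFiniteMeasure μ]
    {h : (Fin d → ℝ) → ℝ} (hh : IsDensity μ h) :
    ∃ H : (Fin d → ℝ) → ℝ≥0∞, Measurable H ∧ (∀ x, H x ≤ ENNReal.ofReal (h x)) ∧
      μ = volume.withDensity H := by
  obtain ⟨H, hH, hle, heq⟩ := exists_measurable_le_lintegral_eq volume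
    fun x => ENNReal.ofReal (h x)
  have huniv : (volume.withDensity H) univ = μ univ := by
    rw [withDensity_apply _ .univ, hh _ .univ, setLIntegral_univ, setLIntegral_univ, heq]
  have : IsFiniteMeasure (volume.withDensity H) := ⟨huniv ▸ measure_lt_top μ univ⟩
  refine ⟨H, hH, hle, (Measure.eq_of_le_of_measure_univ_eq (Measure.le_iff.2 fun A hA => ?_)
    huniv).symm⟩
  rw [withDensity_apply _ hA, hh _ hA]
  exact lintegral_mono hle

namespace PES

variable {d : ℕ} (S : PES d)

theorem Lop_mono_ae {f g : (Fin d → ℝ) → ℝ≥0∞} (hf : Measurable f) (hg : Measurable g)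
    (h : f ≤ᵐ[volume] g) : S.Lop f ≤ᵐ[volume] S.Lop g := by
  rw [← lintegral_tsub_eq_zero_iff hf hg] at h
  rw [← lintegral_tsub_eq_zero_iff (S.measurable_Lop hf) (S.measurable_Lop hg)]
  exact le_antisymm ((S.lintegral_Lop_tsub_le hf hg).trans h.le) zero_le

theorem Lop_iterate_ae_eq {f : (Fin d → ℝ) → ℝ≥0∞} (hf : Measurable f)
    (h : S.Lop f =ᵐ[volume] f) (N : ℕ) : S.Lop^[N] f =ᵐ[volume] f := by
  induction N with
  | zero => rfl
  | succ N ih =>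
    rw [Function.iterate_succ_apply']
    have hm := S.measurable_Lop_iterate hf N
    exact ((S.Lop_mono_ae hm hf ih.le).antisymm (S.Lop_mono_ae hf hm ih.symm.le)).trans h

theorem Lop_iterate_ae_eq_zero {f : (Fin d → ℝ) → ℝ≥0∞} (hf : Measurable f)
    {W : Set (Fin d → ℝ)} (hW : MeasurableSet W) (hWT : ∀ᵐ x, x ∈ W → S.T x ∈ W)
    (h : ∀ᵐ x, x ∉ W → f x = 0) (N : ℕ) : ∀ᵐ x, x ∉ W → S.Lop^[N] f x = 0 := by
  induction N with
  | zero => exact h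
  | succ N ih =>
    have hm := S.measurable_Lop_iterate hf N
    rw [Function.iterate_succ_apply']
    have h0 : ∫⁻ x in Wᶜ, S.Lop (S.Lop^[N] f) x = 0 := by
      rw [S.setLIntegral_Lop hm hW.compl]
      refine lintegral_eq_zero_of_ae_eq_zero (ae_restrict_of_ae ?_)
      filter_upwards [hWT, ih] with x h1 h2
      by_cases hx : x ∈ W
      · simp [h1 hx]
      · simp [h2 hx]
    rw [lintegral_eq_zero_iff (S.measurable_Lop hm)] at h0
    exact (ae_restrict_iff' hW.compl).1 h0

/-- The density of an invariant measure is a fixed point of the transfer operator. -/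
theorem Lop_ae_eq_of_invariant {μ : Measure (Fin d → ℝ)} (hμ : InvariantMeasure S.Ω S.T μ)
    {H : (Fin d → ℝ) → ℝ≥0∞} (hH : Measurable H) (hμH : μ = volume.withDensity H) :
    S.Lop (S.Ω.indicator H) =ᵐ[volume] S.Ω.indicator H ∧ ∫⁻ x, S.Ω.indicator H x = 1 := by
  obtain ⟨hprob, -, hΩ, hinv⟩ := hμ
  have hind : Measurable (S.Ω.indicator H) := hH.indicator S.measurableSet_Ω
  have hres : μ = (volume.restrict S.Ω).withDensity H := by
    rw [← restrict_withDensity S.measurableSet_Ω, ← hμH]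
    exact (Measure.restrict_eq_self_of_ae_mem (mem_ae_iff.2 hΩ)).symm
  have hμi : μ = volume.withDensity (S.Ω.indicator H) := by
    rw [withDensity_indicator S.measurableSet_Ω, ← hres]
  have hmass : ∫⁻ x, S.Ω.indicator H x = 1 := by
    rw [← setLIntegral_univ, ← withDensity_apply _ .univ, ← hμi]
    exact measure_univ
  refine ⟨?_, hmass⟩
  have hT : AEMeasurable S.T μ :=
    S.aemeasurable_T.mono_ac (hres ▸ withDensity_absolutelyContinuous _ _)
  have hmap : Measure.map S.T μ = μ := by
    ext A hA
    rw [Measure.map_apply_of_aemeasurable hT hA, hinv A hA]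
  have hL : volume.withDensity (S.Lop (S.Ω.indicator H)) =
      volume.withDensity (S.Ω.indicator H) := by
    rw [S.Lop_congr (g := H) fun x hx => indicator_of_mem hx H, ← S.map_withDensity hH, ← hres,
      hmap, ← hμi]
  refine (withDensity_eq_iff (S.measurable_Lop hind).aemeasurable hind.aemeasurable ?_).1 hL
  exact ne_top_of_le_ne_top (hmass.trans_ne ENNReal.one_ne_top)
    (S.lintegral_Lop_iterate_le hind 1)

/-- The part of an invariant set outside of its essential interior is forward invariant. -/
theorem exists_isOpen_essential_interior {Δ : Set (Fin d → ℝ)} (hΔΩ : Δ ⊆ S.Ω)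
    (hΔ : volume (symmDiff (S.T ⁻¹' Δ) Δ) = 0) :
    ∃ V : Set (Fin d → ℝ), IsOpen V ∧ volume (V \ Δ) = 0 ∧
      (∀ U, IsOpen U → volume (U \ Δ) = 0 → U ⊆ V) ∧
      ∀ᵐ x, x ∈ Δ \ V → S.T x ∈ Δ \ V := by
  set 𝒰 : Set (Set (Fin d → ℝ)) := {U | IsOpen U ∧ volume (U \ Δ) = 0} with h𝒰
  have hmax : ∀ U, IsOpen U → volume (U \ Δ) = 0 → U ⊆ ⋃₀ 𝒰 := fun U hU h =>
    subset_sUnion_of_mem (show U ∈ 𝒰 from ⟨hU, h⟩)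
  have hopen : IsOpen (⋃₀ 𝒰) := isOpen_sUnion fun U hU => hU.1
  have hnull : volume (⋃₀ 𝒰 \ Δ) = 0 := by
    obtain ⟨𝒯, hc, hsub, heq⟩ := TopologicalSpace.isOpen_sUnion_countable 𝒰 fun U hU => hU.1
    rw [← heq, sUnion_eq_biUnion]
    simp only [iUnion_sdiff]
    exact (measure_biUnion_null_iff hc).2 fun U hU => (hsub hU).2
  refine ⟨⋃₀ 𝒰, hopen, hnull, hmax, ?_⟩
  rw [measure_symmDiff_eq_zero_iff] at hΔ
  have hpre : S.Ω ∩ S.T ⁻¹' ⋃₀ 𝒰 ⊆ ⋃₀ 𝒰 := by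
    refine hmax _ (S.continuousOn_T.isOpen_inter_preimage S.Ω_open hopen) ?_
    have h1 := S.volume_preimage_eq_zero hnull
    rw [← compl_mem_ae_iff] at h1 ⊢
    filter_upwards [h1, hΔ.mem_iff] with x hx hx' hxU
    exact hx ⟨hxU.1.1, hxU.1.2, fun h => hxU.2 (hx'.1 h)⟩
  filter_upwards [hΔ.mem_iff] with x hx hxW
  exact ⟨hx.2 hxW.1, fun h => hxW.2 (hpre ⟨hΔΩ hxW.1, h⟩)⟩

end PES

theorem statement4 {d : ℕ} (hd : 1 ≤ d) (S : PES6 d) :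
    ∃ εst > (0:ℝ),
      (∀ (μ : Measure (Fin d → ℝ)) (h : (Fin d → ℝ) → ℝ),
        InvariantMeasure S.Ω S.T μ → IsDensity μ h →
        ∃ x₀ : Fin d → ℝ, Metric.ball x₀ (εst / 2) ⊆ S.Ω ∧
          ∃ c > (0:ℝ), ∀ᵐ x ∂(volume.restrict (Metric.ball x₀ (εst / 2))), c ≤ h x) ∧
      (∀ Δ : Set (Fin d → ℝ), MeasurableSet Δ → Δ ⊆ S.Ω → 0 < volume Δ →
        volume (symmDiff (S.T ⁻¹' Δ) Δ) = 0 →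
        (∀ A : Set (Fin d → ℝ), MeasurableSet A → A ⊆ Δ →
          volume (symmDiff (S.T ⁻¹' A) A) = 0 →
          volume A = 0 ∨ volume (Δ \ A) = 0) →
        ∃ U : Set (Fin d → ℝ), IsOpen U ∧ volume (symmDiff Δ U) = 0) := by
  obtain ⟨n, rfl⟩ : ∃ n, d = n + 1 := ⟨d - 1, by lia⟩
  obtain ⟨ε, hε, hmain⟩ := S.exists_ball_lintegral_tsub_le
  refine ⟨ε, hε, fun μ h hμ hh => ?_, fun Δ hΔm hΔΩ _ hΔ _ => ?_⟩
  · have := hμ.1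
    obtain ⟨H, hH, hHh, hμH⟩ := hh.exists_measurable
    have hind : Measurable (S.Ω.indicator H) := hH.indicator S.measurableSet_Ω
    obtain ⟨hfix, hmass⟩ := S.Lop_ae_eq_of_invariant hμ hH hμH
    obtain ⟨x₀, hx₀, hle⟩ := exists_ball_half_ae_le S.Ω_subset hε
      (c := ENNReal.ofReal (1 / 16)) hind fun η hη => by
        obtain ⟨N, x, hx, hxη⟩ := hmain _ hind (fun x hx => indicator_of_notMem hx H) hmass η hη
        refine ⟨x, hx, le_of_eq_of_le (lintegral_congr_ae (ae_restrict_of_ae ?_)) hxη⟩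
        filter_upwards [S.Lop_iterate_ae_eq hind hfix N] with y hy
        rw [hy]
    refine ⟨x₀, hx₀, 1 / 16, by norm_num, ?_⟩
    filter_upwards [hle] with y hy
    have h1 : ENNReal.ofReal (1 / 16) ≤ ENNReal.ofReal (h y) :=
      hy.trans ((indicator_le_self S.Ω H y).trans (hHh y))
    rcases ENNReal.ofReal_le_ofReal_iff'.1 h1 with h2 | h2
    · exact h2
    · norm_num at h2
  · obtain ⟨V, hV, hVΔ, hmax, hT⟩ := S.exists_isOpen_essential_interior hΔΩ hΔ
    have hWm : MeasurableSet (Δ \ V) := hΔm.diff hV.measurableSet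
    suffices hW : volume (Δ \ V) = 0 from ⟨V, hV, by
      rw [Set.symmDiff_def]
      exact measure_union_null hW hVΔ⟩
    by_contra hW
    have hWΩ : Δ \ V ⊆ S.Ω := sdiff_subset.trans hΔΩ
    have hWtop : volume (Δ \ V) ≠ ⊤ :=
      ne_top_of_le_ne_top ENNReal.one_ne_top ((measure_mono hWΩ).trans S.volume_Ω_le_one)
    set g : (Fin (n + 1) → ℝ) → ℝ≥0∞ := (Δ \ V).indicator fun _ => (volume (Δ \ V))⁻¹ with hg
    have hgm : Measurable g := measurable_const.indicator hWm
    have hg1 : ∫⁻ x, g x = 1 := by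
      rw [hg, lintegral_indicator_const hWm, ENNReal.inv_mul_cancel hW hWtop]
    obtain ⟨x₀, hx₀, hle⟩ := exists_ball_half_ae_le S.Ω_subset hε
      (c := ENNReal.ofReal (1 / 16)) (H := (Δ \ V).indicator fun _ => ⊤)
      (measurable_const.indicator hWm) fun η hη => by
        obtain ⟨N, x, hx, hxη⟩ := hmain g hgm
          (fun x hx => indicator_of_notMem (fun h => hx (hWΩ h)) _) hg1 η hη
        refine ⟨x, hx, (lintegral_mono_ae (ae_restrict_of_ae ?_)).trans hxη⟩
        filter_upwards [S.Lop_iterate_ae_eq_zero hgm hWm hT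
          (ae_of_all _ fun y hy => indicator_of_notMem hy _) N] with y hy
        by_cases hyW : y ∈ Δ \ V
        · simp [indicator_of_mem hyW]
        · simp [hy hyW]
    have hball : ∀ᵐ y, y ∈ Metric.ball x₀ (ε / 2) → y ∈ Δ \ V := by
      filter_upwards [(ae_restrict_iff' measurableSet_ball).1 hle] with y hy hyB
      by_contra hyW
      have := hy hyB
      rw [indicator_of_notMem hyW] at this
      norm_num at this
    have hsub : Metric.ball x₀ (ε / 2) ⊆ V := by
      refine hmax _ Metric.isOpen_ball ?_
      rw [← compl_mem_ae_iff]
      filter_upwards [hball] with y hy hyB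
      exact hyB.2 (hy hyB.1).1
    refine (Metric.measure_ball_pos volume x₀ (half_pos hε)).ne' ?_
    rw [← compl_mem_ae_iff]
    filter_upwards [hball] with y hy hyB
    exact (hy hyB).2 (hsub hyB)

end Liverani
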